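/- arXiv:2007.08324 — 2 statements merged into one kernel-verified Lean document; each statement's English description precedes it below -/
import Mathlib

section
/- For every graph G and every integer k ≥ 2, the edges of G can be colored with at most 198k − 101 colors so that in the subgraph spanned by the edges of each color, every vertex has degree congruent to 1 modulo k. -/
/-- The number of edges of `G` incident to `v` that receive color `i` under `c`. -/
def colorDeg {V : Type*} [Fintype V] [DecidableEq V] (G : SimpleGraph V)
    [DecidableRel G.Adj] {m : ℕ} (c : Sym2 V → Fin m) (i : Fin m) (v : V) : ℕ :=
  ((G.incidenceFinset v).filter (fun e => c e = i)).card

/-- `c` is a χ'_k-coloring of `G`: in the subgraph spanned by the edges of each color,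
every vertex has degree congruent to 1 modulo `k` (vertices incident to no edge of that
color are not in that subgraph). -/
def IsChiPrimeKColoring {V : Type*} [Fintype V] [DecidableEq V] (G : SimpleGraph V)
    [DecidableRel G.Adj] (k : ℕ) {m : ℕ} (c : Sym2 V → Fin m) : Prop :=
  ∀ i : Fin m, ∀ v : V, colorDeg G c i v = 0 ∨ colorDeg G c i v % k = 1

open Matrix in
theorem Matrix.PosDef.sq_dotProduct_le {α : Type*} [Fintype α] [DecidableEq α]
    {M : Matrix α α ℝ} (hM : M.PosDef) (x φ : α → ℝ) :
    (x ⬝ᵥ φ) ^ 2 ≤ (x ⬝ᵥ M⁻¹ *ᵥ x) * (φ ⬝ᵥ M *ᵥ φ) := by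
  have hψ : M *ᵥ (M⁻¹ *ᵥ x) = x := by
    rw [mulVec_mulVec, mul_nonsing_inv _ ((isUnit_iff_isUnit_det _).1 hM.isUnit), one_mulVec]
  have hT : Mᵀ = M := by simpa [IsHermitian, conjTranspose_eq_transpose_of_trivial] using hM.1
  have key : ∀ t : ℝ, 0 ≤ (φ ⬝ᵥ M *ᵥ φ) * (t * t) + (2 * (x ⬝ᵥ φ)) * t + (x ⬝ᵥ M⁻¹ *ᵥ x) := by
    intro t
    have h := hM.posSemidef.dotProduct_mulVec_nonneg (M⁻¹ *ᵥ x + t • φ)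
    have h2 : (M⁻¹ *ᵥ x) ⬝ᵥ (M *ᵥ φ) = x ⬝ᵥ φ := by
      rw [dotProduct_mulVec, ← mulVec_transpose, hT, hψ]
    simp only [star_trivial, mulVec_add, mulVec_smul, hψ, add_dotProduct, dotProduct_add,
      smul_dotProduct, dotProduct_smul, h2, smul_eq_mul] at h
    rw [dotProduct_comm φ x, dotProduct_comm (M⁻¹ *ᵥ x) x] at h
    linarith
  have := discrim_le_zero key
  rw [discrim] at this
  nlinarith

open Matrix in
/-- Regularized form of `exists_reweighting`. -/
theorem exists_reweighting_of_pos {ι α : Type*} [Fintype ι] [Fintype α] (b : ι → α → ℝ)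
    {K η : ℝ} (hK : 0 < K) (hη : 0 < η) (hcard : K * Fintype.card α < Fintype.card ι) :
    ∃ c : ι → ℝ, c ∈ Set.Icc 0 1 ∧ (∃ e, c e = 1) ∧
      ∀ φ e, K * c e * (b e ⬝ᵥ φ) ^ 2 ≤ ∑ f, c f * (b f ⬝ᵥ φ) ^ 2 + η * (φ ⬝ᵥ φ) := by
  classical
  let S : Set (ι → ℝ) := {c | ∀ φ e, K * c e * (b e ⬝ᵥ φ) ^ 2 ≤
    ∑ f, c f * (b f ⬝ᵥ φ) ^ 2 + η * (φ ⬝ᵥ φ)}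
  have hS : IsClosed S := by
    simp only [S, Set.ofPred_forall]
    exact isClosed_iInter fun φ => isClosed_iInter fun e =>
      isClosed_le (by fun_prop) (by fun_prop)
  have hcomp : IsCompact (Set.Icc (0 : ι → ℝ) 1 ∩ S) := isCompact_Icc.inter_right hS
  have hφ : ∀ φ : α → ℝ, 0 ≤ φ ⬝ᵥ φ := fun φ => by
    simpa using dotProduct_star_self_nonneg φ
  obtain ⟨c, ⟨hc, hcS⟩, hmax⟩ := hcomp.exists_isMaxOn (f := fun c : ι → ℝ => ∑ e, c e)
    ⟨0, ⟨le_rfl, zero_le_one⟩, fun φ e => by simpa using mul_nonneg hη.le (hφ φ)⟩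
    (by fun_prop)
  refine ⟨c, hc, ?_, hcS⟩
  by_contra! hne
  have hlt : ∀ e, c e < 1 := fun e => lt_of_le_of_ne (hc.2 e) (hne e)
  let B : Matrix ι α ℝ := b
  let M : Matrix α α ℝ := η • (1 : Matrix α α ℝ) + Bᵀ * diagonal c * B
  have hdiag : (diagonal c).PosSemidef := posSemidef_diagonal_iff.2 hc.1
  have hM : M.PosDef := by
    refine (PosDef.one.smul hη).add_posSemidef ?_
    simpa [conjTranspose_eq_transpose_of_trivial] using hdiag.conjTranspose_mul_mul_same B
  have hquad : ∀ φ, φ ⬝ᵥ M *ᵥ φ = ∑ f, c f * (b f ⬝ᵥ φ) ^ 2 + η * (φ ⬝ᵥ φ) := by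
    intro φ
    have h1 : φ ⬝ᵥ (Bᵀ * diagonal c * B) *ᵥ φ = ∑ f, c f * (b f ⬝ᵥ φ) ^ 2 := by
      rw [← mulVec_mulVec, ← mulVec_mulVec, dotProduct_mulVec, vecMul_transpose]
      simp only [dotProduct, mulVec_diagonal]
      refine Finset.sum_congr rfl fun f _ => ?_
      simp only [mulVec, B, dotProduct]
      ring
    simp only [M, add_mulVec, dotProduct_add, h1, smul_mulVec, one_mulVec, dotProduct_smul,
      smul_eq_mul]
    ring
  let R : ι → ℝ := fun e => b e ⬝ᵥ M⁻¹ *ᵥ b e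
  have hR : ∀ e, 0 ≤ R e := fun e => by
    simpa using hM.inv.posSemidef.dotProduct_mulVec_nonneg (b e)
  have hsum : ∑ e, c e * R e ≤ Fintype.card α := by
    have h1 : ∑ e, c e * R e = (diagonal c * B * M⁻¹ * Bᵀ).trace := by
      simp only [trace, diag_apply, Matrix.mul_assoc, diagonal_mul]
      refine Finset.sum_congr rfl fun e _ => ?_
      congr 1
    have h2 : (diagonal c * B * M⁻¹ * Bᵀ).trace = (M⁻¹ * (Bᵀ * diagonal c * B)).trace := by
      rw [trace_mul_comm, ← Matrix.mul_assoc, trace_mul_comm, Matrix.mul_assoc Bᵀ]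
    have h3 : Bᵀ * diagonal c * B = M - η • 1 := by simp [M]
    rw [h1, h2, h3, Matrix.mul_sub, nonsing_inv_mul _ ((isUnit_iff_isUnit_det _).1 hM.isUnit)]
    have := mul_nonneg hη.le hM.inv.posSemidef.trace_nonneg
    simpa [trace_sub, trace_smul] using this
  obtain ⟨e, he⟩ : ∃ e, K * (c e * R e) < 1 := by
    by_contra! h
    have : ∑ e : ι, (1 : ℝ) ≤ ∑ e, K * (c e * R e) := Finset.sum_le_sum fun e _ => h e
    rw [← Finset.mul_sum] at this
    simp only [Finset.sum_const, Finset.card_univ, nsmul_eq_mul, mul_one] at this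
    nlinarith
  obtain ⟨ε, hε, hε1, hε2⟩ : ∃ ε : ℝ, 0 < ε ∧ c e + ε ≤ 1 ∧ K * ((c e + ε) * R e) ≤ 1 := by
    have hpos : 0 < K * R e + 1 := by have := mul_nonneg hK.le (hR e); linarith
    refine ⟨min (1 - c e) ((1 - K * (c e * R e)) / (K * R e + 1)), ?_, ?_, ?_⟩
    · exact lt_min (by linarith [hlt e]) (div_pos (by linarith) hpos)
    · linarith [min_le_left (1 - c e) ((1 - K * (c e * R e)) / (K * R e + 1))]
    · have h1 := min_le_right (1 - c e) ((1 - K * (c e * R e)) / (K * R e + 1))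
      have h2 : 0 < min (1 - c e) ((1 - K * (c e * R e)) / (K * R e + 1)) :=
        lt_min (by linarith [hlt e]) (div_pos (by linarith) hpos)
      rw [le_div_iff₀ hpos] at h1
      nlinarith
  let c' : ι → ℝ := c + Pi.single e ε
  have hsum' : ∀ φ, ∑ f, c' f * (b f ⬝ᵥ φ) ^ 2 =
      ∑ f, c f * (b f ⬝ᵥ φ) ^ 2 + ε * (b e ⬝ᵥ φ) ^ 2 := by
    intro φ
    simp [c', add_mul, Finset.sum_add_distrib, Pi.single_apply]
  have hc' : c' ∈ Set.Icc 0 1 ∩ S := by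
    refine ⟨⟨fun f => ?_, fun f => ?_⟩, fun φ f => ?_⟩
    · by_cases hf : f = e
      · subst hf; have := hc.1 f; simp only [Pi.zero_apply] at this; simp [c']; linarith
      · simpa [c', hf] using hc.1 f
    · by_cases hf : f = e
      · subst hf; simpa [c'] using hε1
      · simpa [c', hf] using hc.2 f
    · rw [hsum']
      by_cases hf : f = e
      · subst hf
        have h1 := hM.sq_dotProduct_le (b f) φ
        rw [hquad] at h1
        have hce : c' f = c f + ε := by simp [c']
        have hQ : 0 ≤ ∑ f, c f * (b f ⬝ᵥ φ) ^ 2 + η * (φ ⬝ᵥ φ) :=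
          add_nonneg (Finset.sum_nonneg fun f _ => mul_nonneg (hc.1 f) (sq_nonneg _))
            (mul_nonneg hη.le (hφ φ))
        have h0 : 0 ≤ K * (c f + ε) := mul_nonneg hK.le (by have := hc.1 f; simp at this; linarith)
        have h2 := mul_le_mul_of_nonneg_left h1 h0
        have h3 := mul_le_mul_of_nonneg_right hε2 hQ
        have h4 : 0 ≤ ε * (b f ⬝ᵥ φ) ^ 2 := by positivity
        rw [hce]
        change _ ≤ K * (c f + ε) * (R f * _) at h2
        linarith
      · have h1 := hcS φ f
        have h4 : 0 ≤ ε * (b e ⬝ᵥ φ) ^ 2 := by positivity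
        have hce : c' f = c f := by simp [c', hf]
        rw [hce]
        linarith
  have := hmax hc'
  simp only [Set.mem_ofPred_eq, c', Pi.add_apply, Finset.sum_add_distrib,
    Finset.sum_pi_single', Finset.mem_univ, if_true] at this
  linarith

open Matrix in
/-- If a system of vectors is much larger than the dimension, it carries a nonzero weighting
for which all leverage scores are at most `1 / K`. -/
theorem exists_reweighting {ι α : Type*} [Fintype ι] [Fintype α] (b : ι → α → ℝ)
    {K : ℝ} (hK : 0 < K) (hcard : K * Fintype.card α < Fintype.card ι) :
    ∃ c : ι → ℝ, c ∈ Set.Icc 0 1 ∧ (∃ e, c e = 1) ∧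
      ∀ φ e, K * c e * (b e ⬝ᵥ φ) ^ 2 ≤ ∑ f, c f * (b f ⬝ᵥ φ) ^ 2 := by
  let T : {η : ℝ // 0 < η} → Set (ι → ℝ) := fun η => {c | c ∈ Set.Icc 0 1 ∧ (∃ e, c e = 1) ∧
      ∀ φ e, K * c e * (b e ⬝ᵥ φ) ^ 2 ≤ ∑ f, c f * (b f ⬝ᵥ φ) ^ 2 + η * (φ ⬝ᵥ φ)}
  have hφ : ∀ φ : α → ℝ, 0 ≤ φ ⬝ᵥ φ := fun φ => by
    simpa using dotProduct_star_self_nonneg φ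
  have hclosed : ∀ η, IsClosed (T η) := by
    intro η
    refine isClosed_Icc.inter (IsClosed.inter (s₁ := {c : ι → ℝ | ∃ e, c e = 1}) ?_
      (s₂ := {c : ι → ℝ | ∀ φ e, K * c e * (b e ⬝ᵥ φ) ^ 2 ≤
        ∑ f, c f * (b f ⬝ᵥ φ) ^ 2 + η * (φ ⬝ᵥ φ)}) ?_)
    · simp only [Set.ofPred_exists]
      exact isClosed_iUnion_of_finite fun e => isClosed_eq (by fun_prop) (by fun_prop)
    · simp only [Set.ofPred_forall]
      exact isClosed_iInter fun φ => isClosed_iInter fun e =>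
        isClosed_le (by fun_prop) (by fun_prop)
  have : Nonempty {η : ℝ // 0 < η} := ⟨⟨1, one_pos⟩⟩
  have hmono : ∀ η η' : {η : ℝ // 0 < η}, η ≤ η' → T η ⊆ T η' := fun η η' h c hc =>
    ⟨hc.1, hc.2.1, fun φ e => (hc.2.2 φ e).trans
      (by have := mul_le_mul_of_nonneg_right (Subtype.coe_le_coe.2 h) (hφ φ); linarith)⟩
  obtain ⟨c, hc⟩ := IsCompact.nonempty_iInter_of_directed_nonempty_isCompact_isClosed T
    (fun η η' => ⟨min η η', hmono _ _ (min_le_left _ _), hmono _ _ (min_le_right _ _)⟩)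
    (fun η => exists_reweighting_of_pos b hK η.2 hcard)
    (fun η => isCompact_Icc.of_isClosed_subset (hclosed η) fun c hc => hc.1) hclosed
  rw [Set.mem_iInter] at hc
  refine ⟨c, (hc ⟨1, one_pos⟩).1, (hc ⟨1, one_pos⟩).2.1, fun φ e => ?_⟩
  refine le_of_forall_pos_le_add fun ε hε => ?_
  have hpos : 0 < φ ⬝ᵥ φ + 1 := by linarith [hφ φ]
  refine ((hc ⟨ε / (φ ⬝ᵥ φ + 1), div_pos hε hpos⟩).2.2 φ e).trans ?_
  gcongr
  rw [div_mul_eq_mul_div, div_le_iff₀ hpos]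
  nlinarith [hφ φ]

open Matrix in
/-- Given a weighting with leverage scores at most `1 / K`, every starting point can be corrected,
modulo multiples of `k` on each coordinate, to an almost minimal solution with small entries. -/
theorem exists_small_correction {ι α : Type*} [Fintype ι] (b : ι → α → ℝ)
    [Fintype α] {k K : ℝ} (hk : 0 < k) (hK : 0 < K) {c : ι → ℝ} (hc : c ∈ Set.Icc 0 1)
    (hcK : ∀ φ e, K * c e * (b e ⬝ᵥ φ) ^ 2 ≤ ∑ f, c f * (b f ⬝ᵥ φ) ^ 2) (x : ι → ℝ)
    {ε : ℝ} (hε : 0 < ε) :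
    ∃ (f : ι → ℝ) (m : ι → ℤ), (∀ e, |f e| ≤ k / (2 * K) + ε) ∧ (∀ e, c e = 0 → f e = 0) ∧
      ∀ φ, ∑ e, f e * (b e ⬝ᵥ φ) = ∑ e with c e ≠ 0, (x e + k * m e) * (b e ⬝ᵥ φ) := by
  classical
  let a : (α → ℝ) →ₗ[ℝ] EuclideanSpace ℝ ι :=
    { toFun := fun φ => WithLp.toLp 2 fun e => √(c e) * (b e ⬝ᵥ φ)
      map_add' := fun φ ψ => by ext e; simp [mul_add]
      map_smul' := fun t φ => by ext e; simp; ring }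
  have ha : ∀ φ e, a φ e = √(c e) * (b e ⬝ᵥ φ) := fun _ _ => rfl
  let U := LinearMap.range a
  let P := U.starProjection
  let ε₁ : ι → EuclideanSpace ℝ ι := fun e => EuclideanSpace.single e 1
  let w : (ι → ℤ) → EuclideanSpace ℝ ι := fun m => WithLp.toLp 2 fun e => (√(c e))⁻¹ * (x e + k * m e)
  have hc0 : ∀ e, 0 ≤ c e := hc.1
  have hc1 : ∀ e, c e ≤ 1 := hc.2
  have hPapply : ∀ u e, P u e = inner ℝ (P (ε₁ e)) u := by
    intro u e
    rw [Submodule.inner_starProjection_left_eq_right]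
    simp [ε₁, EuclideanSpace.inner_single_left, P]
  have hPmem : ∀ u, P u ∈ U := fun u => Submodule.starProjection_apply_mem U u
  have hPP : ∀ u v, inner ℝ (P u) (P v) = inner ℝ (P u) v := by
    intro u v
    rw [← Submodule.inner_starProjection_left_eq_right]
    congr 1
    exact Submodule.starProjection_eq_self_iff.2 (hPmem u)
  have hU : ∀ u ∈ U, ∀ e, K * u e ^ 2 ≤ ‖u‖ ^ 2 := by
    rintro _ ⟨φ, rfl⟩ e
    rw [EuclideanSpace.real_norm_sq_eq]
    simp only [ha, mul_pow, Real.sq_sqrt (hc0 _)]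
    linarith [hcK φ e]
  have hlev : ∀ e, ‖P (ε₁ e)‖ ^ 2 ≤ 1 / K := by
    intro e
    have h1 := hU _ (hPmem (ε₁ e)) e
    rw [hPapply, ← hPP, real_inner_self_eq_norm_sq] at h1
    rw [le_div_iff₀ hK]
    by_contra! h
    nlinarith
  have hbdd : BddBelow (Set.range fun m => ‖P (w m)‖ ^ 2) :=
    ⟨0, by rintro _ ⟨m, rfl⟩; positivity⟩
  obtain ⟨m, hm⟩ : ∃ m, ‖P (w m)‖ ^ 2 < (⨅ m, ‖P (w m)‖ ^ 2) + 2 * k * ε :=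
    exists_lt_of_ciInf_lt (lt_add_of_pos_right _ (by positivity))
  refine ⟨fun e => √(c e) * P (w m) e, m, fun e => ?_, fun e he => by simp [he], fun φ => ?_⟩
  · rcases eq_or_ne (c e) 0 with he | he
    · simp only [he, Real.sqrt_zero, zero_mul, abs_zero]; positivity
    have hs : 0 < √(c e) := Real.sqrt_pos.2 (lt_of_le_of_ne (hc0 e) he.symm)
    have hs1 : √(c e) ≤ 1 := Real.sqrt_le_one.2 (hc1 e)
    have hstep : ∀ j : ℤ, 2 * k * (j * (√(c e) * P (w m) e)) + k ^ 2 * j ^ 2 * (1 / K) +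
        2 * k * ε ≥ 0 := by
      intro j
      have hw : w (m + Pi.single e j) = w m + ((√(c e))⁻¹ * k * j) • ε₁ e := by
        ext e'
        by_cases h : e' = e
        · subst h; simp [w, ε₁]; ring
        · simp [w, ε₁, h]
      have h1 := (ciInf_le hbdd (m + Pi.single e j))
      simp only [hw, map_add, map_smul] at h1
      rw [norm_add_sq_real, norm_smul, mul_pow, inner_smul_right, real_inner_comm, hPP,
        ← hPapply, Real.norm_eq_abs, sq_abs] at h1
      set s := √(c e)
      set p := P (w m) e
      have h2 : 0 ≤ 2 * (s⁻¹ * k * j * p) + (s⁻¹ * k * j) ^ 2 * ‖P (ε₁ e)‖ ^ 2 + 2 * k * ε := by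
        linarith
      have h3 : (s⁻¹ * k * j) ^ 2 * ‖P (ε₁ e)‖ ^ 2 ≤ (s⁻¹ * k * j) ^ 2 * (1 / K) :=
        mul_le_mul_of_nonneg_left (hlev e) (sq_nonneg _)
      have h4 := mul_nonneg (sq_nonneg s) (h2.trans (by linarith [h3] : _ ≤
        2 * (s⁻¹ * k * j * p) + (s⁻¹ * k * j) ^ 2 * (1 / K) + 2 * k * ε))
      have h5 : s ^ 2 * (2 * (s⁻¹ * k * j * p) + (s⁻¹ * k * j) ^ 2 * (1 / K) + 2 * k * ε) =
          2 * k * (j * (s * p)) + k ^ 2 * j ^ 2 * (1 / K) + s ^ 2 * (2 * k * ε) := by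
        field_simp
      have h6 : s ^ 2 * (2 * k * ε) ≤ 1 * (2 * k * ε) :=
        mul_le_mul_of_nonneg_right (by nlinarith) (by positivity)
      linarith
    have h1 := hstep 1
    have h2 := hstep (-1)
    push_cast at h1 h2
    have h3 : k / (2 * K) = k * (1 / K) / 2 := by field_simp
    rw [h3, abs_le]
    constructor
    · refine le_of_mul_le_mul_left (a := 2 * k) ?_ (by positivity)
      linarith
    · refine le_of_mul_le_mul_left (a := 2 * k) ?_ (by positivity)
      linarith
  · have h1 : inner ℝ (P (w m)) (a φ) = inner ℝ (w m) (a φ) := by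
      rw [Submodule.inner_starProjection_left_eq_right]
      congr 1
      exact Submodule.starProjection_eq_self_iff.2 (LinearMap.mem_range_self a φ)
    simp only [PiLp.inner_apply, ha] at h1
    simp only [RCLike.inner_apply, conj_trivial] at h1
    rw [Finset.sum_filter]
    calc _ = _ := Finset.sum_congr rfl fun e _ => by ring
      _ = _ := h1
      _ = _ := Finset.sum_congr rfl fun e _ => ?_
    split_ifs with he
    · have hs : 0 < √(c e) := Real.sqrt_pos.2 (lt_of_le_of_ne (hc0 e) (Ne.symm he))
      simp only [w]
      field_simp
    · simp [not_not.1 he]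

theorem exists_ne_fractional_of_sum_eq_int {ι : Type*} {A : Finset ι} {z : ι → ℝ} {n : ℤ}
    (h0 : ∀ e, 0 ≤ z e) (h1 : ∀ e, z e ≤ 1) (hsum : ∑ e ∈ A, z e = n) {e : ι} (he : e ∈ A)
    (hz0 : z e ≠ 0) (hz1 : z e ≠ 1) : ∃ e' ∈ A, e' ≠ e ∧ z e' ≠ 0 ∧ z e' ≠ 1 := by
  classical
  by_contra! h
  have hint : ∀ e' ∈ A.erase e, ∃ j : ℤ, z e' = j := fun e' he' => by
    rw [Finset.mem_erase] at he'
    by_cases h' : z e' = 0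
    · exact ⟨0, by simpa using h'⟩
    · exact ⟨1, by simpa using h e' he'.2 he'.1 h'⟩
  choose! j hj using hint
  rw [← Finset.add_sum_erase _ _ he, Finset.sum_congr rfl hj, ← Int.cast_sum] at hsum
  have hze : z e = ((n - ∑ e' ∈ A.erase e, j e' : ℤ) : ℝ) := by push_cast at hsum ⊢; linarith
  have hpos : 0 < z e := lt_of_le_of_ne (h0 e) hz0.symm
  have hlt : z e < 1 := lt_of_le_of_ne (h1 e) hz1
  rw [hze] at hpos hlt
  have := Int.cast_pos.1 hpos
  have : (n - ∑ e' ∈ A.erase e, j e' : ℤ) < 1 := by exact_mod_cast hlt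
  omega

/-- Too many coordinates supported on `T`, where every fiber of `s` and of `t` on `T` has at least
two elements, carry a nonzero vector whose fiber sums all vanish. -/
theorem exists_ne_zero_fiber_sums_eq_zero {ι α : Type*} [Fintype ι] [Fintype α] [DecidableEq α]
    (s t : ι → α) {T : Finset ι} (hT : T.Nonempty)
    (hs : ∀ e ∈ T, ∃ e' ∈ T, e' ≠ e ∧ s e' = s e) (ht : ∀ e ∈ T, ∃ e' ∈ T, e' ≠ e ∧ t e' = t e) :
    ∃ z : ι → ℝ, z ≠ 0 ∧ (∀ e ∉ T, z e = 0) ∧ (∀ v, ∑ e with s e = v, z e = 0) ∧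
      ∀ v, ∑ e with t e = v, z e = 0 := by
  classical
  have hcard : ∀ r : ι → α, (∀ e ∈ T, ∃ e' ∈ T, e' ≠ e ∧ r e' = r e) →
      2 * (T.image r).card ≤ T.card := by
    intro r hr
    refine Finset.mul_card_image_le_card _ _ fun v hv => ?_
    obtain ⟨e, he, rfl⟩ := Finset.mem_image.1 hv
    obtain ⟨e', he', hne, h⟩ := hr e he
    exact Finset.one_lt_card.2 ⟨e', by simp [he', h], e, by simp [he], hne⟩
  obtain ⟨e₀, he₀⟩ := hT
  let f : (ι → ℝ) →ₗ[ℝ]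
      (((Tᶜ : Finset ι) ⊕ (T.image s) ⊕ ((T.image t).erase (t e₀) : Finset α)) → ℝ) :=
    LinearMap.pi (Sum.elim (fun e => LinearMap.proj e.1)
      (Sum.elim (fun v => ∑ e with s e = v.1, LinearMap.proj e)
        (fun v => ∑ e with t e = v.1, LinearMap.proj e)))
  have hlt : Module.finrank ℝ
      (((Tᶜ : Finset ι) ⊕ (T.image s) ⊕ ((T.image t).erase (t e₀) : Finset α)) → ℝ) <
      Module.finrank ℝ (ι → ℝ) := by
    simp only [Module.finrank_fintype_fun_eq_card, Fintype.card_sum, Fintype.card_coe]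
    have h1 := hcard s hs
    have h2 := hcard t ht
    have h3 := Finset.card_erase_add_one (Finset.mem_image_of_mem t he₀)
    have h4 := Finset.card_compl_add_card T
    omega
  obtain ⟨z, hz, hz0⟩ := (Submodule.ne_bot_iff _).1 (LinearMap.ker_ne_bot_of_finrank_lt (f := f) hlt)
  rw [LinearMap.mem_ker] at hz
  have hzT : ∀ e ∉ T, z e = 0 := fun e he => by
    simpa [f] using congrFun hz (Sum.inl ⟨e, by simpa using he⟩)
  have hout : ∀ (r : ι → α) v, v ∉ T.image r → ∑ e with r e = v, z e = 0 := by
    intro r v hv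
    refine Finset.sum_eq_zero fun e he => hzT e fun heT => hv ?_
    exact Finset.mem_image.2 ⟨e, heT, (Finset.mem_filter.1 he).2⟩
  have hzs : ∀ v, ∑ e with s e = v, z e = 0 := by
    intro v
    by_cases hv : v ∈ T.image s
    · simpa [f] using congrFun hz (Sum.inr (Sum.inl ⟨v, hv⟩))
    · exact hout s v hv
  have hzt : ∀ v ≠ t e₀, ∑ e with t e = v, z e = 0 := by
    intro v hne
    by_cases hv : v ∈ T.image t
    · simpa [f] using congrFun hz (Sum.inr (Sum.inr ⟨v, Finset.mem_erase.2 ⟨hne, hv⟩⟩))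
    · exact hout t v hv
  refine ⟨z, hz0, hzT, hzs, fun v => ?_⟩
  rcases eq_or_ne v (t e₀) with rfl | hv
  · have h1 := Finset.sum_fiberwise Finset.univ s z
    rw [Finset.sum_eq_zero fun v _ => hzs v, ← Finset.sum_fiberwise Finset.univ t z,
      Finset.sum_eq_single (t e₀) (fun v _ hv => hzt v hv) (by simp)] at h1
    exact h1.symm
  · exact hzt v hv

/-- Integrality of the bipartite degree polytope. -/
theorem exists_finset_card_fiber_eq {ι α : Type*} [Fintype ι] [Fintype α] [DecidableEq α]
    (s t : ι → α) {y : ι → ℝ} (hy : y ∈ Set.Icc 0 1)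
    (hs : ∀ v, ∃ n : ℤ, ∑ e with s e = v, y e = n) (ht : ∀ v, ∃ n : ℤ, ∑ e with t e = v, y e = n) :
    ∃ S : Finset ι, (∀ v, ((S.filter (s · = v)).card : ℝ) = ∑ e with s e = v, y e) ∧
      ∀ v, ((S.filter (t · = v)).card : ℝ) = ∑ e with t e = v, y e := by
  classical
  let P : Set (ι → ℝ) := {z | (∀ v, ∑ e with s e = v, z e = ∑ e with s e = v, y e) ∧
    ∀ v, ∑ e with t e = v, z e = ∑ e with t e = v, y e}
  have hP : IsClosed P := by
    refine IsClosed.inter (s₁ := {z : ι → ℝ | ∀ v, ∑ e with s e = v, z e = ∑ e with s e = v, y e})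
      (s₂ := {z : ι → ℝ | ∀ v, ∑ e with t e = v, z e = ∑ e with t e = v, y e}) ?_ ?_ <;>
    · simp only [Set.ofPred_forall]
      exact isClosed_iInter fun v => isClosed_eq (by fun_prop) (by fun_prop)
  obtain ⟨z, ⟨hz, hzP⟩, hmax⟩ := (isCompact_Icc.inter_right hP).exists_isMaxOn
    (f := fun z : ι → ℝ => ∑ e, z e ^ 2) ⟨y, hy, fun _ => rfl, fun _ => rfl⟩ (by fun_prop)
  have hz0 : ∀ e, 0 ≤ z e := hz.1
  have hz1 : ∀ e, z e ≤ 1 := hz.2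
  have hint : ∀ e, z e = 0 ∨ z e = 1 := by
    by_contra! hfrac
    obtain ⟨e₀, he₀⟩ := hfrac
    have hfib : ∀ (r : ι → α), (∀ v, ∃ n : ℤ, ∑ e with r e = v, z e = n) →
        ∀ e ∈ Finset.univ.filter (fun e => z e ≠ 0 ∧ z e ≠ 1),
          ∃ e' ∈ Finset.univ.filter (fun e => z e ≠ 0 ∧ z e ≠ 1), e' ≠ e ∧ r e' = r e := by
      intro r hr e he
      obtain ⟨n, hn⟩ := hr (r e)
      simp only [Finset.mem_filter, Finset.mem_univ, true_and] at he ⊢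
      obtain ⟨e', he', hne, h⟩ := exists_ne_fractional_of_sum_eq_int hz0 hz1 hn (e := e)
        (by simp) he.1 he.2
      exact ⟨e', h, hne, by simpa using he'⟩
    obtain ⟨d, hd, hdT, hds, hdt⟩ := exists_ne_zero_fiber_sums_eq_zero s t
      ⟨e₀, by simpa using he₀⟩
      (hfib s fun v => by rw [hzP.1 v]; exact hs v) (hfib t fun v => by rw [hzP.2 v]; exact ht v)
    have hsmall : ∀ᶠ ε : ℝ in nhdsWithin 0 (Set.Ioi 0), ∀ e,
        (0 ≤ z e + ε * d e ∧ z e + ε * d e ≤ 1) ∧ 0 ≤ z e - ε * d e ∧ z e - ε * d e ≤ 1 := by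
      refine Filter.eventually_all.2 fun e => ?_
      by_cases he : z e ≠ 0 ∧ z e ≠ 1
      · have h0 : 0 < z e := lt_of_le_of_ne (hz0 e) he.1.symm
        have h1 : z e < 1 := lt_of_le_of_ne (hz1 e) he.2
        refine Filter.Eventually.filter_mono nhdsWithin_le_nhds ?_
        have hp : Filter.Tendsto (fun ε : ℝ => z e + ε * d e) (nhds 0) (nhds (z e)) := by
          have : Continuous fun ε : ℝ => z e + ε * d e := by fun_prop
          simpa using this.tendsto 0
        have hm : Filter.Tendsto (fun ε : ℝ => z e - ε * d e) (nhds 0) (nhds (z e)) := by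
          have : Continuous fun ε : ℝ => z e - ε * d e := by fun_prop
          simpa using this.tendsto 0
        filter_upwards [hp.eventually_const_le h0, hp.eventually_le_const h1,
          hm.eventually_const_le h0, hm.eventually_le_const h1] with ε a b c d
        exact ⟨⟨a, b⟩, c, d⟩
      · have : d e = 0 := hdT e (by simpa using he)
        simp [this, hz0, hz1]
    obtain ⟨ε, hε, hεpos⟩ := (hsmall.and self_mem_nhdsWithin).exists
    have hplus : z + ε • d ∈ Set.Icc 0 1 ∩ P := by
      refine ⟨⟨fun e => (hε e).1.1, fun e => (hε e).1.2⟩, fun v => ?_, fun v => ?_⟩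
      · simp [Finset.sum_add_distrib, ← Finset.mul_sum, hds, hzP.1]
      · simp [Finset.sum_add_distrib, ← Finset.mul_sum, hdt, hzP.2]
    have hminus : z - ε • d ∈ Set.Icc 0 1 ∩ P := by
      refine ⟨⟨fun e => (hε e).2.1, fun e => (hε e).2.2⟩, fun v => ?_, fun v => ?_⟩
      · simp [Finset.sum_sub_distrib, ← Finset.mul_sum, hds, hzP.1]
      · simp [Finset.sum_sub_distrib, ← Finset.mul_sum, hdt, hzP.2]
    have h1 : ∑ e, (z e + ε * d e) ^ 2 ≤ ∑ e, z e ^ 2 := hmax hplus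
    have h2 : ∑ e, (z e - ε * d e) ^ 2 ≤ ∑ e, z e ^ 2 := hmax hminus
    obtain ⟨e₁, he₁⟩ := Function.ne_iff.1 hd
    replace hεpos : 0 < ε := hεpos
    have h3 : 0 < ∑ e, (ε * d e) ^ 2 := Finset.sum_pos' (fun e _ => sq_nonneg _)
      ⟨e₁, Finset.mem_univ _, sq_pos_of_ne_zero (mul_ne_zero hεpos.ne' he₁)⟩
    have h4 : ∑ e, (z e + ε * d e) ^ 2 + ∑ e, (z e - ε * d e) ^ 2 =
        2 * ∑ e, z e ^ 2 + 2 * ∑ e, (ε * d e) ^ 2 := by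
      rw [Finset.mul_sum, Finset.mul_sum, ← Finset.sum_add_distrib, ← Finset.sum_add_distrib]
      exact Finset.sum_congr rfl fun e _ => by ring
    linarith
  have hcount : ∀ (r : ι → α) v,
      (((Finset.univ.filter (z · = 1)).filter (r · = v)).card : ℝ) = ∑ e with r e = v, z e := by
    intro r v
    rw [Finset.filter_comm, ← Finset.sum_boole]
    refine Finset.sum_congr rfl fun e _ => ?_
    rcases hint e with h | h <;> simp [h]
  exact ⟨Finset.univ.filter (z · = 1), fun v => (hcount s v).trans (hzP.1 v),
    fun v => (hcount t v).trans (hzP.2 v)⟩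

/-- A bipartite multigraph with more than `4 * k` times as many edges as vertices in each class has
a nonempty set of edges in which all degrees are divisible by `k`. -/
theorem exists_nonempty_dvd_card_fiber {ι α : Type*} [Fintype ι] [Fintype α] [DecidableEq α]
    (s t : ι → α) {k : ℕ} (hk : 0 < k) (hcard : 4 * k * Fintype.card α < Fintype.card ι) :
    ∃ S : Finset ι, S.Nonempty ∧ (∀ v, k ∣ (S.filter (s · = v)).card) ∧
      ∀ v, k ∣ (S.filter (t · = v)).card := by
  classical
  let b : ι → α ⊕ α → ℝ := fun e => Sum.elim (Pi.single (s e) 1) (Pi.single (t e) 1)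
  have hk' : (0 : ℝ) < k := Nat.cast_pos.2 hk
  obtain ⟨c, hc, ⟨e₁, he₁⟩, hcK⟩ := exists_reweighting b (K := 2 * k) (by positivity) (by
    rw [Fintype.card_sum]
    have : ((4 * k * Fintype.card α : ℕ) : ℝ) < Fintype.card ι := by exact_mod_cast hcard
    push_cast at this ⊢
    linarith)
  obtain ⟨f, m, hf, hfc, hsum⟩ := exists_small_correction b hk' (by positivity) hc hcK
    (fun _ => -(1 / 2)) (ε := 1 / 8) (by norm_num)
  have hf' : ∀ e, |f e| < 1 / 2 := fun e => (hf e).trans_lt (by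
    have : (k : ℝ) / (2 * (2 * k)) = 1 / 4 := by field_simp; norm_num
    rw [this]; norm_num)
  let y : ι → ℝ := fun e => if c e = 0 then 0 else 1 / 2 + f e
  have hy : y ∈ Set.Icc 0 1 := by
    refine ⟨fun e => ?_, fun e => ?_⟩ <;>
    · have := abs_lt.1 (hf' e)
      simp only [y, Pi.zero_apply, Pi.one_apply]
      split_ifs <;> linarith
  have hdeg : ∀ (r : ι → α) (w : α ⊕ α), (∀ e, b e w = if r e = w.elim id id then 1 else 0) →
      ∑ e with r e = w.elim id id, y e =
        ((k * ∑ e with r e = w.elim id id, if c e = 0 then 0 else m e : ℤ) : ℝ) := by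
    intro r w hw
    have h := hsum (Pi.single w 1)
    simp only [dotProduct_single, mul_one, hw, Finset.sum_filter, mul_ite, mul_zero] at h
    push_cast
    rw [Finset.mul_sum, Finset.sum_filter, Finset.sum_filter, ← sub_eq_zero,
      ← Finset.sum_sub_distrib]
    rw [← sub_eq_zero, ← Finset.sum_sub_distrib] at h
    refine (Finset.sum_congr rfl fun e _ => ?_).trans h
    by_cases he : c e = 0
    · simp [y, he, hfc e he]
    · by_cases hr : r e = w.elim id id
      · simp only [y, he, hr, if_true, if_false, ne_eq, not_false_eq_true]; ring
      · simp [hr]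
  have hs := fun v => hdeg s (Sum.inl v) fun e => by simp [b, Pi.single_apply, eq_comm]
  have ht := fun v => hdeg t (Sum.inr v) fun e => by simp [b, Pi.single_apply, eq_comm]
  simp only [Sum.elim_inl, Sum.elim_inr, id_eq] at hs ht
  obtain ⟨S, hSs, hSt⟩ := exists_finset_card_fiber_eq s t hy (fun v => ⟨_, hs v⟩)
    (fun v => ⟨_, ht v⟩)
  refine ⟨S, ?_, fun v => ?_, fun v => ?_⟩
  · have hpos : (0 : ℝ) < ((S.filter (s · = s e₁)).card : ℝ) := by
      rw [hSs]
      refine Finset.sum_pos' (fun e _ => hy.1 e) ⟨e₁, by simp, ?_⟩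
      have := abs_lt.1 (hf' e₁)
      simp only [y, he₁, one_ne_zero, if_false]
      linarith
    exact (Finset.card_pos.1 (Nat.cast_pos.1 hpos)).mono (Finset.filter_subset _ _)
  · have h := (hSs v).trans (hs v)
    rw [← Int.cast_natCast, Int.cast_inj] at h
    exact Int.natCast_dvd_natCast.1 ⟨_, h⟩
  · have h := (hSt v).trans (ht v)
    rw [← Int.cast_natCast, Int.cast_inj] at h
    exact Int.natCast_dvd_natCast.1 ⟨_, h⟩

/-- Every element of `N` can be given a color outside its small forbidden set so that each used
color is used `1` modulo `k` times. -/
theorem exists_list_coloring {ι κ : Type*} [DecidableEq κ] (N : Finset ι) (Φ : ι → Finset κ)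
    {D k : ℕ} (hk : 2 ≤ k) (hΦ : ∀ w, (Φ w).card ≤ D) {P Q : Finset κ} (hPQ : Disjoint P Q)
    (hP0 : P.Nonempty) (hP : 2 * D ≤ P.card) (hQ : D + 2 * k ≤ Q.card) :
    ∃ g : ι → κ, (∀ w ∈ N, g w ∉ Φ w) ∧
      ∀ i, (N.filter (g · = i)).card = 0 ∨ (N.filter (g · = i)).card % k = 1 := by
  classical
  let Good : Finset ι → (ι → κ) → Prop := fun A g => (∀ w ∈ A, g w ∈ P ∧ g w ∉ Φ w) ∧
    ∀ i, (A.filter (g · = i)).card = 0 ∨ (A.filter (g · = i)).card % k = 1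
  obtain ⟨i₀, hi₀⟩ := hP0
  obtain ⟨A, hA, hmax⟩ := (N.powerset.filter fun A => ∃ g, Good A g).exists_max_image Finset.card
    ⟨∅, by simpa [Good] using Or.inr ⟨i₀⟩⟩
  simp only [Finset.mem_filter, Finset.mem_powerset, and_imp, forall_exists_index] at hA hmax
  obtain ⟨hAN, g, hgA, hg⟩ := hA
  have hext : ∀ i ∈ P, ∀ B ⊆ N \ A, B.Nonempty → (∀ w ∈ B, i ∉ Φ w) →
      ¬ ((A.filter (g · = i)).card + B.card) % k = 1 := by
    intro i hi B hB hB0 hBΦ hcard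
    have hdis : Disjoint A B := Finset.disjoint_sdiff.mono_right hB
    have hgB : ∀ w ∈ A, w ∉ B := fun w hw => Finset.disjoint_left.1 hdis hw
    have hlt : A.card < (A ∪ B).card := by
      rw [Finset.card_union_of_disjoint hdis]
      have := hB0.card_pos
      omega
    refine hlt.not_ge (hmax (A ∪ B) (Finset.union_subset hAN (hB.trans Finset.sdiff_subset))
      (fun w => if w ∈ B then i else g w) ⟨fun w hw => ?_, fun j => ?_⟩)
    · by_cases hwB : w ∈ B
      · simp [hwB, hi, hBΦ w hwB]
      · have hwA : w ∈ A := (Finset.mem_union.1 hw).resolve_right hwB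
        simpa [hwB] using hgA w hwA
    · have h1 : A.filter (fun w => (if w ∈ B then i else g w) = j) = A.filter (g · = j) :=
        Finset.filter_congr fun w hw => by simp [hgB w hw]
      have h2 : B.filter (fun w => (if w ∈ B then i else g w) = j) = B.filter fun _ => i = j :=
        Finset.filter_congr fun w hw => by simp [hw]
      rw [Finset.filter_union, h1, h2, Finset.card_union_of_disjoint
        (hdis.mono (Finset.filter_subset _ _) (Finset.filter_subset _ _))]
      by_cases hij : i = j
      · subst hij; right; simpa using hcard
      · simpa [hij] using hg j
  have hrem : (N \ A).card < 2 * k := by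
    by_contra! hr
    have h1 : ∑ i ∈ P, ((N \ A).filter (i ∉ Φ ·)).card = ∑ w ∈ N \ A, (P.filter (· ∉ Φ w)).card :=
      Finset.sum_card_bipartiteAbove_eq_sum_card_bipartiteBelow _
    have h2 : ∀ w, P.card ≤ 2 * (P.filter (· ∉ Φ w)).card := by
      intro w
      have h3 := Finset.card_filter_add_card_filter_not (s := P) (· ∈ Φ w)
      have h4 : (P.filter (· ∈ Φ w)).card ≤ (Φ w).card :=
        Finset.card_le_card fun i hi => (Finset.mem_filter.1 hi).2
      have := hΦ w
      omega
    obtain ⟨i, hi, hik⟩ : ∃ i ∈ P, k ≤ ((N \ A).filter (i ∉ Φ ·)).card := by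
      refine Finset.exists_le_of_sum_le ⟨i₀, hi₀⟩ ?_
      rw [h1]
      have h5 : ∑ w ∈ N \ A, P.card ≤ 2 * ∑ w ∈ N \ A, (P.filter (· ∉ Φ w)).card := by
        rw [Finset.mul_sum]
        exact Finset.sum_le_sum fun w _ => h2 w
      simp only [Finset.sum_const, smul_eq_mul] at h5 ⊢
      nlinarith
    rcases hg i with h0 | h0
    · obtain ⟨B, hB, hBc⟩ := Finset.exists_subset_card_eq (show 1 ≤ _ by omega : 1 ≤ _)
        (s := (N \ A).filter (i ∉ Φ ·))
      refine hext i hi B (hB.trans (Finset.filter_subset _ _)) (Finset.card_pos.1 (by omega))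
        (fun w hw => (Finset.mem_filter.1 (hB hw)).2) ?_
      rw [h0, hBc, Nat.mod_eq_of_lt (by omega)]
    · obtain ⟨B, hB, hBc⟩ := Finset.exists_subset_card_eq hik
      refine hext i hi B (hB.trans (Finset.filter_subset _ _)) (Finset.card_pos.1 (by omega))
        (fun w hw => (Finset.mem_filter.1 (hB hw)).2) ?_
      rw [hBc, Nat.add_mod_right, h0]
  obtain ⟨h, hinj, hh⟩ := (Finset.all_card_le_biUnion_card_iff_exists_injective
    (fun w : (N \ A : Finset ι) => Q \ Φ w)).1 (by
      intro s
      rcases s.eq_empty_or_nonempty with rfl | ⟨w, hw⟩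
      · simp
      have h1 : s.card ≤ (N \ A).card := by simpa using s.card_le_univ
      have h2 := Finset.le_card_sdiff (Φ w) Q
      have h3 := Finset.card_le_card (Finset.subset_biUnion_of_mem
        (fun w : (N \ A : Finset ι) => Q \ Φ w) hw)
      have := hΦ w
      omega)
  refine ⟨fun w => if hw : w ∈ N \ A then h ⟨w, hw⟩ else g w, fun w hw => ?_, fun i => ?_⟩
  · by_cases hwA : w ∈ A
    · simpa [hwA] using (hgA w hwA).2
    · have hw' : w ∈ N \ A := Finset.mem_sdiff.2 ⟨hw, hwA⟩
      simpa only [hw', dif_pos] using (Finset.mem_sdiff.1 (hh ⟨w, hw'⟩)).2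
  · by_cases hi : i ∈ Q
    · have hle : (N.filter fun w =>
          (if hw : w ∈ N \ A then h ⟨w, hw⟩ else g w) = i).card ≤ 1 := by
        have hmem : ∀ w ∈ N, (if hw : w ∈ N \ A then h ⟨w, hw⟩ else g w) = i →
            ∃ hw : w ∈ N \ A, h ⟨w, hw⟩ = i := by
          intro w hw hwi
          by_cases hwA : w ∈ A
          · simp only [Finset.mem_sdiff, hwA, not_true_eq_false, and_false, dif_neg,
              not_false_eq_true] at hwi
            exact absurd hi (Finset.disjoint_left.1 hPQ (hwi ▸ (hgA w hwA).1))
          · have hw' : w ∈ N \ A := Finset.mem_sdiff.2 ⟨hw, hwA⟩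
            exact ⟨hw', by simpa only [hw', dif_pos] using hwi⟩
        refine Finset.card_le_one.2 fun w hw w' hw' => ?_
        rw [Finset.mem_filter] at hw hw'
        obtain ⟨h1, h2⟩ := hmem w hw.1 hw.2
        obtain ⟨h3, h4⟩ := hmem w' hw'.1 hw'.2
        exact congrArg Subtype.val (hinj (h2.trans h4.symm))
      rcases Nat.le_one_iff_eq_zero_or_eq_one.1 hle with h0 | h0
      · exact Or.inl h0
      · right; rw [h0, Nat.mod_eq_of_lt (by omega)]
    · have heq : (N.filter fun w => (if hw : w ∈ N \ A then h ⟨w, hw⟩ else g w) = i) =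
          A.filter (g · = i) := by
        ext w
        simp only [Finset.mem_filter]
        by_cases hwA : w ∈ A
        · simp [hwA, hAN hwA]
        · simp only [hwA, false_and, iff_false, not_and]
          intro hw
          have hw' : w ∈ N \ A := Finset.mem_sdiff.2 ⟨hw, hwA⟩
          simp only [hw', dif_pos]
          rintro rfl
          exact hi (Finset.mem_sdiff.1 (hh ⟨w, hw'⟩)).1
      rw [heq]
      exact hg i

/-- A degenerate graph has a vertex ordering with few backward neighbors at each vertex. -/
theorem exists_injective_back_degree_le {V : Type*} [Fintype V] (R : SimpleGraph V)
    [DecidableRel R.Adj] {d : ℕ}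
    (h : ∀ X : Finset V, X.Nonempty → ∃ v ∈ X, (X.filter (R.Adj v)).card ≤ d) :
    ∃ f : V → ℕ, Function.Injective f ∧
      ∀ v, (Finset.univ.filter fun w => R.Adj v w ∧ f w < f v).card ≤ d := by
  classical
  suffices H : ∀ n, ∀ X : Finset V, X.card = n → ∃ f : V → ℕ, Set.InjOn f X ∧ (∀ v ∈ X, f v < n) ∧
      ∀ v ∈ X, (X.filter fun w => R.Adj v w ∧ f w < f v).card ≤ d by
    obtain ⟨f, hf, -, hd⟩ := H _ Finset.univ rfl
    exact ⟨f, by simpa [Set.injOn_univ] using hf, fun v => hd v (Finset.mem_univ v)⟩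
  intro n
  induction n with
  | zero => intro X hX; rw [Finset.card_eq_zero] at hX; subst hX; exact ⟨fun _ => 0, by simp⟩
  | succ n ih =>
    intro X hX
    obtain ⟨v, hv, hvd⟩ := h X (Finset.card_pos.1 (by omega))
    obtain ⟨f, hf, hlt, hd⟩ := ih (X.erase v) (by rw [Finset.card_erase_of_mem hv]; omega)
    have hne : ∀ w ∈ X, w ≠ v → Function.update f v n w = f w ∧ f w < n := fun w hw hwv =>
      ⟨Function.update_of_ne hwv _ _, hlt w (Finset.mem_erase.2 ⟨hwv, hw⟩)⟩
    refine ⟨Function.update f v n, ?_, fun w hw => ?_, fun w hw => ?_⟩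
    · intro w hw w' hw' hww
      by_cases h1 : w = v <;> by_cases h2 : w' = v
      · rw [h1, h2]
      · subst h1
        have := hne w' hw' h2
        simp only [Function.update_self] at hww
        omega
      · subst h2
        have := hne w hw h1
        simp only [Function.update_self] at hww
        omega
      · rw [(hne w hw h1).1, (hne w' hw' h2).1] at hww
        exact hf (by simp [h1, Finset.mem_coe.1 hw]) (by simp [h2, Finset.mem_coe.1 hw']) hww
    · by_cases h1 : w = v
      · subst h1; simp
      · have := hne w hw h1; omega
    · by_cases h1 : w = v
      · subst h1
        exact (Finset.card_le_card
          (Finset.monotone_filter_right X fun u _ hu => hu.1)).trans hvd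
      · refine (Finset.card_le_card fun u hu => ?_).trans (hd w (Finset.mem_erase.2 ⟨h1, hw⟩))
        rw [Finset.mem_filter, (hne w hw h1).1] at hu
        have huv : u ≠ v := by
          rintro rfl
          have := hne w hw h1
          simp only [Function.update_self] at hu
          omega
        rw [(hne u hu.1 huv).1] at hu
        simp [huv, hu]

/-- A graph with an ordering in which back degrees are at most `d` has an edge-coloring from a
palette of size linear in `d + k` with all degrees in color classes `0` or `1` modulo `k`. -/
theorem exists_coloring_of_back_degree_le {V κ : Type*} [Fintype V] [DecidableEq κ]
    (R : SimpleGraph V) [DecidableRel R.Adj] {d k : ℕ} (hk : 2 ≤ k) {f : V → ℕ}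
    (hf : Function.Injective f)
    (hd : ∀ v, (Finset.univ.filter fun w => R.Adj v w ∧ f w < f v).card ≤ d) {P Q : Finset κ}
    (hPQ : Disjoint P Q) (hP0 : P.Nonempty) (hP : 2 * (2 * d) ≤ P.card)
    (hQ : 2 * d + 2 * k ≤ Q.card) :
    ∃ c : Sym2 V → κ, ∀ v i, (Finset.univ.filter fun w => R.Adj v w ∧ c s(v, w) = i).card = 0 ∨
      (Finset.univ.filter fun w => R.Adj v w ∧ c s(v, w) = i).card % k = 1 := by
  classical
  let col : (V → V → κ) → V → V → κ := fun c u w => if f u < f w then c u w else c w u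
  suffices H : ∀ n : ℕ, ∃ c : V → V → κ,
      (∀ v, f v < n → ∀ i, (Finset.univ.filter fun w => R.Adj v w ∧ col c v w = i).card = 0 ∨
        (Finset.univ.filter fun w => R.Adj v w ∧ col c v w = i).card % k = 1) ∧
      ∀ w, n ≤ f w → ∀ u u', R.Adj w u → f u < n → R.Adj w u' → f u' < n →
        c u w = c u' w → u = u' by
    obtain ⟨c, hc, -⟩ := H (Finset.univ.sup f + 1)
    refine ⟨Sym2.lift ⟨col c, fun u w => ?_⟩, fun v i => ?_⟩
    · rcases lt_trichotomy (f u) (f w) with h | h | h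
      · simp [col, h, h.not_gt]
      · rw [hf h]
      · simp [col, h, h.not_gt]
    · exact hc v (Nat.lt_succ_of_le (Finset.le_sup (Finset.mem_univ v))) i
  intro n
  induction n with
  | zero =>
    obtain ⟨i₀, -⟩ := hP0
    exact ⟨fun _ _ => i₀, by simp⟩
  | succ n ih =>
    obtain ⟨c, hc, hb⟩ := ih
    by_cases hv : ∃ v, f v = n
    swap
    · have hlt : ∀ v, f v < n + 1 → f v < n := fun v h =>
        lt_of_le_of_ne (Nat.lt_succ_iff.1 h) fun h' => hv ⟨v, h'⟩
      exact ⟨c, fun v h => hc v (hlt v h), fun w hw u u' h1 h2 h3 h4 =>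
        hb w (by omega) u u' h1 (hlt u h2) h3 (hlt u' h4)⟩
    obtain ⟨v, rfl⟩ := hv
    let N : Finset V := Finset.univ.filter fun w => R.Adj v w ∧ f v < f w
    let B : V → Finset V := fun w => Finset.univ.filter fun u => R.Adj w u ∧ f u < f v
    let Φ : V → Finset κ := fun w =>
      if w ∈ N then (B w).image (c · w) ∪ (B v).image (c · v) else ∅
    have hB : ∀ w, f v ≤ f w → (B w).card ≤ d := fun w hw =>
      (Finset.card_le_card (Finset.monotone_filter_right _ fun u _ hu =>
        ⟨hu.1, hu.2.trans_le hw⟩)).trans (hd w)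
    have hΦ : ∀ w, (Φ w).card ≤ 2 * d := by
      intro w
      by_cases hw : w ∈ N
      · have h1 : (B w).card ≤ d := hB w (Finset.mem_filter.1 hw).2.2.le
        have h2 : (B v).card ≤ d := hB v le_rfl
        have h3 : ((B w).image (c · w)).card ≤ (B w).card := Finset.card_image_le
        have h4 : ((B v).image (c · v)).card ≤ (B v).card := Finset.card_image_le
        have h5 := Finset.card_union_le ((B w).image (c · w)) ((B v).image (c · v))
        simp only [Φ, if_pos hw]
        omega
      · simp [Φ, hw]
    obtain ⟨g, hgΦ, hg⟩ := exists_list_coloring N Φ hk hΦ hPQ hP0 hP hQ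
    have hgN : ∀ w, R.Adj v w → f v < f w → (∀ u, R.Adj w u → f u < f v → g w ≠ c u w) ∧
        ∀ u, R.Adj v u → f u < f v → g w ≠ c u v := by
      intro w hvw hlt
      have hw : w ∈ N := by simp [N, hvw, hlt]
      have h := hgΦ w hw
      simp only [Φ, if_pos hw, Finset.mem_union, Finset.mem_image, not_or, not_exists, not_and,
        B, Finset.mem_filter, Finset.mem_univ, true_and] at h
      exact ⟨fun u h1 h2 h3 => h.1 u ⟨h1, h2⟩ h3.symm, fun u h1 h2 h3 => h.2 u ⟨h1, h2⟩ h3.symm⟩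
    have hself : ∀ w, Function.update c v g v w = g w := fun w => by simp
    have hne : ∀ u w, u ≠ v → Function.update c v g u w = c u w := fun u w h => by
      rw [Function.update_of_ne h]
    have hlt_ne : ∀ u, f u < f v → u ≠ v := by rintro u h rfl; exact lt_irrefl _ h
    refine ⟨Function.update c v g, fun x hx i => ?_, fun w hw u u' h1 h2 h3 h4 h5 => ?_⟩
    · rcases (Nat.lt_succ_iff.1 hx).lt_or_eq with hlt | heq
      · have h : ∀ w, col (Function.update c v g) x w = col c x w := by
          intro w
          by_cases hxw : f x < f w
          · simp only [col, if_pos hxw, hne x w (hlt_ne x hlt)]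
          · simp only [col, if_neg hxw, hne w x (hlt_ne w (by omega))]
        simpa only [h] using hc x hlt i
      · obtain rfl := hf heq
        have hcol : ∀ w, R.Adj x w → (f w < f x ∧ col (Function.update c x g) x w = c w x) ∨
            (f x < f w ∧ col (Function.update c x g) x w = g w) := by
          intro w hxw
          rcases lt_trichotomy (f w) (f x) with h | h | h
          · left
            exact ⟨h, by simp only [col, if_neg h.not_gt, hne w x (hlt_ne w h)]⟩
          · exact absurd (hf h) hxw.ne'
          · right
            exact ⟨h, by simp only [col, if_pos h, hself]⟩
        by_cases hback : ∃ u, R.Adj x u ∧ f u < f x ∧ c u x = i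
        · obtain ⟨u, hu1, hu2, rfl⟩ := hback
          right
          have : (Finset.univ.filter fun w => R.Adj x w ∧
              col (Function.update c x g) x w = c u x) = {u} := by
            ext w
            simp only [Finset.mem_filter, Finset.mem_univ, true_and, Finset.mem_singleton]
            constructor
            · rintro ⟨h1, h2⟩
              rcases hcol w h1 with ⟨h3, h4⟩ | ⟨h3, h4⟩
              · exact hb x le_rfl w u h1 h3 hu1 hu2 (h4.symm.trans h2)
              · exact absurd (h4.symm.trans h2) ((hgN w h1 h3).2 u hu1 hu2)
            · rintro rfl
              refine ⟨hu1, ?_⟩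
              rcases hcol w hu1 with ⟨h3, h4⟩ | ⟨h3, h4⟩
              · exact h4
              · omega
          rw [this, Finset.card_singleton, Nat.mod_eq_of_lt (by omega)]
        · have : (Finset.univ.filter fun w => R.Adj x w ∧
              col (Function.update c x g) x w = i) = N.filter (g · = i) := by
            ext w
            simp only [Finset.mem_filter, Finset.mem_univ, true_and, N]
            constructor
            · rintro ⟨h1, h2⟩
              rcases hcol w h1 with ⟨h3, h4⟩ | ⟨h3, h4⟩
              · exact absurd ⟨w, h1, h3, h4.symm.trans h2⟩ hback
              · exact ⟨⟨h1, h3⟩, h4.symm.trans h2⟩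
            · rintro ⟨⟨h1, h3⟩, h2⟩
              rcases hcol w h1 with ⟨h5, h4⟩ | ⟨h5, h4⟩
              · omega
              · exact ⟨h1, h4.trans h2⟩
          rw [this]
          exact hg i
    · have hcases : ∀ u, f u < f v + 1 → f u < f v ∨ u = v := fun u h =>
        (Nat.lt_succ_iff.1 h).lt_or_eq.imp_right fun h => hf h
      rcases hcases u h2 with hu | rfl <;> rcases hcases u' h4 with hu' | rfl
      · rw [hne u w (hlt_ne u hu), hne u' w (hlt_ne u' hu')] at h5
        exact hb w (by omega) u u' h1 hu h3 hu' h5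
      · rw [hne u w (hlt_ne u hu), hself] at h5
        exact absurd h5.symm ((hgN w h3.symm (by omega)).1 u h1 hu)
      · rw [hne u' w (hlt_ne u' hu'), hself] at h5
        exact absurd h5 ((hgN w h1.symm (by omega)).1 u' h3 hu')
      · rfl

/-- A set of vertices inducing minimum degree more than `8 * k` spans a nonempty set of edges in
which all degrees are divisible by `k`. -/
theorem exists_edges_dvd_degree {V : Type*} [Fintype V] [DecidableEq V] (R : SimpleGraph V)
    [DecidableRel R.Adj] {k : ℕ} (hk : 0 < k) {X : Finset V} (hX : X.Nonempty)
    (hdeg : ∀ v ∈ X, 8 * k < (X.filter (R.Adj v)).card) :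
    ∃ S ⊆ R.edgeFinset, S.Nonempty ∧ (∀ e ∈ S, ∀ v ∈ e, v ∈ X) ∧
      ∀ v, k ∣ (S.filter (v ∈ ·)).card := by
  classical
  let R' : SimpleGraph V :=
    { Adj := fun a b => R.Adj a b ∧ a ∈ X ∧ b ∈ X
      symm := ⟨fun a b h => ⟨h.1.symm, h.2.2, h.2.1⟩⟩
      loopless := ⟨fun a h => R.loopless.irrefl a h.1⟩ }
  have hE : 4 * k * X.card < R'.edgeFinset.card := by
    have h1 : ∑ v ∈ X, 8 * k < ∑ v ∈ X, R'.degree v := by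
      refine Finset.sum_lt_sum_of_nonempty hX fun v hv => (hdeg v hv).trans_le ?_
      rw [← SimpleGraph.card_neighborFinset_eq_degree]
      refine Finset.card_le_card fun w hw => ?_
      rw [Finset.mem_filter] at hw
      simpa [R', hv] using hw.symm
    have h2 : ∑ v ∈ X, R'.degree v ≤ ∑ v, R'.degree v :=
      Finset.sum_le_sum_of_subset (Finset.subset_univ X)
    rw [SimpleGraph.sum_degrees_eq_twice_card_edges] at h2
    rw [Finset.sum_const, smul_eq_mul] at h1
    nlinarith
  have hmem : ∀ e ∈ R'.edgeFinset, (Quot.out e).1 ∈ X ∧ (Quot.out e).2 ∈ X ∧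
      (Quot.out e).1 ≠ (Quot.out e).2 ∧ e ∈ R.edgeFinset ∧
      ∀ v, v ∈ e ↔ (Quot.out e).1 = v ∨ (Quot.out e).2 = v := by
    intro e he
    have hout : s((Quot.out e).1, (Quot.out e).2) = e := Quot.out_eq e
    generalize Quot.out e = p at *
    obtain ⟨a, b⟩ := p
    subst hout
    have h : R.Adj a b ∧ a ∈ X ∧ b ∈ X := by simpa [R'] using he
    refine ⟨h.2.1, h.2.2, h.1.ne, by simpa using h.1, fun v => ?_⟩
    rw [Sym2.mem_iff, eq_comm, @eq_comm _ v b]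
  obtain ⟨S, hS, h1, h2⟩ := exists_nonempty_dvd_card_fiber
    (fun e : R'.edgeFinset => (⟨_, (hmem e.1 e.2).1⟩ : X))
    (fun e : R'.edgeFinset => (⟨_, (hmem e.1 e.2).2.1⟩ : X)) hk
    (by simpa only [Fintype.card_coe] using hE)
  have hverts : ∀ e ∈ R'.edgeFinset, ∀ v ∈ e, v ∈ X := by
    intro e he v hv
    rcases ((hmem e he).2.2.2.2 v).1 hv with h | h
    · exact h ▸ (hmem e he).1
    · exact h ▸ (hmem e he).2.1
  refine ⟨S.map (Function.Embedding.subtype _), fun e he => ?_, hS.map, fun e he => ?_,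
    fun v => ?_⟩
  · obtain ⟨e', -, rfl⟩ := Finset.mem_map.1 he
    exact (hmem e'.1 e'.2).2.2.2.1
  · obtain ⟨e', -, rfl⟩ := Finset.mem_map.1 he
    exact hverts e'.1 e'.2
  · rw [Finset.filter_map, Finset.card_map]
    by_cases hv : v ∈ X
    · have h : S.filter ((v ∈ ·) ∘ Function.Embedding.subtype _) =
          S.filter (fun e => (⟨_, (hmem e.1 e.2).1⟩ : X) = ⟨v, hv⟩) ∪
          S.filter (fun e => (⟨_, (hmem e.1 e.2).2.1⟩ : X) = ⟨v, hv⟩) := by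
        rw [← Finset.filter_or]
        refine Finset.filter_congr fun e _ => ?_
        simpa using (hmem e.1 e.2).2.2.2.2 v
      rw [h, Finset.card_union_of_disjoint]
      · exact dvd_add (h1 _) (h2 _)
      · rw [Finset.disjoint_filter]
        intro e _ h3 h4
        exact (hmem e.1 e.2).2.2.1 (congrArg Subtype.val (h3.trans h4.symm))
    · rw [Finset.filter_false_of_mem, Finset.card_empty]
      · exact dvd_zero k
      · exact fun e _ hve => hv (hverts e.1 e.2 v hve)

/-- Every graph has a set of edges with all degrees `0` or `1` modulo `k` whose removal leaves a
`9 * k`-degenerate graph. -/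
theorem exists_edges_degenerate_sdiff {V : Type*} [Fintype V] [DecidableEq V] (G : SimpleGraph V)
    {k : ℕ} (hk : 2 ≤ k) :
    ∃ (H : Finset (Sym2 V)) (R : SimpleGraph V) (_ : DecidableRel R.Adj),
      (∀ v, (H.filter (v ∈ ·)).card = 0 ∨ (H.filter (v ∈ ·)).card % k = 1) ∧
      (∀ e ∈ H, e ∈ G.edgeSet) ∧ (∀ v w, R.Adj v w ↔ G.Adj v w ∧ s(v, w) ∉ H) ∧
      ∀ X : Finset V, X.Nonempty → ∃ v ∈ X, (X.filter (R.Adj v)).card ≤ 9 * k := by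
  classical
  obtain ⟨H, hH, hmax⟩ := (G.edgeFinset.powerset.filter fun H => ∀ v,
    (H.filter (v ∈ ·)).card = 0 ∨ (H.filter (v ∈ ·)).card % k = 1).exists_max_image Finset.card
    ⟨∅, by simp⟩
  simp only [Finset.mem_filter, Finset.mem_powerset, and_imp] at hH hmax
  obtain ⟨hHG, hH⟩ := hH
  let R : SimpleGraph V := G.deleteEdges H
  have hR : ∀ v w, R.Adj v w ↔ G.Adj v w ∧ s(v, w) ∉ H := fun v w => by
    simp [R, SimpleGraph.deleteEdges_adj]
  have hext : ∀ S ⊆ R.edgeFinset, S.Nonempty →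
      ¬ ∀ v, (H.filter (v ∈ ·)).card + (S.filter (v ∈ ·)).card = 0 ∨
        ((H.filter (v ∈ ·)).card + (S.filter (v ∈ ·)).card) % k = 1 := by
    intro S hS hS0 hdeg
    have hS' : ∀ e ∈ S, e ∈ G.edgeFinset ∧ e ∉ H := by
      intro e he
      have := hS he
      induction e with
      | _ a b => simpa [hR] using this
    have hdis : Disjoint H S := Finset.disjoint_right.2 fun e he => (hS' e he).2
    have hlt := hmax (H ∪ S) (Finset.union_subset hHG fun e he => (hS' e he).1) fun v => by
      rw [Finset.filter_union, Finset.card_union_of_disjoint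
        (hdis.mono (Finset.filter_subset _ _) (Finset.filter_subset _ _))]
      exact hdeg v
    rw [Finset.card_union_of_disjoint hdis] at hlt
    have := hS0.card_pos
    omega
  have hstar : ∀ w, ∀ L : Finset V, L.Nonempty →
      (∀ u ∈ L, R.Adj w u ∧ (H.filter (u ∈ ·)).card = 0) →
      ¬ ((H.filter (w ∈ ·)).card + L.card) % k = 1 := by
    intro w L hL hLw hw
    refine hext (L.image (s(w, ·))) (fun e he => ?_) (hL.image _) fun u => ?_
    · obtain ⟨u, hu, rfl⟩ := Finset.mem_image.1 he
      simpa using (hLw u hu).1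
    · rw [Finset.filter_image, Finset.card_image_of_injective _ fun a b h => Sym2.congr_right.1 h]
      by_cases huw : u = w
      · subst huw
        right
        rwa [Finset.filter_true_of_mem fun a _ => Sym2.mem_mk_left u a]
      · have h1 : L.filter (fun a => u ∈ s(w, a)) = L.filter (u = ·) :=
          Finset.filter_congr fun a _ => by simp [huw]
        rw [h1]
        by_cases huL : u ∈ L
        · right
          rw [(hLw u huL).2, Finset.filter_eq, if_pos huL, Finset.card_singleton,
            Nat.mod_eq_of_lt (by omega)]
        · rw [Finset.filter_eq, if_neg huL, Finset.card_empty, add_zero]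
          exact hH u
  refine ⟨H, R, inferInstance, hH, fun e he => by simpa using hHG he, hR, fun X hX => ?_⟩
  rcases (X.filter fun v => (H.filter (v ∈ ·)).card ≠ 0).eq_empty_or_nonempty with hX' | hX'
  · obtain ⟨v, hv⟩ := hX
    have h0 : ∀ u ∈ X, (H.filter (u ∈ ·)).card = 0 := by
      simpa [Finset.filter_eq_empty_iff] using hX'
    refine ⟨v, hv, ?_⟩
    rw [Finset.filter_false_of_mem, Finset.card_empty]
    · exact Nat.zero_le _
    · intro u hu hvu
      refine hstar v {u} (Finset.singleton_nonempty u)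
        (fun a ha => by
          rw [Finset.mem_singleton.1 ha]
          exact ⟨hvu, h0 u hu⟩) ?_
      rw [h0 v hv, Finset.card_singleton, Nat.mod_eq_of_lt (by omega)]
  · obtain ⟨w, hwX, hw⟩ : ∃ w ∈ X.filter fun v => (H.filter (v ∈ ·)).card ≠ 0,
        ((X.filter fun v => (H.filter (v ∈ ·)).card ≠ 0).filter (R.Adj w)).card ≤ 8 * k := by
      by_contra! hcon
      obtain ⟨S, hS, hS0, hSX, hdvd⟩ := exists_edges_dvd_degree R (by omega) hX' hcon
      refine hext S hS hS0 fun v => ?_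
      by_cases hv : (H.filter (v ∈ ·)).card = 0
      · have h : (S.filter (v ∈ ·)).card = 0 := by
          rw [Finset.card_eq_zero, Finset.filter_false_of_mem]
          exact fun e he hve => (Finset.mem_filter.1 (hSX e he v hve)).2 hv
        exact Or.inl (by rw [hv, h])
      · right
        rw [Nat.add_mod, Nat.mod_eq_zero_of_dvd (hdvd v), add_zero, Nat.mod_mod]
        exact (hH v).resolve_left hv
    rw [Finset.mem_filter] at hwX
    refine ⟨w, hwX.1, ?_⟩
    have hout : ((X.filter fun v => ¬ (H.filter (v ∈ ·)).card ≠ 0).filter (R.Adj w)).card < k := by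
      by_contra! hcon
      obtain ⟨L, hL, hLk⟩ := Finset.exists_subset_card_eq hcon
      refine hstar w L (Finset.card_pos.1 (by omega)) (fun u hu => ?_) ?_
      · have := hL hu
        simp only [Finset.mem_filter] at this
        exact ⟨this.2, this.1.2⟩
      · rw [hLk, Nat.add_mod_right]
        exact (hH w).resolve_left hwX.2
    have h := Finset.card_filter_add_card_filter_not (s := X.filter (R.Adj w))
      fun v => (H.filter (v ∈ ·)).card ≠ 0
    rw [Finset.filter_comm, Finset.filter_comm (R.Adj w)] at h
    omega

theorem chi_prime_k_le_linear (k : ℕ) (hk : 2 ≤ k)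
    {V : Type*} [Fintype V] [DecidableEq V] (G : SimpleGraph V) [DecidableRel G.Adj] :
    ∃ c : Sym2 V → Fin (198 * k - 101), IsChiPrimeKColoring G k c := by
  obtain ⟨H, R, _, hH, hHG, hR, hdeg⟩ := exists_edges_degenerate_sdiff G hk
  obtain ⟨f, hf, hd⟩ := exists_injective_back_degree_le R hdeg
  obtain ⟨c, hc⟩ := exists_coloring_of_back_degree_le R hk hf hd
    (κ := Fin (36 * k) ⊕ Fin (20 * k))
    (P := Finset.univ.map Function.Embedding.inl) (Q := Finset.univ.map Function.Embedding.inr)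
    (Finset.disjoint_map_inl_map_inr _ _)
    (by rw [← Finset.card_pos, Finset.card_map, Finset.card_fin]; omega)
    (by rw [Finset.card_map, Finset.card_fin]; omega)
    (by rw [Finset.card_map, Finset.card_fin]; omega)
  obtain ⟨φ⟩ : Nonempty (Option (Fin (36 * k) ⊕ Fin (20 * k)) ↪ Fin (198 * k - 101)) :=
    Function.Embedding.nonempty_of_card_le (by simp; omega)
  refine ⟨fun e => φ (if e ∈ H then none else some (c e)), fun i v => ?_⟩
  unfold colorDeg
  by_cases hi : ∃ j, φ j = i
  swap
  · left
    rw [Finset.card_eq_zero, Finset.filter_false_of_mem]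
    exact fun e _ h => hi ⟨_, h⟩
  obtain ⟨j, rfl⟩ := hi
  simp only [φ.injective.eq_iff]
  cases j with
  | none =>
    have h : (G.incidenceFinset v).filter (fun e => (if e ∈ H then none else some (c e)) = none) =
        H.filter (v ∈ ·) := by
      ext e
      simp only [Finset.mem_filter, SimpleGraph.mem_incidenceFinset, SimpleGraph.incidenceSet,
        Set.mem_sep_iff, ite_eq_left_iff, reduceCtorEq, imp_false, not_not]
      exact ⟨fun h => ⟨h.2, h.1.2⟩, fun h => ⟨⟨hHG e h.1, h.2⟩, h.1⟩⟩
    rw [h]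
    exact hH v
  | some j =>
    have h : (G.incidenceFinset v).filter
        (fun e => (if e ∈ H then none else some (c e)) = some j) =
        (Finset.univ.filter fun w => R.Adj v w ∧ c s(v, w) = j).image (s(v, ·)) := by
      ext e
      simp only [Finset.mem_filter, SimpleGraph.mem_incidenceFinset, SimpleGraph.incidenceSet,
        Set.mem_sep_iff, Finset.mem_image, Finset.mem_univ, true_and, hR]
      constructor
      · rintro ⟨⟨he, w, rfl⟩, h⟩
        by_cases hw : s(v, w) ∈ H
        · simp [hw] at h
        · exact ⟨w, ⟨⟨he, hw⟩, by simpa [hw] using h⟩, rfl⟩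
      · rintro ⟨w, ⟨⟨he, hw⟩, h⟩, rfl⟩
        exact ⟨⟨he, Sym2.mem_mk_left v w⟩, by simp [hw, h]⟩
    rw [h, Finset.card_image_of_injective _ fun a b h => Sym2.congr_right.1 h]
    exact hc v j
end

section
/- Let k ≥ 2 and let H be a (12k−6)-connected graph. Then H contains a non-empty subgraph in which every vertex has degree divisible by k. -/
/-- `G` is `m`-connected: it has more than `m` vertices and deleting any `m − 1`
vertices leaves it connected. -/
def IsMConnected {V : Type*} [Fintype V] (G : SimpleGraph V) (m : ℕ) : Prop :=
  m < Fintype.card V ∧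
    ∀ s : Finset V, s.card ≤ m - 1 → (G.induce {v : V | v ∉ s}).Connected

/-- The distance from `x` to the nearest multiple of `2 * m`. -/
def circNorm (m : ℕ) (x : ℤ) : ℤ := |Int.bmod x (2 * m)|

lemma exists_circNorm_eq (m : ℕ) (x : ℤ) : ∃ k : ℤ, circNorm m x = |x - 2 * m * k| := by
  refine ⟨Int.bdiv x (2 * m), ?_⟩
  have h := Int.bmod_add_bdiv x (2 * m)
  unfold circNorm
  congr 1
  push_cast at h
  linarith

lemma circNorm_le {m : ℕ} (hm : 0 < m) (x k : ℤ) : circNorm m x ≤ |x - 2 * m * k| := by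
  have h := Int.bmod_add_bdiv x (2 * m)
  have h1 := Int.le_bmod (x := x) (m := 2 * m) (by omega)
  have h2 := Int.bmod_lt (x := x) (m := 2 * m) (by omega)
  unfold circNorm
  push_cast at h h1 h2
  set r := x.bmod (2 * m)
  set d := x.bdiv (2 * m)
  have hm' : (0 : ℤ) < m := by exact_mod_cast hm
  have h3 : |r| ≤ m := abs_le.2 ⟨by omega, by omega⟩
  have hx : x - 2 * m * k = r + 2 * m * (d - k) := by rw [← h]; ring
  rw [hx]
  rcases lt_trichotomy (d - k) 0 with hd | hd | hd
  · have : 2 * (m : ℤ) * (d - k) ≤ - (2 * m) := by nlinarith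
    have h5 := neg_abs_le (r + 2 * m * (d - k))
    have h6 := le_abs_self r
    omega
  · rw [hd]; simp
  · have : 2 * (m : ℤ) ≤ 2 * m * (d - k) := by nlinarith
    have h5 := le_abs_self (r + 2 * m * (d - k))
    have h6 := neg_abs_le r
    omega

lemma circNorm_nonneg (m : ℕ) (x : ℤ) : 0 ≤ circNorm m x := abs_nonneg _

lemma circNorm_le_half {m : ℕ} (hm : 0 < m) (x : ℤ) : circNorm m x ≤ m := by
  have h1 := Int.le_bmod (x := x) (m := 2 * m) (by omega)
  have h2 := Int.bmod_lt (x := x) (m := 2 * m) (by omega)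
  push_cast at h1 h2
  exact abs_le.2 ⟨by omega, by omega⟩

lemma circNorm_le_abs {m : ℕ} (hm : 0 < m) (x : ℤ) : circNorm m x ≤ |x| := by
  simpa using circNorm_le hm x 0

lemma circNorm_add_le {m : ℕ} (hm : 0 < m) (x y : ℤ) :
    circNorm m (x + y) ≤ circNorm m x + circNorm m y := by
  obtain ⟨k, hk⟩ := exists_circNorm_eq m x
  obtain ⟨l, hl⟩ := exists_circNorm_eq m y
  have h := circNorm_le hm (x + y) (k + l)
  have h' := abs_add_le (x - 2 * m * k) (y - 2 * m * l)
  rw [hk, hl]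
  refine h.trans (le_trans (le_of_eq ?_) h')
  congr 1; ring

lemma circNorm_add_abs_le {m : ℕ} (hm : 0 < m) (x y : ℤ) :
    circNorm m (x + y) ≤ circNorm m x + |y| :=
  (circNorm_add_le hm x y).trans (by have := circNorm_le_abs hm y; omega)

lemma circNorm_congr {m : ℕ} (hm : 0 < m) {x y : ℤ} (h : (2 * m : ℤ) ∣ x - y) :
    circNorm m x = circNorm m y := by
  have key : ∀ x y : ℤ, (2 * m : ℤ) ∣ x - y → circNorm m x ≤ circNorm m y := by
    rintro x y ⟨c, hc⟩
    obtain ⟨k, hk⟩ := exists_circNorm_eq m y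
    rw [hk]
    refine (circNorm_le hm x (k + c)).trans (le_of_eq ?_)
    congr 1; linear_combination hc
  exact le_antisymm (key x y h) (key y x (by rw [← neg_sub]; exact h.neg_right))

lemma circNorm_neg {m : ℕ} (hm : 0 < m) (x : ℤ) : circNorm m (-x) = circNorm m x := by
  have key : ∀ x : ℤ, circNorm m (-x) ≤ circNorm m x := by
    intro x
    obtain ⟨k, hk⟩ := exists_circNorm_eq m x
    rw [hk, ← abs_neg (x - _)]
    refine (circNorm_le hm (-x) (-k)).trans (le_of_eq ?_)
    congr 1; ring
  exact le_antisymm (key x) (by simpa using key (-x))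

lemma circNorm_parity (m : ℕ) (x : ℤ) : ∃ j : ℤ, circNorm m x = x + 2 * j := by
  obtain ⟨k, hk⟩ := exists_circNorm_eq m x
  rcases abs_choice (x - 2 * m * k) with h | h
  · exact ⟨-(m * k), by rw [hk, h]; ring⟩
  · exact ⟨m * k - x, by rw [hk, h]; ring⟩

lemma circNorm_sub_one_or_add_one {m : ℕ} (hm : 0 < m) {x : ℤ} (h : ¬ (2 * m : ℤ) ∣ x) :
    circNorm m (x - 1) < circNorm m x ∨ circNorm m (x + 1) < circNorm m x := by
  obtain ⟨k, hk⟩ := exists_circNorm_eq m x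
  have h0 : x - 2 * m * k ≠ 0 := fun h0 => h ⟨k, by linarith⟩
  have h1 := circNorm_le hm (x - 1) k
  have h2 := circNorm_le hm (x + 1) k
  rw [hk]
  rcases lt_or_gt_of_ne h0 with h' | h'
  · right
    rw [abs_of_neg h']
    rw [abs_of_nonpos (by omega)] at h2
    omega
  · left
    rw [abs_of_pos h']
    rw [abs_of_nonneg (by omega)] at h1
    omega

/-- A residue whose norm drops when decreased, but not when increased, has a representative
strictly between `0` and `m`. -/
lemma exists_rep_of_circNorm {m : ℕ} (hm : 0 < m) {x : ℤ}
    (h : circNorm m (x - 1) < circNorm m x) (h' : ¬ circNorm m (x + 1) < circNorm m x) :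
    ∃ r : ℤ, 1 ≤ r ∧ r < m ∧ (2 * m : ℤ) ∣ x - r := by
  obtain ⟨k, hk⟩ := exists_circNorm_eq m x
  have h1 := circNorm_le hm (x + 1) k
  have h2 := circNorm_le hm (x + 1) (k + 1)
  have hle := circNorm_le_half hm x
  refine ⟨x - 2 * m * k, ?_, ?_, ⟨k, by ring⟩⟩
  · by_contra hlt
    rcases eq_or_lt_of_le (show x - 2 * m * k ≤ 0 by omega) with h0 | h0
    · rw [h0] at hk; simp at hk
      have := circNorm_nonneg m (x - 1); omega
    · rw [abs_of_neg h0] at hk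
      rw [abs_of_nonpos (by omega)] at h1
      omega
  · by_contra hlt
    have hm' : (0 : ℤ) < m := by exact_mod_cast hm
    have h3 : x - 2 * m * k = m := by
      rw [hk, abs_of_nonneg (by omega)] at hle; omega
    have h4 : x + 1 - 2 * m * (k + 1) = 1 - m := by linear_combination h3
    rw [h4, abs_of_nonpos (by omega)] at h2
    rw [hk, h3, abs_of_pos hm'] at h'
    omega

/-- The admissible pairs (number of edges into the graph, number of edges out of the graph)
for the boundary edges whose direction is already fixed. -/
def AdmissibleBoundary (m : ℕ) (o i : ℤ) : Prop :=
  o + i ≤ 10 * m - 10 + circNorm m (o - i) ∧ o ≤ 8 * m - 4 ∧ i ≤ 8 * m - 4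

lemma AdmissibleBoundary.symm {m : ℕ} (hm : 0 < m) {o i : ℤ} (h : AdmissibleBoundary m o i) :
    AdmissibleBoundary m i o := by
  refine ⟨?_, h.2.2, h.2.1⟩
  rw [show i - o = -(o - i) by ring, circNorm_neg hm]
  have := h.1
  omega

lemma AdmissibleBoundary.sub_left {m : ℕ} (hm : 0 < m) {o i : ℤ} (h : AdmissibleBoundary m o i)
    {r : ℤ} (hr : 0 ≤ r) : AdmissibleBoundary m (o - r) i := by
  refine ⟨?_, by have := h.2.1; omega, h.2.2⟩
  have h1 := circNorm_add_abs_le hm (o - r - i) r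
  rw [abs_of_nonneg hr, show o - r - i + r = o - i by ring] at h1
  have := h.1
  omega

lemma AdmissibleBoundary.sub_right {m : ℕ} (hm : 0 < m) {o i : ℤ} (h : AdmissibleBoundary m o i)
    {r : ℤ} (hr : 0 ≤ r) : AdmissibleBoundary m o (i - r) :=
  ((h.symm hm).sub_left hm hr).symm hm

lemma admissibleBoundary_of_le {m : ℕ} (hm : 2 ≤ m) {o i : ℤ} (ho : 0 ≤ o) (hi : 0 ≤ i)
    (h : o + i ≤ 8 * m - 7 + circNorm m (o - i)) : AdmissibleBoundary m o i := by
  have hm0 : 0 < m := by omega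
  obtain ⟨j, hj⟩ := circNorm_parity m (o - i)
  have key : ∀ o i : ℤ, 0 ≤ o → 0 ≤ i → o + i ≤ 8 * m - 8 + circNorm m (o - i) →
      o ≤ 8 * m - 4 := by
    intro o i ho hi h
    have h1 := circNorm_le hm0 (o - i) 4
    rcases abs_cases (o - i - 2 * m * 4) with ⟨h2, _⟩ | ⟨h2, _⟩ <;> rw [h2] at h1 <;> omega
  have h8 : o + i ≤ 8 * m - 8 + circNorm m (o - i) := by omega
  refine ⟨by omega, key o i ho hi h8, key i o hi ho ?_⟩
  rw [show i - o = -(o - i) by ring, circNorm_neg hm0]; omega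

section Multigraph

variable {V : Type*}

/-- The multigraph underlying a multiset of arcs. -/
def unoriented (O : Multiset (V × V)) : Multiset (Sym2 V) := O.map fun a => s(a.1, a.2)

/-- All edges of `s` have both ends in `W`. -/
def EndsIn (s : Multiset (Sym2 V)) (W : Finset V) : Prop := ∀ x y, s(x, y) ∈ s → x ∈ W ∧ y ∈ W

@[simp] lemma unoriented_zero : unoriented (0 : Multiset (V × V)) = 0 := rfl
@[simp] lemma unoriented_cons (a : V × V) (O : Multiset (V × V)) :
    unoriented (a ::ₘ O) = s(a.1, a.2) ::ₘ unoriented O := by simp [unoriented]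
@[simp] lemma unoriented_add (O O' : Multiset (V × V)) :
    unoriented (O + O') = unoriented O + unoriented O' := by simp [unoriented]

lemma EndsIn.of_cons {e : Sym2 V} {s : Multiset (Sym2 V)} {W : Finset V}
    (h : EndsIn (e ::ₘ s) W) : EndsIn s W := fun x y hxy => h x y (Multiset.mem_cons_of_mem hxy)

lemma EndsIn.cons {x y : V} {s : Multiset (Sym2 V)} {W : Finset V}
    (h : EndsIn s W) (hx : x ∈ W) (hy : y ∈ W) : EndsIn (s(x, y) ::ₘ s) W := by
  intro u v huv
  rcases Multiset.mem_cons.1 huv with h' | h'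
  · rcases Sym2.eq_iff.1 h' with ⟨rfl, rfl⟩ | ⟨rfl, rfl⟩
    exacts [⟨hx, hy⟩, ⟨hy, hx⟩]
  · exact h u v h'

lemma EndsIn.mono {s s' : Multiset (Sym2 V)} {W : Finset V}
    (h : EndsIn s W) (hs : s' ≤ s) : EndsIn s' W :=
  fun x y hxy => h x y (Multiset.mem_of_le hs hxy)

variable [DecidableEq V]

/-- The indicator of the edges with exactly one end in `A`. -/
def crossing (A : Finset V) : Sym2 V → ℤ :=
  Sym2.lift ⟨fun x y => if (x ∈ A ↔ y ∈ A) then 0 else 1, fun x y => by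
    simp only [iff_comm]⟩

/-- The number of ends of an edge which are equal to `v`; a loop has two equal ends. -/
def incid (v : V) : Sym2 V → ℤ :=
  Sym2.lift ⟨fun x y => (if x = v then 1 else 0) + (if y = v then 1 else 0), fun x y => by
    exact add_comm _ _⟩

@[simp] lemma crossing_mk (A : Finset V) (x y : V) :
    crossing A s(x, y) = if (x ∈ A ↔ y ∈ A) then 0 else 1 := rfl

@[simp] lemma incid_mk (v x y : V) :
    incid v s(x, y) = (if x = v then 1 else 0) + (if y = v then 1 else 0) := rfl

/-- The number of edges of the multigraph `s` leaving `A`. -/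
def mcut (s : Multiset (Sym2 V)) (A : Finset V) : ℤ := (s.map (crossing A)).sum

/-- The degree of `v` in the multigraph `s`. -/
def mdeg (s : Multiset (Sym2 V)) (v : V) : ℤ := (s.map (incid v)).sum

/-- The out-degree of `v` in the multiset of arcs `O`. -/
def tails (O : Multiset (V × V)) (v : V) : ℤ := (O.map fun a => if a.1 = v then 1 else 0).sum

/-- The in-degree of `v` in the multiset of arcs `O`. -/
def heads (O : Multiset (V × V)) (v : V) : ℤ := (O.map fun a => if a.2 = v then 1 else 0).sum

@[simp] lemma mcut_zero (A : Finset V) : mcut 0 A = 0 := rfl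
@[simp] lemma mcut_cons (e : Sym2 V) (s : Multiset (Sym2 V)) (A : Finset V) :
    mcut (e ::ₘ s) A = crossing A e + mcut s A := by simp [mcut]
@[simp] lemma mcut_add (s s' : Multiset (Sym2 V)) (A : Finset V) :
    mcut (s + s') A = mcut s A + mcut s' A := by simp [mcut]
@[simp] lemma mdeg_zero (v : V) : mdeg 0 v = 0 := rfl
@[simp] lemma mdeg_cons (e : Sym2 V) (s : Multiset (Sym2 V)) (v : V) :
    mdeg (e ::ₘ s) v = incid v e + mdeg s v := by simp [mdeg]
@[simp] lemma mdeg_add (s s' : Multiset (Sym2 V)) (v : V) :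
    mdeg (s + s') v = mdeg s v + mdeg s' v := by simp [mdeg]
@[simp] lemma tails_zero (v : V) : tails 0 v = 0 := rfl
@[simp] lemma tails_cons (a : V × V) (O : Multiset (V × V)) (v : V) :
    tails (a ::ₘ O) v = (if a.1 = v then 1 else 0) + tails O v := by simp [tails]
@[simp] lemma tails_add (O O' : Multiset (V × V)) (v : V) :
    tails (O + O') v = tails O v + tails O' v := by simp [tails]
@[simp] lemma heads_zero (v : V) : heads 0 v = 0 := rfl
@[simp] lemma heads_cons (a : V × V) (O : Multiset (V × V)) (v : V) :
    heads (a ::ₘ O) v = (if a.2 = v then 1 else 0) + heads O v := by simp [heads]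
lemma tails_nonneg (O : Multiset (V × V)) (v : V) : 0 ≤ tails O v := by
  induction O using Multiset.induction_on with
  | empty => simp
  | cons a O ih => rw [tails_cons]; split_ifs <;> omega

lemma heads_nonneg (O : Multiset (V × V)) (v : V) : 0 ≤ heads O v := by
  induction O using Multiset.induction_on with
  | empty => simp
  | cons a O ih => rw [heads_cons]; split_ifs <;> omega

lemma crossing_nonneg (A : Finset V) (e : Sym2 V) : 0 ≤ crossing A e := by
  induction e using Sym2.ind with
  | _ x y => rw [crossing_mk]; split_ifs <;> norm_num

lemma mcut_nonneg (s : Multiset (Sym2 V)) (A : Finset V) : 0 ≤ mcut s A := by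
  induction s using Multiset.induction_on with
  | empty => simp
  | cons e s ih => have := crossing_nonneg A e; rw [mcut_cons]; omega

lemma sum_incid (A : Finset V) (x y : V) :
    ∑ v ∈ A, incid v s(x, y) = (if x ∈ A then 1 else 0) + (if y ∈ A then 1 else 0) := by
  simp [Finset.sum_add_distrib]

lemma mdeg_unoriented (O : Multiset (V × V)) (v : V) :
    mdeg (unoriented O) v = tails O v + heads O v := by
  induction O using Multiset.induction_on with
  | empty => simp
  | cons a O ih =>
    simp only [unoriented_cons, mdeg_cons, incid_mk, tails_cons, heads_cons, ih]
    ring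

lemma sum_mdeg {s : Multiset (Sym2 V)} {W : Finset V} (h : EndsIn s W) :
    ∑ v ∈ W, mdeg s v = 2 * s.card := by
  induction s using Multiset.induction_on with
  | empty => simp
  | cons e s ih =>
    induction e using Sym2.ind with
    | _ x y =>
      have hxy := h x y (Multiset.mem_cons_self _ _)
      simp only [mdeg_cons, Finset.sum_add_distrib, ih h.of_cons, Multiset.card_cons]
      rw [sum_incid, if_pos hxy.1, if_pos hxy.2]; push_cast; ring

lemma sum_tails {O : Multiset (V × V)} {W : Finset V} (h : ∀ a ∈ O, a.1 ∈ W) :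
    ∑ v ∈ W, tails O v = O.card := by
  induction O using Multiset.induction_on with
  | empty => simp
  | cons a O ih =>
    have ha := h a (Multiset.mem_cons_self _ _)
    simp only [tails_cons, Finset.sum_add_distrib, Multiset.card_cons,
      ih fun b hb => h b (Multiset.mem_cons_of_mem hb)]
    simp [ha]; ring

lemma mcut_eq_zero {s : Multiset (Sym2 V)} {A : Finset V} (h : EndsIn s A) : mcut s A = 0 := by
  induction s using Multiset.induction_on with
  | empty => simp
  | cons e s ih =>
    induction e using Sym2.ind with
    | _ x y =>
      have hxy := h x y (Multiset.mem_cons_self _ _)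
      simp [ih h.of_cons, hxy]

lemma mcut_sdiff {s : Multiset (Sym2 V)} {W : Finset V} (h : EndsIn s W) (A : Finset V) :
    mcut s (W \ A) = mcut s A := by
  induction s using Multiset.induction_on with
  | empty => simp
  | cons e s ih =>
    induction e using Sym2.ind with
    | _ x y =>
      have hxy := h x y (Multiset.mem_cons_self _ _)
      simp [ih h.of_cons, hxy, not_iff_not]

/-- The value which an orientation has to meet at `v` modulo `2 * m`: the prescribed value of
out-degree minus in-degree, where `q v` and `p v` further arcs leave and enter `v`. -/
def excess (s : Multiset (Sym2 V)) (t p q : V → ℤ) (v : V) : ℤ := 2 * t v - mdeg s v + q v - p v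

/-- The number of edges leaving `A`, including the `p v` and `q v` further arcs at its vertices. -/
def boundary (s : Multiset (Sym2 V)) (p q : V → ℤ) (A : Finset V) : ℤ :=
  mcut s A + ∑ v ∈ A, p v + ∑ v ∈ A, q v

lemma exists_sum_mdeg_eq (s : Multiset (Sym2 V)) (A : Finset V) :
    ∃ j, ∑ v ∈ A, mdeg s v = mcut s A + 2 * j := by
  induction s using Multiset.induction_on with
  | empty => exact ⟨0, by simp⟩
  | cons e s ih =>
    obtain ⟨j, hj⟩ := ih
    induction e using Sym2.ind with
    | _ x y =>
      simp only [mdeg_cons, Finset.sum_add_distrib, mcut_cons, hj, sum_incid, crossing_mk]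
      by_cases hx : x ∈ A <;> by_cases hy : y ∈ A <;> simp only [hx, hy, if_true, if_false]
      · exact ⟨j + 1, by simp; ring⟩
      · exact ⟨j, by simp; ring⟩
      · exact ⟨j, by simp; ring⟩
      · exact ⟨j, by simp⟩

lemma sum_excess (s : Multiset (Sym2 V)) (t p q : V → ℤ) (A : Finset V) :
    ∑ v ∈ A, excess s t p q v =
      2 * ∑ v ∈ A, t v - ∑ v ∈ A, mdeg s v + ∑ v ∈ A, q v - ∑ v ∈ A, p v := by
  simp only [excess, Finset.sum_add_distrib, Finset.sum_sub_distrib, Finset.mul_sum]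

lemma exists_boundary_eq (s : Multiset (Sym2 V)) (t p q : V → ℤ) (A : Finset V) :
    ∃ j, boundary s p q A = ∑ v ∈ A, excess s t p q v + 2 * j := by
  obtain ⟨j, hj⟩ := exists_sum_mdeg_eq s A
  exact ⟨mcut s A + j + ∑ v ∈ A, p v - ∑ v ∈ A, t v, by rw [sum_excess, boundary, hj]; ring⟩

/-- `s` has an orientation in which the out-degree of each `v ∈ W` is `t v` modulo `m`. -/
def Solvable (m : ℕ) (W : Finset V) (s : Multiset (Sym2 V)) (t : V → ℤ) : Prop :=
  ∃ O : Multiset (V × V), unoriented O = s ∧ ∀ v ∈ W, (m : ℤ) ∣ t v - tails O v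

/-- The conditions on a multigraph with prescribed out-degrees other than cut conditions. -/
structure BalancedBoundary (m : ℕ) (W : Finset V) (s : Multiset (Sym2 V)) (t p q : V → ℤ) :
    Prop where
  endsIn : EndsIn s W
  nonneg_left : ∀ v, 0 ≤ p v
  nonneg_right : ∀ v, 0 ≤ q v
  dvd_sum : (m : ℤ) ∣ ∑ v ∈ W, t v - s.card
  admissible : AdmissibleBoundary m (∑ v ∈ W, p v) (∑ v ∈ W, q v)

/-- The set `A` has sufficiently many boundary edges. -/
def CutCond (m : ℕ) (s : Multiset (Sym2 V)) (t p q : V → ℤ) (A : Finset V) : Prop :=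
  6 * m - 6 + circNorm m (∑ v ∈ A, excess s t p q v) ≤ boundary s p q A

/-- All nonempty proper subsets have sufficiently many boundary edges. -/
structure CutRegular (m : ℕ) (W : Finset V) (s : Multiset (Sym2 V)) (t p q : V → ℤ) : Prop
    extends BalancedBoundary m W s t p q where
  cut : ∀ A ⊆ W, A.Nonempty → A ≠ W → CutCond m s t p q A

/-- All nonempty proper subsets except possibly `{e}` and its complement have sufficiently many
boundary edges. -/
structure CutRegularExcept (m : ℕ) (W : Finset V) (s : Multiset (Sym2 V)) (t p q : V → ℤ)
    (e : V) : Prop extends BalancedBoundary m W s t p q where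
  mem : e ∈ W
  cut : ∀ A ⊆ W, A.Nonempty → A ≠ W → A ≠ {e} → A ≠ W.erase e → CutCond m s t p q A
  dvd_excess : (2 * m : ℤ) ∣ excess s t p q e
  left_le : p e ≤ mcut s {e} + q e
  right_le : q e ≤ mcut s {e} + p e

lemma BalancedBoundary.dvd_sum_excess {m : ℕ} {W : Finset V} {s : Multiset (Sym2 V)} {t p q : V → ℤ}
    (h : BalancedBoundary m W s t p q) :
    (2 * m : ℤ) ∣ ∑ v ∈ W, excess s t p q v - (∑ v ∈ W, q v - ∑ v ∈ W, p v) := by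
  obtain ⟨c, hc⟩ := h.dvd_sum
  exact ⟨c, by rw [sum_excess, sum_mdeg h.endsIn]; linear_combination 2 * hc⟩

end Multigraph

section Collapse

variable {V : Type*}

lemma exists_orientation_lift (φ : V → V) (s : Multiset (Sym2 V)) (O' : Multiset (V × V))
    (h : unoriented O' = s.map (Sym2.map φ)) :
    ∃ O, unoriented O = s ∧ O.map (Prod.map φ φ) = O' := by
  induction s using Multiset.induction_on generalizing O' with
  | empty => exact ⟨0, rfl, by simpa [unoriented, eq_comm] using h⟩
  | cons e s ih =>
    induction e using Sym2.ind with
    | _ x y =>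
      rw [Multiset.map_cons, Sym2.map_mk] at h
      obtain ⟨a, ha, ha'⟩ := Multiset.mem_map.1 (h ▸ Multiset.mem_cons_self _ _ :
        s(φ x, φ y) ∈ unoriented O')
      obtain ⟨O₁, rfl⟩ := Multiset.exists_cons_of_mem ha
      rw [unoriented_cons, ha', Multiset.cons_inj_right] at h
      obtain ⟨O, hO, hO'⟩ := ih O₁ h
      obtain ⟨u, v⟩ := a
      rcases Sym2.eq_iff.1 ha' with ⟨h1, h2⟩ | ⟨h1, h2⟩ <;> dsimp only at h1 h2
      · exact ⟨(x, y) ::ₘ O, by simp [hO], by simp [hO', h1, h2]⟩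
      · exact ⟨(y, x) ::ₘ O, by simp [hO, Sym2.eq_swap], by simp [hO', h1, h2]⟩

variable [DecidableEq V]

/-- The sum of `f` over the fibres of `φ` in `W`. -/
def push (W : Finset V) (φ : V → V) (f : V → ℤ) (v : V) : ℤ := ∑ u ∈ W with φ u = v, f u

/-- The map contracting `A` to the vertex `a`. -/
def shrink (A : Finset V) (a : V) (v : V) : V := if v ∈ A then a else v

lemma sum_push (W : Finset V) (φ : V → V) (f : V → ℤ) (B : Finset V) :
    ∑ v ∈ B, push W φ f v = ∑ v ∈ W with φ v ∈ B, f v := by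
  rw [← Finset.sum_fiberwise_of_maps_to (s := W.filter (φ · ∈ B)) (t := B) (g := φ)
    (fun i hi => (Finset.mem_filter.1 hi).2)]
  refine Finset.sum_congr rfl fun v hv => Finset.sum_congr ?_ fun _ _ => rfl
  ext u
  simp only [Finset.mem_filter]
  constructor
  · rintro ⟨h1, rfl⟩; exact ⟨⟨h1, hv⟩, rfl⟩
  · rintro ⟨⟨h1, _⟩, h2⟩; exact ⟨h1, h2⟩

lemma mcut_map {s : Multiset (Sym2 V)} {W : Finset V} (h : EndsIn s W) (φ : V → V)
    (B : Finset V) : mcut (s.map (Sym2.map φ)) B = mcut s (W.filter (φ · ∈ B)) := by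
  induction s using Multiset.induction_on with
  | empty => simp
  | cons e s ih =>
    induction e using Sym2.ind with
    | _ x y =>
      have hxy := h x y (Multiset.mem_cons_self _ _)
      simp [ih h.of_cons, hxy]

lemma mdeg_map {s : Multiset (Sym2 V)} {W : Finset V} (h : EndsIn s W) (φ : V → V)
    (v : V) : mdeg (s.map (Sym2.map φ)) v = push W φ (mdeg s) v := by
  induction s using Multiset.induction_on with
  | empty => simp [push]
  | cons e s ih =>
    induction e using Sym2.ind with
    | _ x y =>
      have hxy := h x y (Multiset.mem_cons_self _ _)
      simp only [Multiset.map_cons, Sym2.map_mk, mdeg_cons, ih h.of_cons, push,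
        Finset.sum_add_distrib, sum_incid]
      simp [hxy]

lemma tails_map {O : Multiset (V × V)} {W : Finset V} (h : EndsIn (unoriented O) W) (φ : V → V)
    (v : V) : tails (O.map (Prod.map φ φ)) v = push W φ (tails O) v := by
  induction O using Multiset.induction_on with
  | empty => simp [push]
  | cons a O ih =>
    rw [unoriented_cons] at h
    have ha := h _ _ (Multiset.mem_cons_self _ _)
    simp only [Multiset.map_cons, tails_cons, ih h.of_cons, push, Finset.sum_add_distrib]
    simp [ha]

lemma excess_map {s : Multiset (Sym2 V)} {W : Finset V} (h : EndsIn s W) (φ : V → V)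
    (t p q : V → ℤ) (v : V) :
    excess (s.map (Sym2.map φ)) (push W φ t) (push W φ p) (push W φ q) v =
      push W φ (excess s t p q) v := by
  rw [excess, mdeg_map h]
  simp only [push, sum_excess]

lemma EndsIn.map {s : Multiset (Sym2 V)} {W : Finset V} (h : EndsIn s W) (φ : V → V) :
    EndsIn (s.map (Sym2.map φ)) (W.image φ) := by
  intro x y hxy
  obtain ⟨e, he, hxy⟩ := Multiset.mem_map.1 hxy
  induction e using Sym2.ind with
  | _ u v =>
    have huv := h u v he
    have h1 := Finset.mem_image_of_mem φ huv.1
    have h2 := Finset.mem_image_of_mem φ huv.2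
    rw [Sym2.map_mk] at hxy
    rcases Sym2.eq_iff.1 hxy with ⟨rfl, rfl⟩ | ⟨rfl, rfl⟩
    exacts [⟨h1, h2⟩, ⟨h2, h1⟩]

lemma boundary_map {s : Multiset (Sym2 V)} {W : Finset V} (h : EndsIn s W) (φ : V → V)
    (p q : V → ℤ) (B : Finset V) :
    boundary (s.map (Sym2.map φ)) (push W φ p) (push W φ q) B =
      boundary s p q (W.filter (φ · ∈ B)) := by
  rw [boundary, mcut_map h, sum_push, sum_push, boundary]

lemma cutCond_map {m : ℕ} {s : Multiset (Sym2 V)} {W : Finset V} (h : EndsIn s W) (φ : V → V)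
    (t p q : V → ℤ) {B : Finset V}
    (hcut : CutCond m s t p q (W.filter (φ · ∈ B))) :
    CutCond m (s.map (Sym2.map φ)) (push W φ t) (push W φ p) (push W φ q) B := by
  unfold CutCond at hcut ⊢
  simp only [excess_map h]
  rwa [boundary_map h, sum_push]

lemma BalancedBoundary.map {m : ℕ} {W : Finset V} {s : Multiset (Sym2 V)} {t p q : V → ℤ}
    (h : BalancedBoundary m W s t p q) (φ : V → V) :
    BalancedBoundary m (W.image φ) (s.map (Sym2.map φ)) (push W φ t) (push W φ p)
      (push W φ q) := by
  have key : ∀ f : V → ℤ, ∑ v ∈ W.image φ, push W φ f v = ∑ v ∈ W, f v := by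
    intro f
    rw [sum_push, Finset.filter_true_of_mem]
    exact fun v hv => Finset.mem_image_of_mem φ hv
  refine ⟨h.endsIn.map φ, fun v => Finset.sum_nonneg fun u _ => h.nonneg_left u,
    fun v => Finset.sum_nonneg fun u _ => h.nonneg_right u, ?_, ?_⟩
  · rw [key, Multiset.card_map]; exact h.dvd_sum
  · rw [key, key]; exact h.admissible

lemma filter_ne_of_ne {W B : Finset V} {φ : V → V} (hB : B ⊆ W.image φ) (hne : B ≠ W.image φ) :
    W.filter (φ · ∈ B) ≠ W := by
  intro h
  refine hne (Finset.Subset.antisymm hB fun v hv => ?_)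
  obtain ⟨u, hu, rfl⟩ := Finset.mem_image.1 hv
  rw [← h] at hu
  exact (Finset.mem_filter.1 hu).2

lemma filter_nonempty_of_nonempty {W B : Finset V} {φ : V → V} (hB : B ⊆ W.image φ)
    (hne : B.Nonempty) : (W.filter (φ · ∈ B)).Nonempty := by
  obtain ⟨v, hv⟩ := hne
  obtain ⟨u, hu, rfl⟩ := Finset.mem_image.1 (hB hv)
  exact ⟨u, Finset.mem_filter.2 ⟨hu, hv⟩⟩

lemma image_filter_eq {W B : Finset V} {φ : V → V} (hB : B ⊆ W.image φ) :
    (W.filter (φ · ∈ B)).image φ = B := by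
  ext v
  constructor
  · intro hv
    obtain ⟨u, hu, rfl⟩ := Finset.mem_image.1 hv
    exact (Finset.mem_filter.1 hu).2
  · intro hv
    obtain ⟨u, hu, rfl⟩ := Finset.mem_image.1 (hB hv)
    exact Finset.mem_image_of_mem φ (Finset.mem_filter.2 ⟨hu, hv⟩)

lemma shrink_of_mem {A : Finset V} {a v : V} (h : v ∈ A) : shrink A a v = a := if_pos h

lemma shrink_of_notMem {A : Finset V} {a v : V} (h : v ∉ A) : shrink A a v = v := if_neg h

lemma subset_or_disjoint_filter {W A : Finset V} (hA : A ⊆ W) (a : V) (B : Finset V) :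
    A ⊆ W.filter (shrink A a · ∈ B) ∨ Disjoint A (W.filter (shrink A a · ∈ B)) := by
  by_cases h : a ∈ B
  · left
    intro v hv
    rw [Finset.mem_filter, shrink_of_mem hv]
    exact ⟨hA hv, h⟩
  · right
    rw [Finset.disjoint_left]
    intro v hv hv'
    rw [Finset.mem_filter, shrink_of_mem hv] at hv'
    exact h hv'.2

lemma card_image_shrink_lt {W A : Finset V} (hA : A ⊆ W) (hcard : 2 ≤ A.card) (a : V) :
    (W.image (shrink A a)).card < W.card := by
  have hsub : W.image (shrink A a) ⊆ insert a (W \ A) := by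
    intro v hv
    obtain ⟨u, hu, rfl⟩ := Finset.mem_image.1 hv
    by_cases h : u ∈ A
    · simp [shrink_of_mem h]
    · simp [shrink_of_notMem h, hu, h]
  have h1 := Finset.card_le_card hsub
  have h2 := Finset.card_insert_le a (W \ A)
  have h3 := Finset.card_sdiff_add_card_eq_card hA
  omega

/-- Contracting a set `A` keeps the cut conditions if they hold for all sets not separating `A`. -/
lemma BalancedBoundary.cutRegular_shrink {m : ℕ} {W A : Finset V} {s : Multiset (Sym2 V)}
    {t p q : V → ℤ} (h : BalancedBoundary m W s t p q) (hA : A ⊆ W) (a : V)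
    (hcut : ∀ B ⊆ W, B.Nonempty → B ≠ W → A ⊆ B ∨ Disjoint A B → CutCond m s t p q B) :
    CutRegular m (W.image (shrink A a)) (s.map (Sym2.map (shrink A a)))
      (push W (shrink A a) t) (push W (shrink A a) p) (push W (shrink A a) q) where
  toBalancedBoundary := h.map _
  cut B hB hne hne' := cutCond_map h.endsIn _ _ _ _ <|
    hcut _ (Finset.filter_subset _ _) (filter_nonempty_of_nonempty hB hne)
      (filter_ne_of_ne hB hne') (subset_or_disjoint_filter hA a B)

lemma push_shrink_of_notMem {W A : Finset V} {a v : V} (ha : a ∈ A) (hv : v ∉ A) (hvW : v ∈ W)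
    (f : V → ℤ) : push W (shrink A a) f v = f v := by
  have : W.filter (shrink A a · = v) = {v} := by
    ext u
    rw [Finset.mem_filter, Finset.mem_singleton]
    constructor
    · rintro ⟨_, h⟩
      by_cases hu : u ∈ A
      · rw [shrink_of_mem hu] at h; exact absurd (h ▸ ha) hv
      · rwa [shrink_of_notMem hu] at h
    · rintro rfl; exact ⟨hvW, shrink_of_notMem hv⟩
  rw [push, this, Finset.sum_singleton]

lemma push_shrink_self {W A : Finset V} {a : V} (hA : A ⊆ W) (ha : a ∈ A)
    (f : V → ℤ) : push W (shrink A a) f a = ∑ v ∈ A, f v := by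
  have : W.filter (shrink A a · = a) = A := by
    ext u
    rw [Finset.mem_filter]
    constructor
    · rintro ⟨_, h⟩
      by_contra hu
      rw [shrink_of_notMem hu] at h; exact hu (h ▸ ha)
    · intro hu; exact ⟨hA hu, shrink_of_mem hu⟩
  rw [push, this]

lemma filter_shrink_singleton {W A : Finset V} {a e : V} (ha : a ∈ A) (he : e ∉ A)
    (heW : e ∈ W) : W.filter (shrink A a · ∈ ({e} : Finset V)) = {e} := by
  ext u
  simp only [Finset.mem_filter, Finset.mem_singleton]
  constructor
  · rintro ⟨_, h⟩
    by_cases hu : u ∈ A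
    · rw [shrink_of_mem hu] at h; exact absurd (h ▸ ha) he
    · rwa [shrink_of_notMem hu] at h
  · rintro rfl; exact ⟨heW, shrink_of_notMem he⟩

lemma image_shrink_erase {W A : Finset V} {a e : V} (ha : a ∈ A) (he : e ∉ A) :
    (W.erase e).image (shrink A a) = (W.image (shrink A a)).erase e := by
  ext v
  simp only [Finset.mem_image, Finset.mem_erase]
  constructor
  · rintro ⟨u, ⟨hu, huW⟩, rfl⟩
    refine ⟨fun h => ?_, u, huW, rfl⟩
    by_cases huA : u ∈ A
    · rw [shrink_of_mem huA] at h; exact he (h ▸ ha)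
    · rw [shrink_of_notMem huA] at h; exact hu h
  · rintro ⟨hv, u, huW, rfl⟩
    refine ⟨u, ⟨?_, huW⟩, rfl⟩
    rintro rfl
    exact hv (shrink_of_notMem he)

lemma CutRegularExcept.image_shrink {m : ℕ} {W A : Finset V} {s : Multiset (Sym2 V)}
    {t p q : V → ℤ} {a e : V} (h : CutRegularExcept m W s t p q e) (ha : a ∈ A)
    (he : e ∉ A) :
    CutRegularExcept m (W.image (shrink A a)) (s.map (Sym2.map (shrink A a)))
      (push W (shrink A a) t) (push W (shrink A a) p) (push W (shrink A a) q) e where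
  toBalancedBoundary := h.toBalancedBoundary.map _
  mem := Finset.mem_image.2 ⟨e, h.mem, shrink_of_notMem he⟩
  cut B hB hne hne' h1 h2 := by
    refine cutCond_map h.endsIn _ _ _ _ <|
      h.cut _ (Finset.filter_subset _ _) (filter_nonempty_of_nonempty hB hne)
        (filter_ne_of_ne hB hne') (fun h' => h1 ?_) (fun h' => h2 ?_)
    · rw [← image_filter_eq hB, h', Finset.image_singleton, shrink_of_notMem he]
    · rw [← image_filter_eq hB, h', image_shrink_erase ha he]
  dvd_excess := by
    rw [excess_map h.endsIn, push_shrink_of_notMem ha he h.mem]; exact h.dvd_excess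
  left_le := by
    rw [push_shrink_of_notMem ha he h.mem, push_shrink_of_notMem ha he h.mem,
      mcut_map h.endsIn, filter_shrink_singleton ha he h.mem]
    exact h.left_le
  right_le := by
    rw [push_shrink_of_notMem ha he h.mem, push_shrink_of_notMem ha he h.mem,
      mcut_map h.endsIn, filter_shrink_singleton ha he h.mem]
    exact h.right_le

lemma mcut_unoriented_of_not_both {O : Multiset (V × V)} {A B : Finset V} (hB : B ⊆ A)
    (h : ∀ a ∈ O, ¬ (a.1 ∈ A ∧ a.2 ∈ A)) :
    mcut (unoriented O) B = ∑ v ∈ B, tails O v + ∑ v ∈ B, heads O v := by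
  induction O using Multiset.induction_on with
  | empty => simp
  | cons a O ih =>
    have ha := h a (Multiset.mem_cons_self _ _)
    have h1 : ¬ (a.1 ∈ B ∧ a.2 ∈ B) := fun h' => ha ⟨hB h'.1, hB h'.2⟩
    simp only [unoriented_cons, mcut_cons, crossing_mk, tails_cons, heads_cons,
      Finset.sum_add_distrib, ih fun b hb => h b (Multiset.mem_cons_of_mem hb),
      Finset.sum_ite_eq]
    by_cases hx : a.1 ∈ B <;> by_cases hy : a.2 ∈ B <;> simp_all <;> ring

/-- `s'` is the part of `s` inside `A`, and `t'`, `p'`, `q'` are the data obtained from `t`, `p`,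
`q` by orienting all the edges with at most one end in `A`. -/
structure IsPiece (m : ℕ) (A : Finset V) (s : Multiset (Sym2 V)) (t p q : V → ℤ)
    (s' : Multiset (Sym2 V)) (t' p' q' : V → ℤ) : Prop where
  endsIn : EndsIn s' A
  left_le : p ≤ p'
  right_le : q ≤ q'
  dvd_sum : (m : ℤ) ∣ ∑ v ∈ A, t' v - s'.card
  boundary_eq : ∀ B ⊆ A, boundary s' p' q' B = boundary s p q B
  excess_eq : ∀ v, excess s' t' p' q' v = excess s t p q v
  count_eq : ∀ x ∈ A, ∀ y ∈ A, s'.count s(x, y) = s.count s(x, y)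

/-- An orientation of the graph in which `A` is contracted can be extended to one of the whole
graph if the graph inside `A`, with every pre-orientation of the boundary edges, can be
oriented. -/
theorem Solvable.of_shrink {m : ℕ} {W A : Finset V} {s : Multiset (Sym2 V)}
    {t : V → ℤ} (p q : V → ℤ) {a : V} (hA : A ⊆ W) (ha : a ∈ A) (hs : EndsIn s W)
    (hq : Solvable m (W.image (shrink A a)) (s.map (Sym2.map (shrink A a)))
      (push W (shrink A a) t))
    (hin : ∀ s' t' p' q', IsPiece m A s t p q s' t' p' q' → Solvable m A s' t') :
    Solvable m W s t := by
  obtain ⟨O', hO', ht'⟩ := hq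
  obtain ⟨O, rfl, rfl⟩ := exists_orientation_lift _ _ _ hO'
  set O₁ := O.filter (fun a => a.1 ∈ A ∧ a.2 ∈ A) with hO₁
  set O₂ := O.filter (fun a => ¬ (a.1 ∈ A ∧ a.2 ∈ A)) with hO₂
  have hO : O = O₁ + O₂ := (Multiset.filter_add_not _ _).symm
  have h1 : ∀ a ∈ O₁, a.1 ∈ A ∧ a.2 ∈ A := fun a ha => (Multiset.mem_filter.1 ha).2
  have h2 : ∀ a ∈ O₂, ¬ (a.1 ∈ A ∧ a.2 ∈ A) := fun a ha => (Multiset.mem_filter.1 ha).2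
  have hends : EndsIn (unoriented O₁) A := by
    intro x y hxy
    obtain ⟨b, hb, hxy⟩ := Multiset.mem_map.1 hxy
    have := h1 b hb
    rcases Sym2.eq_iff.1 hxy with ⟨rfl, rfl⟩ | ⟨rfl, rfl⟩
    exacts [this, this.symm]
  clear_value O₁ O₂
  subst hO
  have hmap := tails_map (O := O₁ + O₂) hs (shrink A a)
  have hsum1 := sum_tails (O := O₁) (W := A) fun a ha => (h1 a ha).1
  have hcut1 : ∀ B ⊆ A, boundary (unoriented O₁) (p + heads O₂) (q + tails O₂) B
      = boundary (unoriented (O₁ + O₂)) p q B := by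
    intro B hB
    simp only [boundary, unoriented_add, mcut_add, mcut_unoriented_of_not_both hB h2,
      Pi.add_apply, Finset.sum_add_distrib]
    ring
  obtain ⟨O₃, hO₃, ht₃⟩ := hin (unoriented O₁) (t - tails O₂) (p + heads O₂) (q + tails O₂) ⟨hends,
    fun v => by have := heads_nonneg O₂ v; simp; omega,
    fun v => by have := tails_nonneg O₂ v; simp; omega,
    by
      have := ht' a (Finset.mem_image.2 ⟨a, hA ha, shrink_of_mem ha⟩)
      rw [hmap, push_shrink_self hA ha, push_shrink_self hA ha] at this
      simp only [tails_add, Finset.sum_add_distrib, hsum1] at this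
      simp only [Pi.sub_apply, Finset.sum_sub_distrib, unoriented, Multiset.card_map]
      convert this using 1; ring,
    hcut1,
    fun v => by
      simp only [excess, unoriented_add, mdeg_add, mdeg_unoriented, Pi.add_apply, Pi.sub_apply]
      ring,
    fun x hx y hy => by
      rw [unoriented_add, Multiset.count_add, Multiset.count_eq_zero_of_notMem (s := unoriented O₂),
        add_zero]
      intro h
      obtain ⟨b, hb, hxy⟩ := Multiset.mem_map.1 h
      have := h2 b hb
      rcases Sym2.eq_iff.1 hxy with ⟨rfl, rfl⟩ | ⟨rfl, rfl⟩
      exacts [this ⟨hx, hy⟩, this ⟨hy, hx⟩]⟩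
  refine ⟨O₃ + O₂, by rw [unoriented_add, hO₃, unoriented_add], fun v hv => ?_⟩
  by_cases hvA : v ∈ A
  · have := ht₃ v hvA
    rw [tails_add]
    rw [Pi.sub_apply] at this
    convert this using 1; ring
  · have := ht' v (Finset.mem_image.2 ⟨v, hv, shrink_of_notMem hvA⟩)
    rw [hmap, push_shrink_of_notMem ha hvA hv, push_shrink_of_notMem ha hvA hv, tails_add] at this
    have hz : ∀ O : Multiset (V × V), EndsIn (unoriented O) A → tails O v = 0 := by
      intro O hO
      refine Multiset.sum_eq_zero fun c hc => ?_
      obtain ⟨b, hb, rfl⟩ := Multiset.mem_map.1 hc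
      refine if_neg ?_
      rintro rfl
      exact hvA (hO b.1 b.2 (Multiset.mem_map_of_mem _ hb)).1
    rw [hz O₁ hends] at this
    rw [tails_add, hz O₃ (hO₃ ▸ hends)]
    exact this

end Collapse

section Contraction

variable {V : Type*} [DecidableEq V]

/-- Multigraphs on fewer than `n` vertices with the cut conditions have orientations. -/
def SolvableBelow (V : Type*) [DecidableEq V] (m n : ℕ) : Prop :=
  ∀ (W : Finset V) (s : Multiset (Sym2 V)) (t p q : V → ℤ), W.card < n →
    (CutRegular m W s t p q → Solvable m W s t) ∧
      ∀ e, CutRegularExcept m W s t p q e → Solvable m W s t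

variable {m : ℕ} {W A : Finset V} {s s' : Multiset (Sym2 V)} {t p q t' p' q' : V → ℤ}

lemma IsPiece.sum_eq (h : IsPiece m A s t p q s' t' p' q') :
    ∑ v ∈ A, p' v + ∑ v ∈ A, q' v = boundary s p q A := by
  rw [← h.boundary_eq A Finset.Subset.rfl, boundary, mcut_eq_zero h.endsIn, zero_add]

lemma IsPiece.dvd_sum_excess (h : IsPiece m A s t p q s' t' p' q') :
    (2 * m : ℤ) ∣ ∑ v ∈ A, excess s t p q v - (∑ v ∈ A, q' v - ∑ v ∈ A, p' v) := by
  obtain ⟨c, hc⟩ := h.dvd_sum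
  refine ⟨c, ?_⟩
  simp only [← h.excess_eq]
  rw [sum_excess, sum_mdeg h.endsIn]
  linear_combination 2 * hc

lemma IsPiece.cutCond (h : IsPiece m A s t p q s' t' p' q') {B : Finset V} (hB : B ⊆ A)
    (hcut : CutCond m s t p q B) : CutCond m s' t' p' q' B := by
  unfold CutCond at *
  simpa only [h.excess_eq, h.boundary_eq B hB]

lemma IsPiece.balancedBoundary (hm : 2 ≤ m) (h : IsPiece m A s t p q s' t' p' q')
    (hW : BalancedBoundary m W s t p q)
    (hle : boundary s p q A ≤ 8 * m - 7 + circNorm m (∑ v ∈ A, excess s t p q v)) :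
    BalancedBoundary m A s' t' p' q' := by
  have hp : ∀ v, 0 ≤ p' v := fun v => (hW.nonneg_left v).trans (h.left_le v)
  have hq : ∀ v, 0 ≤ q' v := fun v => (hW.nonneg_right v).trans (h.right_le v)
  refine ⟨h.endsIn, hp, hq, h.dvd_sum, admissibleBoundary_of_le hm
    (Finset.sum_nonneg fun v _ => hp v) (Finset.sum_nonneg fun v _ => hq v) ?_⟩
  rw [h.sum_eq]
  rw [circNorm_congr (by omega) h.dvd_sum_excess, ← circNorm_neg (by omega), neg_sub] at hle
  exact hle

theorem CutRegular.solvable_of_boundary_le (hm : 2 ≤ m) (hIH : SolvableBelow V m W.card)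
    (h : CutRegular m W s t p q) (hA : A ⊆ W) (hcard : 2 ≤ A.card) (hne : A ≠ W)
    (hle : boundary s p q A ≤ 8 * m - 7 + circNorm m (∑ v ∈ A, excess s t p q v)) :
    Solvable m W s t := by
  obtain ⟨a, ha⟩ := Finset.card_pos.1 (by omega : 0 < A.card)
  have hlt := Finset.card_lt_card (hA.ssubset_of_ne hne)
  refine Solvable.of_shrink p q hA ha h.endsIn ?_ fun s' t' p' q' hs' => ?_
  · exact (hIH _ _ _ _ _ (card_image_shrink_lt hA hcard a)).1
      (h.toBalancedBoundary.cutRegular_shrink hA a fun B hB hB1 hB2 _ => h.cut B hB hB1 hB2)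
  · refine (hIH A s' t' p' q' hlt).1 ⟨hs'.balancedBoundary hm h.toBalancedBoundary hle, ?_⟩
    intro B hB hB1 hB2
    exact hs'.cutCond hB (h.cut B (hB.trans hA) hB1
      fun hBW => hB2 (Finset.Subset.antisymm hB (hBW ▸ hA)))

lemma boundary_singleton (e : V) : boundary s p q {e} = mcut s {e} + p e + q e := by
  simp [boundary]

/-- Contracting a set which contains the exceptional vertex gives a graph without exceptional
vertices. -/
lemma CutRegularExcept.cutRegular_image_shrink {e : V} (h : CutRegularExcept m W s t p q e)
    (hA : A ⊆ W) (hcard : 2 ≤ A.card) (he : e ∈ A) (a : V) :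
    CutRegular m (W.image (shrink A a)) (s.map (Sym2.map (shrink A a)))
      (push W (shrink A a) t) (push W (shrink A a) p) (push W (shrink A a) q) := by
  have hA1 : ¬ A ⊆ {e} := fun h' => by
    have := Finset.card_le_card h'
    rw [Finset.card_singleton] at this; omega
  refine h.toBalancedBoundary.cutRegular_shrink hA a
    fun B hB hB1 hB2 hsep => h.cut B hB hB1 hB2 ?_ ?_
  · rintro rfl
    rcases hsep with hsep | hsep
    · exact hA1 hsep
    · exact Finset.disjoint_left.1 hsep he (Finset.mem_singleton_self e)
  · rintro rfl
    rcases hsep with hsep | hsep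
    · exact Finset.notMem_erase _ _ (hsep he)
    · refine hA1 fun x hx => ?_
      by_contra hxe
      exact Finset.disjoint_left.1 hsep hx (Finset.mem_erase.2 ⟨by simpa using hxe, hA hx⟩)

theorem CutRegularExcept.solvable_of_boundary_le {e : V} (hm : 2 ≤ m)
    (hIH : SolvableBelow V m W.card)
    (h : CutRegularExcept m W s t p q e) (hA : A ⊆ W) (hcard : 2 ≤ A.card) (hne : A ≠ W)
    (hne' : A ≠ W.erase e)
    (hle : boundary s p q A ≤ 6 * m - 5 + circNorm m (∑ v ∈ A, excess s t p q v)) :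
    Solvable m W s t := by
  obtain ⟨a, ha⟩ := Finset.card_pos.1 (by omega : 0 < A.card)
  have hlt := Finset.card_lt_card (hA.ssubset_of_ne hne)
  have hle' : boundary s p q A ≤ 8 * m - 7 + circNorm m (∑ v ∈ A, excess s t p q v) := by omega
  by_cases he : e ∈ A
  · refine Solvable.of_shrink p q hA ha h.endsIn ?_ fun s' t' p' q' hs' => ?_
    · exact (hIH _ _ _ _ _ (card_image_shrink_lt hA hcard a)).1
        (h.cutRegular_image_shrink hA hcard he a)
    · have hbb := hs'.balancedBoundary hm h.toBalancedBoundary hle'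
      have hcut : ∀ B ⊆ A, B.Nonempty → B ≠ A → B ≠ {e} → CutCond m s t p q B :=
        fun B hB hB1 hB2 hB3 => h.cut B (hB.trans hA) hB1
          (fun hBW => hB2 (Finset.Subset.antisymm hB (hBW ▸ hA))) hB3 (by
            rintro rfl
            refine hne ?_
            refine Finset.Subset.antisymm hA fun x hx => ?_
            by_cases hxe : x = e
            · rwa [hxe]
            · exact hB (Finset.mem_erase.2 ⟨hxe, hx⟩))
      have hne1 : (A.erase e).Nonempty := by
        rw [← Finset.card_pos, Finset.card_erase_of_mem he]; omega
      have hcut1 := hcut (A.erase e) (Finset.erase_subset _ _) hne1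
        (fun h' => Finset.notMem_erase e A (by rw [h']; exact he))
        (fun h' => Finset.notMem_erase e A (by rw [h']; simp))
      have hsum : ∀ f : V → ℤ, ∑ v ∈ A.erase e, f v = ∑ v ∈ A, f v - f e := fun f => by
        rw [← Finset.add_sum_erase A f he]; ring
      have hb1 := hs'.boundary_eq (A.erase e) (Finset.erase_subset _ _)
      have hb2 := hs'.boundary_eq {e} (by simpa using he)
      have hb3 := hs'.sum_eq
      have hmc : mcut s' (A.erase e) = mcut s' {e} := by
        rw [← mcut_sdiff hs'.endsIn {e}, Finset.sdiff_singleton_eq_erase]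
      rw [boundary, hmc, hsum, hsum] at hb1
      unfold CutCond at hcut1
      rw [hsum, circNorm_congr (by omega) (y := ∑ v ∈ A, excess s t p q v)
        (by rw [sub_sub_cancel_left]; exact h.dvd_excess.neg_right)] at hcut1
      obtain ⟨j, hj⟩ := exists_boundary_eq s t p q {e}
      obtain ⟨c, hc⟩ := h.dvd_excess
      rw [Finset.sum_singleton, hc] at hj
      have hj' : boundary s p q {e} = 2 * (m * c + j) := by rw [hj]; ring
      rw [← hb2, boundary_singleton] at hj'
      have h0 := hbb.nonneg_left e
      have h0' := hbb.nonneg_right e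
      refine (hIH A s' t' p' q' hlt).2 e ⟨hbb, he, ?_, ?_, by omega, by omega⟩
      · intro B hB hB1 hB2 hB3 _
        exact hs'.cutCond hB (hcut B hB hB1 hB2 hB3)
      · rw [hs'.excess_eq]; exact h.dvd_excess
  · refine Solvable.of_shrink p q hA ha h.endsIn ?_ fun s' t' p' q' hs' => ?_
    · exact (hIH _ _ _ _ _ (card_image_shrink_lt hA hcard a)).2 e (h.image_shrink ha he)
    · refine (hIH A s' t' p' q' hlt).1 ⟨hs'.balancedBoundary hm h.toBalancedBoundary hle', ?_⟩
      intro B hB hB1 hB2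
      refine hs'.cutCond hB (h.cut B (hB.trans hA) hB1 (fun hBW => he ?_) (fun hBe => he ?_)
        fun hBe => hne' ?_)
      · exact hB (hBW ▸ h.mem)
      · exact hB (by simp [hBe])
      · refine Finset.Subset.antisymm (fun x hx => Finset.mem_erase.2 ⟨?_, hA hx⟩) (hBe ▸ hB)
        rintro rfl; exact he hx

end Contraction

section ExceptionalVertex

variable {V : Type*}

lemma exists_unoriented_eq (s : Multiset (Sym2 V)) : ∃ O, unoriented O = s := by
  induction s using Multiset.induction_on with
  | empty => exact ⟨0, rfl⟩
  | cons e s ih =>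
    obtain ⟨O, rfl⟩ := ih
    induction e using Sym2.ind with
    | _ x y => exact ⟨(x, y) ::ₘ O, unoriented_cons _ _⟩

lemma fst_mem_of_mem {O : Multiset (V × V)} {W : Finset V} (h : EndsIn (unoriented O) W)
    {a : V × V} (ha : a ∈ O) : a.1 ∈ W := (h a.1 a.2 (Multiset.mem_map_of_mem _ ha)).1

variable [DecidableEq V] {m : ℕ} {W A : Finset V} {s : Multiset (Sym2 V)} {t p q : V → ℤ}

lemma solvable_of_card_le_one (hs : EndsIn s W) (hW : W.card ≤ 1)
    (hd : (m : ℤ) ∣ ∑ v ∈ W, t v - s.card) : Solvable m W s t := by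
  obtain ⟨O, rfl⟩ := exists_unoriented_eq s
  refine ⟨O, rfl, fun v hv => ?_⟩
  have hWv : W = {v} := by
    refine Finset.eq_singleton_iff_unique_mem.2 ⟨hv, fun x hx => ?_⟩
    exact Finset.card_le_one.1 hW x hx v hv
  have := sum_tails (O := O) (W := W) fun a ha => fst_mem_of_mem hs ha
  rw [hWv, Finset.sum_singleton] at this hd
  rw [this]
  simpa [unoriented] using hd

lemma mdeg_eq_count_add_mcut (s : Multiset (Sym2 V)) (e : V) :
    mdeg s e = 2 * s.count s(e, e) + mcut s {e} := by
  induction s using Multiset.induction_on with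
  | empty => simp
  | cons f s ih =>
    induction f using Sym2.ind with
    | _ x y =>
      rw [mdeg_cons, mcut_cons, ih, Multiset.count_cons]
      by_cases hx : x = e <;> by_cases hy : y = e <;> simp [hx, hy, eq_comm (a := e)] <;> ring

lemma mcut_singleton_eq_count {e y : V} (hne : e ≠ y)
    (h : ∀ z, s(e, z) ∈ s → z = e ∨ z = y) : mcut s {e} = s.count s(e, y) := by
  induction s using Multiset.induction_on with
  | empty => simp
  | cons f s ih =>
    have ih' := ih fun z hz => h z (Multiset.mem_cons_of_mem hz)
    induction f using Sym2.ind with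
    | _ u v =>
      rw [mcut_cons, ih', Multiset.count_cons]
      by_cases hu : u = e
      · subst hu
        rcases h v (Multiset.mem_cons_self _ _) with rfl | rfl
        · simp [hne.symm]
        · simp [hne.symm]; ring
      · by_cases hv : v = e
        · subst hv
          rcases h u (by rw [Sym2.eq_swap]; exact Multiset.mem_cons_self _ _) with rfl | rfl
          · exact absurd rfl hu
          · simp [hu]; ring
        · simp [hu, hv, Ne.symm hu, Ne.symm hv]

lemma exists_orientation_pair {x y : V} (hxy : x ≠ y) (hs : EndsIn s {x, y}) {k : ℤ}
    (hk : s.count s(x, x) ≤ k) (hk' : k ≤ s.count s(x, x) + s.count s(x, y)) :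
    ∃ O, unoriented O = s ∧ tails O x = k := by
  induction s using Multiset.induction_on generalizing k with
  | empty => exact ⟨0, rfl, by simp at hk hk'; simp; omega⟩
  | cons f s ih =>
    induction f using Sym2.ind with
    | _ u v =>
      have huv := hs u v (Multiset.mem_cons_self _ _)
      simp only [Finset.mem_insert, Finset.mem_singleton] at huv
      rw [Multiset.count_cons] at hk
      rw [Multiset.count_cons, Multiset.count_cons] at hk'
      have hxy' := hxy.symm
      have hs' := hs.of_cons
      rcases huv with ⟨hu | hu, hv | hv⟩ <;> rw [hu, hv] at hk hk' ⊢
      · simp [hxy'] at hk hk'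
        obtain ⟨O, rfl, hO⟩ := ih hs' (k := k - 1) (by omega) (by omega)
        exact ⟨(x, x) ::ₘ O, by simp, by simp [hO]⟩
      · simp [hxy] at hk hk'
        by_cases hlt : k ≤ s.count s(x, x) + s.count s(x, y)
        · obtain ⟨O, rfl, hO⟩ := ih hs' (k := k) (by omega) (by omega)
          exact ⟨(y, x) ::ₘ O, by simp [Sym2.eq_swap], by simp [hO, hxy']⟩
        · obtain ⟨O, rfl, hO⟩ := ih hs' (k := k - 1) (by omega) (by omega)
          exact ⟨(x, y) ::ₘ O, by simp, by simp [hO]⟩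
      · rw [Sym2.eq_swap] at hk hk' ⊢
        simp [hxy, hxy'] at hk hk'
        by_cases hlt : k ≤ s.count s(x, x) + s.count s(x, y)
        · obtain ⟨O, rfl, hO⟩ := ih hs' (k := k) (by omega) (by omega)
          exact ⟨(y, x) ::ₘ O, by simp [Sym2.eq_swap], by simp [hO, hxy']⟩
        · obtain ⟨O, rfl, hO⟩ := ih hs' (k := k - 1) (by omega) (by omega)
          exact ⟨(x, y) ::ₘ O, by simp, by simp [hO]⟩
      · simp [hxy] at hk hk'
        obtain ⟨O, rfl, hO⟩ := ih hs' (k := k) (by omega) (by omega)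
        exact ⟨(y, y) ::ₘ O, by simp, by simp [hO, hxy']⟩

lemma solvable_pair {x y : V} (hxy : x ≠ y) (hs : EndsIn s {x, y})
    (hd : (m : ℤ) ∣ ∑ v ∈ {x, y}, t v - s.card) {k : ℤ}
    (hk : s.count s(x, x) ≤ k) (hk' : k ≤ s.count s(x, x) + s.count s(x, y))
    (hkt : (m : ℤ) ∣ t x - k) : Solvable m {x, y} s t := by
  obtain ⟨O, rfl, hO⟩ := exists_orientation_pair hxy hs hk hk'
  have hsum := sum_tails (O := O) (W := {x, y}) fun a ha => fst_mem_of_mem hs ha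
  rw [Finset.sum_pair hxy] at hsum hd
  refine ⟨O, rfl, fun v hv => ?_⟩
  rcases Finset.mem_insert.1 hv with rfl | hv
  · rwa [hO]
  · rw [Finset.mem_singleton.1 hv]
    have : (unoriented O).card = O.card := Multiset.card_map _ _
    rw [this, ← hsum, hO] at hd
    have h := dvd_sub hd hkt
    rwa [show t x + t y - (k + tails O y) - (t x - k) = t y - tails O y by ring] at h

lemma CutRegularExcept.solvable_of_one_neighbour {e y : V} (hIH : SolvableBelow V m W.card)
    (h : CutRegularExcept m W s t p q e) (hy : y ∈ W) (hne : e ≠ y)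
    (hnb : ∀ z, s(e, z) ∈ s → z = e ∨ z = y) : Solvable m W s t := by
  have hA : {e, y} ⊆ W := by
    intro v hv
    rcases Finset.mem_insert.1 hv with rfl | hv
    · exact h.mem
    · rwa [Finset.mem_singleton.1 hv]
  have hcard : ({e, y} : Finset V).card = 2 := Finset.card_pair hne
  have he : e ∈ ({e, y} : Finset V) := by simp
  refine Solvable.of_shrink p q hA he h.endsIn ?_ fun s' t' p' q' hs' => ?_
  · exact (hIH _ _ _ _ _ (card_image_shrink_lt hA hcard.ge e)).1
      (h.cutRegular_image_shrink hA hcard.ge he e)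
  · have h1 := mcut_singleton_eq_count hne hnb
    have h2 := mcut_singleton_eq_count (s := s') hne fun z hz => by
      simpa using (hs'.endsIn _ _ hz).2
    have h3 := hs'.count_eq e he y (by simp)
    have h4 := hs'.boundary_eq {e} (by simp)
    rw [boundary_singleton, boundary_singleton] at h4
    have h5 : p e ≤ p' e := hs'.left_le e
    have h6 : q e ≤ q' e := hs'.right_le e
    have h7 := h.left_le
    have h8 := h.right_le
    obtain ⟨c, hc⟩ := h.dvd_excess
    rw [← hs'.excess_eq, excess, mdeg_eq_count_add_mcut] at hc
    have hc' : 2 * (t' e - m * c) =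
      2 * (s'.count s(e, e) : ℤ) + mcut s' {e} - q' e + p' e := by linear_combination hc
    exact solvable_pair hne hs'.endsIn hs'.dvd_sum (k := t' e - m * c)
      (by omega) (by omega) ⟨c, by ring⟩

/-- The conditions are preserved by operations which change the boundary of singletons other than
`{e}` not at all and the boundary of other sets by at most two. -/
lemma CutRegularExcept.of_modification {e : V} (h : CutRegularExcept m W s t p q e)
    (hcut : ∀ A ⊆ W, 2 ≤ A.card → A ≠ W → A ≠ W.erase e →
      6 * m - 5 + circNorm m (∑ v ∈ A, excess s t p q v) < boundary s p q A)
    {s' : Multiset (Sym2 V)} {t' p' q' : V → ℤ} (h' : BalancedBoundary m W s' t' p' q')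
    (hex : ∀ v, excess s' t' p' q' v = excess s t p q v)
    (hb : ∀ A, boundary s p q A ≤ boundary s' p' q' A + 2)
    (hb' : ∀ v, v ≠ e → boundary s p q {v} ≤ boundary s' p' q' {v})
    (hl : p' e ≤ mcut s' {e} + q' e) (hr : q' e ≤ mcut s' {e} + p' e) :
    CutRegularExcept m W s' t' p' q' e where
  toBalancedBoundary := h'
  mem := h.mem
  cut A hA hne hAW hAe hAe' := by
    have h1 := h.cut A hA hne hAW hAe hAe'
    unfold CutCond at *
    simp only [hex]
    by_cases hcard : 2 ≤ A.card
    · have := hcut A hA hcard hAW hAe'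
      have := hb A
      omega
    · obtain ⟨v, rfl⟩ := Finset.card_eq_one.1
        (by have := Finset.card_pos.2 hne; omega : A.card = 1)
      exact h1.trans (hb' v fun hv => hAe (by rw [hv]))
  dvd_excess := by rw [hex]; exact h.dvd_excess
  left_le := hl
  right_le := hr

end ExceptionalVertex

section Splitting

variable {V : Type*} [DecidableEq V] {m : ℕ} {W A : Finset V} {s : Multiset (Sym2 V)}
  {t p q : V → ℤ}

/-- The function obtained from `f` by adding `c` to the value at `v`. -/
def bump (f : V → ℤ) (v : V) (c : ℤ) (u : V) : ℤ := f u + if v = u then c else 0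

lemma sum_bump (f : V → ℤ) (v : V) (c : ℤ) (A : Finset V) :
    ∑ u ∈ A, bump f v c u = ∑ u ∈ A, f u + if v ∈ A then c else 0 := by
  simp [bump, Finset.sum_add_distrib]

lemma Solvable.of_delete {x y : V} (h : Solvable m W s (bump t x (-1))) :
    Solvable m W (s(x, y) ::ₘ s) t := by
  obtain ⟨O, rfl, hO⟩ := h
  refine ⟨(x, y) ::ₘ O, by simp, fun v hv => ?_⟩
  have := hO v hv
  rw [bump] at this
  rw [tails_cons]
  convert this using 1
  dsimp only
  split_ifs <;> ring

lemma Solvable.of_split {e y z : V} (hy : y ≠ e) (hz : z ≠ e)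
    (h : Solvable m W (s(y, z) ::ₘ s) (bump t e (-1))) :
    Solvable m W (s(e, y) ::ₘ s(e, z) ::ₘ s) t := by
  obtain ⟨O, hs, hO⟩ := h
  obtain ⟨⟨a, b⟩, ha, ha'⟩ := Multiset.mem_map.1 (hs ▸ Multiset.mem_cons_self _ _ :
    s(y, z) ∈ unoriented O)
  obtain ⟨O, rfl⟩ := Multiset.exists_cons_of_mem ha
  rw [unoriented_cons, ha', Multiset.cons_inj_right] at hs
  subst hs
  rcases Sym2.eq_iff.1 ha' with ⟨h1, h2⟩ | ⟨h1, h2⟩ <;> dsimp only at h1 h2 <;> subst h1 h2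
  · refine ⟨(a, e) ::ₘ (e, b) ::ₘ O, by simp [Sym2.eq_swap], fun v hv => ?_⟩
    have := hO v hv
    rw [bump] at this
    simp only [tails_cons] at this ⊢
    convert this using 1
    split_ifs <;> ring
  · refine ⟨(a, e) ::ₘ (e, b) ::ₘ O, ?_, fun v hv => ?_⟩
    · simp only [unoriented_cons]
      rw [Multiset.cons_swap, Sym2.eq_swap (a := a)]
    have := hO v hv
    rw [bump] at this
    simp only [tails_cons] at this ⊢
    convert this using 1
    split_ifs <;> ring

theorem CutRegularExcept.solvable {e : V} (hm : 2 ≤ m) (hIH : SolvableBelow V m W.card)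
    (h : CutRegularExcept m W s t p q e) : Solvable m W s t := by
  induction hn : s.card using Nat.strong_induction_on generalizing s t p q with
  | _ n ih =>
  subst hn
  by_cases hcut : ∃ A ⊆ W, 2 ≤ A.card ∧ A ≠ W ∧ A ≠ W.erase e ∧
      boundary s p q A ≤ 6 * m - 5 + circNorm m (∑ v ∈ A, excess s t p q v)
  · obtain ⟨A, hA, h1, h2, h3, h4⟩ := hcut
    exact h.solvable_of_boundary_le hm hIH hA h1 h2 h3 h4
  push Not at hcut
  by_cases hW : W.card ≤ 1
  · exact solvable_of_card_le_one h.endsIn hW h.dvd_sum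
  obtain ⟨y₀, hy₀, hy₀e⟩ := Finset.exists_mem_ne (by omega : 1 < W.card) e
  by_cases hone : ∃ y ∈ W, e ≠ y ∧ ∀ z, s(e, z) ∈ s → z = e ∨ z = y
  · obtain ⟨y, hy, hne, hnb⟩ := hone
    exact h.solvable_of_one_neighbour hIH hy hne hnb
  push Not at hone
  obtain ⟨y, hys, hye, -⟩ := hone y₀ hy₀ hy₀e.symm
  have hyW := (h.endsIn _ _ hys).2
  obtain ⟨z, hzs, hze, hzy⟩ := hone y hyW hye.symm
  have hzW := (h.endsIn _ _ hzs).2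
  have hp := h.nonneg_left
  have hq := h.nonneg_right
  have hpe := hp e
  have hqe := hq e
  have hl := h.left_le
  have hr := h.right_le
  have hd := h.dvd_sum
  obtain ⟨s, rfl⟩ := Multiset.exists_cons_of_mem hys
  have hz' : s(e, z) ∈ s := by
    refine (Multiset.mem_cons.1 hzs).resolve_left fun h => hzy ?_
    rcases Sym2.eq_iff.1 h with ⟨-, h⟩ | ⟨-, h⟩
    · exact h
    · exact absurd h hze
  have hme := mcut_nonneg s {e}
  by_cases hpe' : p e = mcut (s(e, y) ::ₘ s) {e} + q e
  · refine Solvable.of_delete (ih s.card (by simp) (t := bump t e (-1))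
      (p := bump (bump p e (-1)) y 1) (q := q) (h.of_modification hcut
      ⟨h.endsIn.of_cons, ?_, hq, ?_, ?_⟩ ?_ ?_ ?_ ?_ ?_) rfl)
    · intro v
      have := hp v
      simp only [mcut_cons, crossing_mk, bump] at hpe' ⊢
      by_cases hv : e = v
      · subst hv; simp [hye] at hpe' ⊢; omega
      · simp only [if_neg hv]; split_ifs <;> omega
    · rw [sum_bump, if_pos h.mem]
      rw [Multiset.card_cons] at hd
      convert hd using 1; push_cast; ring
    · rw [sum_bump, sum_bump, if_pos h.mem, if_pos hyW, neg_add_cancel_right]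
      exact h.admissible
    · intro v
      simp only [excess, mdeg_cons, incid_mk, bump]
      split_ifs <;> ring
    · intro A
      simp only [boundary, mcut_cons, crossing_mk, sum_bump]
      by_cases h1 : e ∈ A <;> by_cases h2 : y ∈ A <;> simp [h1, h2] <;> omega
    · intro v hv
      simp only [boundary, mcut_cons, crossing_mk, sum_bump, Finset.mem_singleton]
      by_cases h2 : y = v <;> simp [hv.symm, h2]
      omega
    · simp [bump, hye] at hpe' ⊢; omega
    · simp [bump, hye] at hpe' ⊢; omega
  by_cases hqe' : q e = mcut (s(e, y) ::ₘ s) {e} + p e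
  · rw [Sym2.eq_swap]
    refine Solvable.of_delete (ih s.card (by simp) (t := bump t y (-1))
      (p := p) (q := bump (bump q e (-1)) y 1) (h.of_modification hcut
      ⟨h.endsIn.of_cons, hp, ?_, ?_, ?_⟩ ?_ ?_ ?_ ?_ ?_) rfl)
    · intro v
      have := hq v
      simp only [mcut_cons, crossing_mk, bump] at hqe' ⊢
      by_cases hv : e = v
      · subst hv; simp [hye] at hqe' ⊢; omega
      · simp only [if_neg hv]; split_ifs <;> omega
    · rw [sum_bump, if_pos hyW]
      rw [Multiset.card_cons] at hd
      convert hd using 1; push_cast; ring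
    · rw [sum_bump, sum_bump, if_pos h.mem, if_pos hyW, neg_add_cancel_right]
      exact h.admissible
    · intro v
      simp only [excess, mdeg_cons, incid_mk, bump]
      split_ifs <;> ring
    · intro A
      simp only [boundary, mcut_cons, crossing_mk, sum_bump]
      by_cases h1 : e ∈ A <;> by_cases h2 : y ∈ A <;> simp [h1, h2] <;> omega
    · intro v hv
      simp only [boundary, mcut_cons, crossing_mk, sum_bump, Finset.mem_singleton]
      by_cases h2 : y = v <;> simp [hv.symm, h2]
      omega
    · simp [bump, hye] at hqe' ⊢; omega
    · simp [bump, hye] at hqe' ⊢; omega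
  obtain ⟨s, rfl⟩ := Multiset.exists_cons_of_mem hz'
  obtain ⟨c, hc⟩ := h.dvd_excess
  rw [excess, mdeg_eq_count_add_mcut] at hc
  have hc' : 2 * (t e - Multiset.count s(e, e) (s(e, y) ::ₘ s(e, z) ::ₘ s) - m * c) =
    mcut (s(e, y) ::ₘ s(e, z) ::ₘ s) {e} + p e - q e := by linear_combination hc
  refine Solvable.of_split hye hze (ih (s(y, z) ::ₘ s).card (by simp) (t := bump t e (-1))
      (p := p) (q := q) (h.of_modification hcut
      ⟨h.endsIn.of_cons.of_cons.cons hyW hzW, hp, hq, ?_, h.admissible⟩ ?_ ?_ ?_ ?_ ?_) rfl)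
  · rw [sum_bump, if_pos h.mem]
    rw [Multiset.card_cons, Multiset.card_cons] at hd
    rw [Multiset.card_cons]
    convert hd using 1; push_cast; ring
  · intro v
    simp only [excess, mdeg_cons, incid_mk, bump]
    split_ifs <;> ring
  · intro A
    simp only [boundary, mcut_cons, crossing_mk]
    by_cases h1 : e ∈ A <;> by_cases h2 : y ∈ A <;> by_cases h3 : z ∈ A <;>
      simp [h1, h2, h3] <;> omega
  · intro v hv
    simp only [boundary, mcut_cons, crossing_mk, Finset.mem_singleton]
    by_cases h2 : y = v <;> by_cases h3 : z = v
    · exact absurd (h3.trans h2.symm) hzy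
    all_goals simp [hv.symm, h2, h3]
  · generalize Multiset.count s(e, e) (s(e, y) ::ₘ s(e, z) ::ₘ s) = r at hc'
    simp [hye, hze] at hpe' hqe' hc' hl hr ⊢; omega
  · generalize Multiset.count s(e, e) (s(e, y) ::ₘ s(e, z) ::ₘ s) = r at hc'
    simp [hye, hze] at hpe' hqe' hc' hl hr ⊢; omega

end Splitting

section RegularStep

variable {V : Type*} [DecidableEq V] {m : ℕ} {W A : Finset V} {s : Multiset (Sym2 V)}
  {t p q : V → ℤ}

lemma CutRegular.solvable_of_le_count (hm : 2 ≤ m) (hIH : SolvableBelow V m W.card)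
    (h : CutRegular m W s t p q) {x y : V} (hx : x ∈ W) (hy : y ∈ W) (hxy : x ≠ y)
    (hle : m - 1 ≤ s.count s(x, y)) : Solvable m W s t := by
  have hA : {x, y} ⊆ W := by
    intro v hv
    rcases Finset.mem_insert.1 hv with rfl | hv
    · exact hx
    · rwa [Finset.mem_singleton.1 hv]
  have hcard : ({x, y} : Finset V).card = 2 := Finset.card_pair hxy
  have hxA : x ∈ ({x, y} : Finset V) := by simp
  refine Solvable.of_shrink p q hA hxA h.endsIn ?_ fun s' t' p' q' hs' => ?_
  · exact (hIH _ _ _ _ _ (card_image_shrink_lt hA hcard.ge x)).1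
      (h.cutRegular_shrink hA x fun B hB hB1 hB2 _ => h.cut B hB hB1 hB2)
  · have h3 := hs'.count_eq x hxA y (by simp)
    set l : ℤ := ((s'.count s(x, x) : ℕ) : ℤ)
    have h4 := Int.emod_nonneg (t' x - l) (b := m) (by omega)
    have h5 := Int.emod_lt_of_pos (t' x - l) (b := m) (by omega)
    refine solvable_pair hxy hs'.endsIn hs'.dvd_sum (k := l + (t' x - l) % m)
      (by omega) (by omega) ?_
    rw [← sub_sub]
    exact Int.dvd_self_sub_emod

lemma exists_edge_of_mcut_pos (h : 0 < mcut s A) : ∃ x ∈ A, ∃ y ∉ A, s(x, y) ∈ s := by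
  induction s using Multiset.induction_on with
  | empty => simp at h
  | cons e s ih =>
    induction e using Sym2.ind with
    | _ u v =>
      by_cases hu : u ∈ A <;> by_cases hv : v ∈ A
      · obtain ⟨x, hx, y, hy, hxy⟩ := ih (by simpa [hu, hv] using h)
        exact ⟨x, hx, y, hy, Multiset.mem_cons_of_mem hxy⟩
      · exact ⟨u, hu, v, hv, Multiset.mem_cons_self _ _⟩
      · exact ⟨v, hv, u, hu, by rw [Sym2.eq_swap]; exact Multiset.mem_cons_self _ _⟩
      · obtain ⟨x, hx, y, hy, hxy⟩ := ih (by simpa [hu, hv] using h)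
        exact ⟨x, hx, y, hy, Multiset.mem_cons_of_mem hxy⟩

lemma sum_add_sum_sdiff {W A : Finset V} (hA : A ⊆ W) (f : V → ℤ) :
    ∑ v ∈ W \ A, f v = ∑ v ∈ W, f v - ∑ v ∈ A, f v := by
  rw [← Finset.sum_sdiff hA]; ring

lemma BalancedBoundary.boundary_sdiff (h : BalancedBoundary m W s t p q) (hA : A ⊆ W) :
    boundary s p q (W \ A) =
      2 * mcut s A + (∑ v ∈ W, p v + ∑ v ∈ W, q v) - boundary s p q A := by
  rw [boundary, boundary, mcut_sdiff h.endsIn, sum_add_sum_sdiff hA, sum_add_sum_sdiff hA]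
  ring

lemma BalancedBoundary.sum_le (hm : 0 < m) (h : BalancedBoundary m W s t p q) :
    ∑ v ∈ W, p v + ∑ v ∈ W, q v ≤
      10 * m - 10 + circNorm m (∑ v ∈ W, excess s t p q v) := by
  have h1 := h.admissible.1
  rw [circNorm_congr hm h.dvd_sum_excess, ← circNorm_neg hm, neg_sub]
  exact h1

/-- Every nonempty proper subset has at least `m - 1` leaving edges. -/
lemma CutRegular.le_mcut (hm : 0 < m) (h : CutRegular m W s t p q) (hA : A ⊆ W)
    (hne : A.Nonempty) (hne' : A ≠ W) : (m : ℤ) - 1 ≤ mcut s A := by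
  have h1 := h.cut A hA hne hne'
  have h2 := h.cut (W \ A) Finset.sdiff_subset
    (Finset.sdiff_nonempty.2 fun h' => hne' (Finset.Subset.antisymm hA h')) fun h' => by
      obtain ⟨v, hv⟩ := hne
      have := hA hv
      rw [← h', Finset.mem_sdiff] at this
      exact this.2 hv
  have h3 := h.boundary_sdiff hA
  have h4 := h.sum_le hm
  have h5 := circNorm_add_le hm (∑ v ∈ A, excess s t p q v) (∑ v ∈ W \ A, excess s t p q v)
  rw [sum_add_sum_sdiff hA, add_sub_cancel] at h5
  unfold CutCond at h1 h2
  rw [sum_add_sum_sdiff hA] at h2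
  omega

lemma CutRegular.solvable_of_card_eq_two (hm : 2 ≤ m) (hIH : SolvableBelow V m W.card)
    (h : CutRegular m W s t p q) (hW : W.card = 2) : Solvable m W s t := by
  obtain ⟨x, y, hxy, rfl⟩ := Finset.card_eq_two.1 hW
  have h1 := h.le_mcut (by omega) (A := {x}) (by simp) (by simp) (fun h' => by
    rw [← h'] at hW; simp at hW)
  rw [mcut_singleton_eq_count hxy fun z hz => by simpa using (h.endsIn _ _ hz).2] at h1
  exact h.solvable_of_le_count hm hIH (by simp) (by simp) hxy (by omega)

/-- All subsets with at least two vertices satisfy a stronger cut condition. -/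
def StrongCut (m : ℕ) (W : Finset V) (s : Multiset (Sym2 V)) (t p q : V → ℤ) : Prop :=
  ∀ A ⊆ W, 2 ≤ A.card → A ≠ W →
    8 * m - 7 + circNorm m (∑ v ∈ A, excess s t p q v) < boundary s p q A

lemma CutRegular.of_modification (hm : 2 ≤ m) (h : CutRegular m W s t p q)
    (hcut : StrongCut m W s t p q) {s' : Multiset (Sym2 V)} {t' p' q' : V → ℤ}
    (h' : BalancedBoundary m W s' t' p' q')
    (hb : ∀ A, boundary s p q A ≤ boundary s' p' q' A + 2)
    (hb' : ∀ v ∈ W, circNorm m (excess s' t' p' q' v) + boundary s p q {v} ≤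
      circNorm m (excess s t p q v) + boundary s' p' q' {v}) :
    CutRegular m W s' t' p' q' where
  toBalancedBoundary := h'
  cut A hA hne hAW := by
    unfold CutCond
    by_cases hcard : 2 ≤ A.card
    · have h1 := hcut A hA hcard hAW
      have h2 := hb A
      have h3 := circNorm_le_half (by omega : 0 < m) (∑ v ∈ A, excess s' t' p' q' v)
      have h4 := circNorm_nonneg m (∑ v ∈ A, excess s t p q v)
      omega
    · obtain ⟨v, rfl⟩ := Finset.card_eq_one.1
        (by have := Finset.card_pos.2 hne; omega : A.card = 1)
      have h1 := h.cut {v} hA hne hAW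
      unfold CutCond at h1
      have h2 := hb' v (hA (Finset.mem_singleton_self v))
      rw [Finset.sum_singleton] at h1 ⊢
      omega

/-- Changing the excess of a vertex `x` to a multiple of `2 * m`, at the cost of `k` boundary
edges, makes `x` an exceptional vertex. -/
lemma CutRegular.cutRegularExcept (hm : 2 ≤ m) (h : CutRegular m W s t p q)
    (hcut : StrongCut m W s t p q) {x : V} (hx : x ∈ W) {k δ : ℤ} (hk : k ≤ 2 * m)
    (hδ : (2 * m : ℤ) ∣ δ - k)
    {s' : Multiset (Sym2 V)} {t' p' q' : V → ℤ} (h' : BalancedBoundary m W s' t' p' q')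
    (hex : ∀ v, excess s' t' p' q' v = bump (excess s t p q) x δ v)
    (hb : ∀ A, x ∉ A → boundary s p q A ≤ boundary s' p' q' A)
    (hb' : ∀ A, x ∈ A → boundary s p q A ≤ boundary s' p' q' A + k)
    (hdvd : (2 * m : ℤ) ∣ excess s t p q x + δ)
    (hl : p' x ≤ mcut s' {x} + q' x) (hr : q' x ≤ mcut s' {x} + p' x) :
    CutRegularExcept m W s' t' p' q' x where
  toBalancedBoundary := h'
  mem := hx
  cut A hA hne hAW hAx _ := by
    unfold CutCond
    simp only [hex, sum_bump]
    by_cases hxA : x ∈ A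
    · have hcard : 2 ≤ A.card := by
        by_contra hlt
        obtain ⟨v, rfl⟩ := Finset.card_eq_one.1
          (by have := Finset.card_pos.2 hne; omega : A.card = 1)
        exact hAx (by rw [Finset.mem_singleton.1 hxA])
      have h1 := hcut A hA hcard hAW
      have h2 := hb' A hxA
      have h3 := circNorm_add_abs_le (by omega : 0 < m) (∑ v ∈ A, excess s t p q v) (k - 2 * m)
      rw [abs_of_nonpos (by omega)] at h3
      rw [if_pos hxA, circNorm_congr (by omega)
        (y := ∑ v ∈ A, excess s t p q v + (k - 2 * m))
        (by rw [add_sub_add_left_eq_sub, ← sub_add]; exact dvd_add hδ dvd_rfl)]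
      omega
    · have h1 := h.cut A hA hne hAW
      unfold CutCond at h1
      rw [if_neg hxA, add_zero]
      exact h1.trans (hb A hxA)
  dvd_excess := by rw [hex, bump, if_pos rfl]; exact hdvd
  left_le := hl
  right_le := hr

lemma StrongCut.mcut_sub_le (h : CutRegular m W s t p q)
    (hcut : StrongCut m W s t p q) (hW : 3 ≤ W.card) {x : V} (hx : x ∈ W) :
    8 * m - 6 + circNorm m (∑ v ∈ W, excess s t p q v - excess s t p q x) ≤
      mcut s {x} - p x - q x + (∑ v ∈ W, p v + ∑ v ∈ W, q v) := by
  have hxW : {x} ⊆ W := by simpa using hx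
  have h1 := hcut (W \ {x}) Finset.sdiff_subset
    (by rw [Finset.card_sdiff_of_subset hxW, Finset.card_singleton]; omega)
    (fun h' => by rw [← h'] at hx; simp at hx)
  rw [h.boundary_sdiff hxW, sum_add_sum_sdiff hxW, boundary_singleton,
    Finset.sum_singleton] at h1
  omega

/-- A regular graph with a vertex of excess divisible by `2 * m` can be oriented. -/
theorem CutRegular.solvable_of_dvd_excess (hm : 2 ≤ m) (hIH : SolvableBelow V m W.card)
    (h : CutRegular m W s t p q) (hcut : StrongCut m W s t p q) (hW : 3 ≤ W.card) {x : V}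
    (hx : x ∈ W) (hdvd : (2 * m : ℤ) ∣ excess s t p q x) : Solvable m W s t := by
  have hm0 : 0 < m := by omega
  have h1 := hcut.mcut_sub_le h hW hx
  have h2 := h.sum_le hm0
  rw [circNorm_congr hm0 (y := ∑ v ∈ W, excess s t p q v)
    (by rw [sub_sub_cancel_left]; exact hdvd.neg_right)] at h1
  have h3 := h.cut {x} (by simpa using hx) (by simp) (fun h' => by rw [← h'] at hW; simp at hW)
  unfold CutCond at h3
  rw [boundary_singleton] at h3
  have h4 := circNorm_nonneg m (∑ v ∈ {x}, excess s t p q v)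
  have hp := h.nonneg_left
  have hq := h.nonneg_right
  have hpx := hp x
  have hqx := hq x
  by_cases hl : p x ≤ mcut s {x} + q x
  · by_cases hr : q x ≤ mcut s {x} + p x
    · refine CutRegularExcept.solvable hm hIH (h.cutRegularExcept hm hcut hx (k := 0) (δ := 0)
        (by omega) (by simp) h.toBalancedBoundary ?_ ?_ ?_ (by simpa using hdvd) hl hr)
      · intro v; simp [bump]
      · intro A _; rfl
      · intro A _; simp
    · refine CutRegularExcept.solvable hm hIH (h.cutRegularExcept hm hcut hx (k := 2 * m)
        (δ := - (2 * m)) (q' := bump q x (-(2 * m))) (p' := p) le_rfl ⟨-2, by ring⟩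
        ⟨h.endsIn, hp, ?_, h.dvd_sum, ?_⟩ ?_ ?_ ?_
        (dvd_add hdvd (dvd_neg.2 dvd_rfl)) ?_ ?_)
      · intro v
        have := hq v
        unfold bump
        split_ifs with hv
        · subst hv; omega
        · omega
      · rw [sum_bump, if_pos hx]
        exact h.admissible.sub_right hm0 (by omega)
      · intro v
        simp only [excess, bump]
        split_ifs <;> ring
      · intro A hA
        simp only [boundary, sum_bump, if_neg hA, add_zero, le_refl]
      · intro A hA
        simp only [boundary, sum_bump, if_pos hA]; omega
      · simp only [bump, if_true]; omega
      · simp only [bump, if_true]; omega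
  · refine CutRegularExcept.solvable hm hIH (h.cutRegularExcept hm hcut hx (k := 2 * m)
      (δ := 2 * m) (p' := bump p x (-(2 * m))) (q' := q) le_rfl (by simp)
      ⟨h.endsIn, ?_, hq, h.dvd_sum, ?_⟩ ?_ ?_ ?_
      (dvd_add hdvd dvd_rfl) ?_ ?_)
    · intro v
      have := hp v
      unfold bump
      split_ifs with hv
      · subst hv; omega
      · omega
    · rw [sum_bump, if_pos hx]
      exact h.admissible.sub_left hm0 (by omega)
    · intro v
      simp only [excess, bump]
      split_ifs <;> ring
    · intro A hA
      simp only [boundary, sum_bump, if_neg hA, add_zero, le_refl]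
    · intro A hA
      simp only [boundary, sum_bump, if_pos hA]; omega
    · simp only [bump, if_true]; omega
    · simp only [bump, if_true]; omega

end RegularStep

section RegularInduction

variable {V : Type*} [DecidableEq V] {m : ℕ} {W A : Finset V} {s : Multiset (Sym2 V)}
  {t p q : V → ℤ}

lemma Solvable.of_reverse (h : Solvable m W s fun v => mdeg s v - t v) : Solvable m W s t := by
  obtain ⟨O, rfl, hO⟩ := h
  refine ⟨O.map Prod.swap, ?_, fun v hv => ?_⟩
  · unfold unoriented
    rw [Multiset.map_map]
    exact Multiset.map_congr rfl fun a _ => Sym2.eq_swap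
  · have h1 := hO v hv
    have h2 : tails (O.map Prod.swap) v = heads O v := by simp [tails, heads]
    simp only [mdeg_unoriented] at h1
    rw [h2, ← dvd_neg, show -(t v - heads O v) = tails O v + heads O v - t v - tails O v by ring]
    exact h1

lemma excess_reverse (s : Multiset (Sym2 V)) (t p q : V → ℤ) (v : V) :
    excess s (fun v => mdeg s v - t v) q p v = - excess s t p q v := by
  unfold excess; ring

lemma boundary_swap (s : Multiset (Sym2 V)) (p q : V → ℤ) (A : Finset V) :
    boundary s q p A = boundary s p q A := by
  unfold boundary; ring

lemma CutRegular.reverse (hm : 0 < m) (h : CutRegular m W s t p q) :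
    CutRegular m W s (fun v => mdeg s v - t v) q p where
  endsIn := h.endsIn
  nonneg_left := h.nonneg_right
  nonneg_right := h.nonneg_left
  dvd_sum := by
    rw [Finset.sum_sub_distrib, sum_mdeg h.endsIn, sub_right_comm, two_mul, add_sub_cancel_right,
      dvd_sub_comm]
    exact h.dvd_sum
  admissible := h.admissible.symm hm
  cut A hA hne hAW := by
    have := h.cut A hA hne hAW
    unfold CutCond at *
    simpa only [excess_reverse, Finset.sum_neg_distrib, circNorm_neg hm, boundary_swap s p q]

lemma StrongCut.reverse (hm : 0 < m) (h : StrongCut m W s t p q) :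
    StrongCut m W s (fun v => mdeg s v - t v) q p := by
  intro A hA hcard hAW
  simpa only [excess_reverse, Finset.sum_neg_distrib, circNorm_neg hm, boundary_swap s p q]
    using h A hA hcard hAW

/-- Orienting `n` edges towards `x` and cutting them at `x`. -/
lemma exists_pinch (hs : EndsIn s W) {x : V} {n : ℕ} (hn : n ≤ mcut s {x}) (p : V → ℤ) :
    ∃ s' t' q', EndsIn s' W ∧ (Solvable m W s' t' → Solvable m W s t) ∧ (∀ v, q v ≤ q' v) ∧
      q' x = q x ∧ ∑ v ∈ W, q' v = ∑ v ∈ W, q v + n ∧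
      ∑ v ∈ W, t' v - s'.card = ∑ v ∈ W, t v - s.card ∧
      (∀ v, excess s' t' p q' v = bump (excess s t p q) x n v) ∧
      (∀ A, x ∉ A → boundary s p q A ≤ boundary s' p q' A) ∧
      (∀ A, x ∈ A → boundary s p q A ≤ boundary s' p q' A + n) ∧
      mcut s' {x} = mcut s {x} - n := by
  induction n generalizing s t q with
  | zero => exact ⟨s, t, q, hs, id, fun _ => le_rfl, rfl, by simp, rfl, by simp [bump], by simp,
      by simp, by simp⟩
  | succ n ih =>
    push_cast at hn
    obtain ⟨x', hx', y, hy, hxy⟩ := exists_edge_of_mcut_pos (by omega : 0 < mcut s {x})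
    rw [Finset.mem_singleton] at hx' hy
    subst hx'
    have hW := hs _ _ hxy
    obtain ⟨s, rfl⟩ := Multiset.exists_cons_of_mem hxy
    have hcr : mcut (s(x', y) ::ₘ s) {x'} = 1 + mcut s {x'} := by simp [hy]
    rw [hcr] at hn
    obtain ⟨s', t', q', h1, h2, h3, h4, h5, h6, h7, h8, h9, h10⟩ :=
      ih (s := s) (t := bump t y (-1)) (q := bump q y 1) hs.of_cons (by omega)
    refine ⟨s', t', q', h1, fun h => ?_, fun v => ?_, ?_, ?_, ?_, fun v => ?_, fun A hA => ?_,
      fun A hA => ?_, ?_⟩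
    · rw [Sym2.eq_swap]
      exact (h2 h).of_delete
    · have := h3 v
      unfold bump at this
      split_ifs at this <;> omega
    · rw [h4, bump, if_neg hy, add_zero]
    · rw [h5, sum_bump, if_pos hW.2]; push_cast; ring
    · rw [h6, sum_bump, if_pos hW.2, Multiset.card_cons]; push_cast; ring
    · rw [h7]
      simp only [bump, excess, mdeg_cons, incid_mk]
      push_cast
      split_ifs <;> ring
    · have := h8 A hA
      simp only [boundary, sum_bump, mcut_cons, crossing_mk, hA, false_iff, ite_not] at this ⊢
      split_ifs at this ⊢ <;> omega
    · have := h9 A hA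
      simp only [boundary, sum_bump, mcut_cons, crossing_mk, hA, true_iff] at this ⊢
      push_cast
      split_ifs at this ⊢ <;> omega
    · rw [h10, hcr]; push_cast; ring

/-- All smaller regular multigraphs on the same vertices can be oriented. -/
def SolvableSmaller (m : ℕ) (W : Finset V) (s : Multiset (Sym2 V)) (p q : V → ℤ) : Prop :=
  ∀ s' t' p' q', 2 * (s'.card : ℤ) + ∑ v ∈ W, p' v + ∑ v ∈ W, q' v <
    2 * s.card + ∑ v ∈ W, p v + ∑ v ∈ W, q v → CutRegular m W s' t' p' q' → Solvable m W s' t'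

lemma CutRegular.exists_edge (hm : 2 ≤ m) (h : CutRegular m W s t p q) (hW : 3 ≤ W.card) :
    ∃ x ∈ W, ∃ y ∈ W, x ≠ y ∧ s(x, y) ∈ s := by
  obtain ⟨x, hx⟩ := Finset.card_pos.1 (by omega : 0 < W.card)
  have h1 := h.le_mcut (by omega) (A := {x}) (by simpa using hx) (by simp)
    (fun h' => by rw [← h'] at hW; simp at hW)
  obtain ⟨x', hx', y, hy, hxy⟩ := exists_edge_of_mcut_pos (by omega : 0 < mcut s {x})
  rw [Finset.mem_singleton] at hx' hy
  subst hx'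
  exact ⟨x', hx, y, (h.endsIn _ _ hxy).2, Ne.symm hy, hxy⟩

lemma CutRegular.solvable_of_forall_lt (hm : 2 ≤ m) (hIH : SolvableBelow V m W.card)
    (h : CutRegular m W s t p q) (hcut : StrongCut m W s t p q) (hW : 3 ≤ W.card)
    (hsm : SolvableSmaller m W s p q)
    (hcount : ∀ x ∈ W, ∀ y ∈ W, x ≠ y → (s.count s(x, y) : ℤ) < m - 1)
    (hpos : ∀ v ∈ W, circNorm m (excess s t p q v - 1) < circNorm m (excess s t p q v))
    (hneg : ∀ v ∈ W, ¬ circNorm m (excess s t p q v + 1) < circNorm m (excess s t p q v))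
    (hq : ∀ v ∈ W, q v = 0) : Solvable m W s t := by
  have hm0 : 0 < m := by omega
  have hp0 := h.nonneg_left
  have hq0 := h.nonneg_right
  have hqs : ∑ v ∈ W, q v = 0 := Finset.sum_eq_zero hq
  obtain ⟨x, hx, y, hy, hxy, hmem⟩ := h.exists_edge hm hW
  have hm3 : 3 ≤ m := by
    have := hcount x hx y hy hxy
    have := Multiset.count_pos.2 hmem
    omega
  by_cases had : AdmissibleBoundary m (∑ v ∈ W, p v + 1) (∑ v ∈ W, q v)
  · obtain ⟨s, rfl⟩ := Multiset.exists_cons_of_mem hmem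
    refine Solvable.of_delete (hsm _ _ (bump p y 1) q ?_ (h.of_modification hm hcut
      ⟨h.endsIn.of_cons, fun v => ?_, hq0, ?_, ?_⟩ (fun A => ?_) fun v hv => ?_))
    · rw [sum_bump, if_pos hy, Multiset.card_cons]; push_cast; omega
    · have := hp0 v
      unfold bump
      split_ifs <;> omega
    · have := h.dvd_sum
      rw [sum_bump, if_pos hx]
      rw [Multiset.card_cons] at this
      convert this using 1
      push_cast; ring
    · rwa [sum_bump, if_pos hy]
    · simp only [boundary, sum_bump, mcut_cons, crossing_mk]
      split_ifs <;> omega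
    · have h1 : excess s (bump t x (-1)) (bump p y 1) q v =
          bump (excess (s(x, y) ::ₘ s) t p q) x (-1) v := by
        simp only [bump, excess, mdeg_cons, incid_mk]
        split_ifs <;> ring
      rw [h1]
      simp only [boundary, sum_bump, mcut_cons, crossing_mk, Finset.mem_singleton]
      have h2 := hpos v hv
      rw [sub_eq_add_neg] at h2
      by_cases hxv : x = v
      · subst hxv
        simp only [bump, if_true, hxy.symm, if_false, iff_false, not_true]
        omega
      · simp only [bump, hxv, if_false, false_iff, add_zero, ite_not]
        split_ifs <;> omega
  · have hsum : ∑ v ∈ W, p v = 8 * m - 4 := by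
      have h1 := h.admissible
      rw [hqs] at h1 had
      by_contra hne
      refine had ⟨?_, ?_, h1.2.2⟩
      · have := circNorm_nonneg m (∑ v ∈ W, p v + 1 - 0)
        have := h1.2.1
        omega
      · have := h1.2.1; omega
    obtain ⟨x, hx, hpx⟩ : ∃ x ∈ W, 0 < p x := by
      by_contra! hall
      have := Finset.sum_nonpos hall
      omega
    obtain ⟨r, hr1, hrm, hr⟩ := exists_rep_of_circNorm hm0 (hpos x hx) (hneg x hx)
    obtain ⟨σ, hσ0, hσp, hσk, hσ⟩ : ∃ σ : ℤ, 1 ≤ σ ∧ σ ≤ p x ∧ σ ≤ 2 * m - r ∧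
        (σ = p x ∨ σ = 2 * m - r) :=
      ⟨min (p x) (2 * m - r), by omega, by omega, by omega, by omega⟩
    have hc1 := h.cut {x} (by simpa using hx) (by simp)
      (fun h' => by rw [← h'] at hW; simp at hW)
    unfold CutCond at hc1
    have hc2 := hcut.mcut_sub_le h hW hx
    have hc3 := circNorm_nonneg m (∑ v ∈ {x}, excess s t p q v)
    have hc4 := circNorm_nonneg m (∑ v ∈ W, excess s t p q v - excess s t p q x)
    rw [boundary_singleton] at hc1
    have hqx := hq x hx
    have hmc := mcut_nonneg s {x}
    obtain ⟨n, hn⟩ : ∃ n : ℕ, (n : ℤ) = 2 * m - r - σ :=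
      ⟨(2 * m - r - σ).toNat, Int.toNat_of_nonneg (by omega)⟩
    obtain ⟨s', t', q', h1, h2, h3, h4, h5, h6, h7, h8, h9, h10⟩ :=
      exists_pinch (m := m) (t := t) (q := q) h.endsIn (x := x) (n := n)
        (by rcases hσ with hσ | hσ <;> omega) (bump p x (-σ))
    have hmc' := mcut_nonneg s' {x}
    refine h2 (CutRegularExcept.solvable hm hIH (h.cutRegularExcept hm hcut hx (k := 2 * m - r)
      (δ := 2 * m - r) (p' := bump p x (-σ)) (by omega) (by simp) ⟨h1, fun v => ?_,
        fun v => (hq0 v).trans (h3 v), by rw [h6]; exact h.dvd_sum, ?_⟩ (fun v => ?_)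
        (fun A hA => ?_) (fun A hA => ?_) ?_ ?_ ?_))
    · have := hp0 v
      unfold bump
      split_ifs with hv
      · subst hv; omega
      · omega
    · rw [sum_bump, if_pos hx, h5, hsum, hqs, hn]
      have hcr : circNorm m (8 * m - 4 + -σ - (0 + (2 * m - r - σ))) = circNorm m (r - 4) :=
        circNorm_congr hm0 ⟨3, by ring⟩
      refine ⟨?_, by omega, by omega⟩
      rw [hcr]
      have h11 : 4 - r ≤ circNorm m (r - 4) := by
        obtain ⟨j, hj⟩ := exists_circNorm_eq m (r - 4)
        rw [hj]
        rcases lt_trichotomy j 0 with hj0 | hj0 | hj0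
        · have : (m : ℤ) * j ≤ - m := by nlinarith
          have := le_abs_self (r - 4 - 2 * m * j)
          rw [mul_assoc] at this ⊢
          omega
        · subst hj0
          have := neg_abs_le (r - 4 - 2 * m * 0)
          omega
        · have : (m : ℤ) ≤ m * j := by nlinarith
          have := neg_abs_le (r - 4 - 2 * m * j)
          rw [mul_assoc] at this ⊢
          omega
      omega
    · rw [h7]
      simp only [bump, excess]
      split_ifs <;> omega
    · have := h8 A hA
      simpa only [boundary, sum_bump, if_neg hA, add_zero] using this
    · have := h9 A hA
      simp only [boundary, sum_bump, if_pos hA] at this ⊢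
      omega
    · obtain ⟨c, hc⟩ := hr
      exact ⟨c + 1, by linear_combination hc⟩
    · rw [h10, h4, bump, if_pos rfl]
      rcases hσ with hσ | hσ <;> omega
    · rw [h10, h4, bump, if_pos rfl]
      omega

theorem CutRegular.solvable_of_smaller (hm : 2 ≤ m) (hIH : SolvableBelow V m W.card)
    (h : CutRegular m W s t p q) (hsm : SolvableSmaller m W s p q) : Solvable m W s t := by
  have hm0 : 0 < m := by omega
  have hp0 := h.nonneg_left
  have hq0 := h.nonneg_right
  rcases lt_or_ge W.card 3 with hW | hW
  · by_cases hW1 : W.card ≤ 1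
    · exact solvable_of_card_le_one h.endsIn hW1 h.dvd_sum
    · exact h.solvable_of_card_eq_two hm hIH (by omega)
  by_cases hcut : StrongCut m W s t p q
  swap
  · unfold StrongCut at hcut
    push Not at hcut
    obtain ⟨A, hA, hcard, hAW, hle⟩ := hcut
    exact h.solvable_of_boundary_le hm hIH hA hcard hAW hle
  by_cases hcount : ∃ x ∈ W, ∃ y ∈ W, x ≠ y ∧ (m : ℤ) - 1 ≤ s.count s(x, y)
  · obtain ⟨x, hx, y, hy, hxy, hle⟩ := hcount
    exact h.solvable_of_le_count hm hIH hx hy hxy (by omega)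
  push Not at hcount
  by_cases hdvd : ∃ x ∈ W, (2 * m : ℤ) ∣ excess s t p q x
  · obtain ⟨x, hx, hd⟩ := hdvd
    exact h.solvable_of_dvd_excess hm hIH hcut hW hx hd
  push Not at hdvd
  by_cases hpn : ∃ x ∈ W, 0 < p x ∧
      circNorm m (excess s t p q x + 1) < circNorm m (excess s t p q x)
  · obtain ⟨x, hx, hpx, hlt⟩ := hpn
    refine hsm s t (bump p x (-1)) q ?_ (h.of_modification hm hcut
      ⟨h.endsIn, fun v => ?_, hq0, h.dvd_sum, ?_⟩ (fun A => ?_) fun v hv => ?_)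
    · rw [sum_bump, if_pos hx]; omega
    · have := hp0 v
      unfold bump
      split_ifs with hv
      · subst hv; omega
      · omega
    · rw [sum_bump, if_pos hx]
      exact h.admissible.sub_left hm0 zero_le_one
    · simp only [boundary, sum_bump]
      split_ifs <;> omega
    · have h1 : excess s t (bump p x (-1)) q v = bump (excess s t p q) x 1 v := by
        simp only [bump, excess]
        split_ifs <;> ring
      rw [h1, boundary_singleton, boundary_singleton]
      simp only [bump]
      split_ifs with hxv
      · subst hxv; omega
      · rw [add_zero]; omega
  by_cases hqp : ∃ x ∈ W, 0 < q x ∧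
      circNorm m (excess s t p q x - 1) < circNorm m (excess s t p q x)
  · obtain ⟨x, hx, hqx, hlt⟩ := hqp
    refine hsm s t p (bump q x (-1)) ?_ (h.of_modification hm hcut
      ⟨h.endsIn, hp0, fun v => ?_, h.dvd_sum, ?_⟩ (fun A => ?_) fun v hv => ?_)
    · rw [sum_bump, if_pos hx]; omega
    · have := hq0 v
      unfold bump
      split_ifs with hv
      · subst hv; omega
      · omega
    · rw [sum_bump, if_pos hx]
      exact h.admissible.sub_right hm0 zero_le_one
    · simp only [boundary, sum_bump]
      split_ifs <;> omega
    · have h1 : excess s t p (bump q x (-1)) v = bump (excess s t p q) x (-1) v := by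
        simp only [bump, excess]
        split_ifs <;> ring
      rw [h1, boundary_singleton, boundary_singleton]
      simp only [bump]
      rw [sub_eq_add_neg] at hlt
      split_ifs with hxv
      · subst hxv; omega
      · rw [add_zero]; omega
  by_cases hedge : ∃ x ∈ W, ∃ y ∈ W, x ≠ y ∧ s(x, y) ∈ s ∧
      circNorm m (excess s t p q x - 1) < circNorm m (excess s t p q x) ∧
      circNorm m (excess s t p q y + 1) < circNorm m (excess s t p q y)
  · obtain ⟨x, hx, y, hy, hxy, hmem, hltx, hlty⟩ := hedge
    obtain ⟨s, rfl⟩ := Multiset.exists_cons_of_mem hmem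
    refine Solvable.of_delete (hsm _ _ p q ?_ (h.of_modification hm hcut
      ⟨h.endsIn.of_cons, hp0, hq0, ?_, h.admissible⟩ (fun A => ?_) fun v hv => ?_))
    · rw [Multiset.card_cons]; push_cast; omega
    · have := h.dvd_sum
      rw [sum_bump, if_pos hx]
      rw [Multiset.card_cons] at this
      convert this using 1
      push_cast; ring
    · simp only [boundary, mcut_cons, crossing_mk]
      split_ifs <;> omega
    · have h1 : excess s (bump t x (-1)) p q v =
          bump (bump (excess (s(x, y) ::ₘ s) t p q) x (-1)) y 1 v := by
        simp only [bump, excess, mdeg_cons, incid_mk]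
        split_ifs <;> ring
      rw [h1]
      simp only [boundary, mcut_cons, crossing_mk, Finset.mem_singleton]
      rw [sub_eq_add_neg] at hltx
      by_cases hxv : x = v
      · subst hxv
        simp only [bump, if_true, hxy.symm, if_false, iff_false, not_true, add_zero]
        omega
      · by_cases hyv : y = v
        · subst hyv
          simp only [bump, if_true, hxv, if_false, iff_true, add_zero]
          omega
        · simp [bump, hxv, hyv]
  push Not at hpn hqp hedge
  have hor := fun v (hv : v ∈ W) => circNorm_sub_one_or_add_one hm0 (hdvd v hv)
  have hone : ∀ A ⊆ W, A.Nonempty → A ≠ W → ∃ x ∈ A, ∃ y ∈ W, y ∉ A ∧ x ≠ y ∧ s(x, y) ∈ s := by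
    intro A hA hne hAW
    have h1 := h.le_mcut hm0 hA hne hAW
    obtain ⟨x, hx, y, hy, hxy⟩ := exists_edge_of_mcut_pos (by omega : 0 < mcut s A)
    exact ⟨x, hx, y, (h.endsIn _ _ hxy).2, hy, fun h' => hy (h' ▸ hx), hxy⟩
  have hsing : ∀ v ∈ W, ∃ y ∈ W, v ≠ y ∧ s(v, y) ∈ s := by
    intro v hv
    obtain ⟨x, hx, y, hy, _, hne, hmem⟩ := hone {v} (by simpa using hv) (by simp)
      (fun h' => by rw [← h'] at hW; simp at hW)
    rw [Finset.mem_singleton] at hx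
    subst hx
    exact ⟨y, hy, hne, hmem⟩
  classical
  set P := W.filter fun v => circNorm m (excess s t p q v - 1) < circNorm m (excess s t p q v)
    with hP
  by_cases hPW : P = W
  · have hpos : ∀ v ∈ W, circNorm m (excess s t p q v - 1) < circNorm m (excess s t p q v) :=
      fun v hv => by rw [← hPW, hP] at hv; exact (Finset.mem_filter.1 hv).2
    refine h.solvable_of_forall_lt hm hIH hcut hW hsm hcount hpos (fun v hv hlt => ?_)
      fun v hv => ?_
    · obtain ⟨y, hy, hne, hmem⟩ := hsing v hv
      rw [Sym2.eq_swap] at hmem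
      exact (hedge y hy v hv hne.symm hmem (hpos y hy)).not_gt hlt
    · have := hq0 v
      by_contra hne
      exact (hqp v hv (by omega)).not_gt (hpos v hv)
  by_cases hPe : P.Nonempty
  · obtain ⟨x, hx, y, hy, hyP, hne, hmem⟩ := hone P (Finset.filter_subset _ _) hPe hPW
    have hx' := Finset.mem_filter.1 hx
    refine absurd ((hor y hy).resolve_left fun h' => hyP (Finset.mem_filter.2 ⟨hy, h'⟩)) ?_
    exact (hedge x hx'.1 y hy hne hmem hx'.2).not_gt
  · have hnp : ∀ v ∈ W, ¬ circNorm m (excess s t p q v - 1) < circNorm m (excess s t p q v) :=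
      fun v hv h' => hPe ⟨v, Finset.mem_filter.2 ⟨hv, h'⟩⟩
    have hng := fun v (hv : v ∈ W) => (hor v hv).resolve_left (hnp v hv)
    have e1 : ∀ v, circNorm m (-excess s t p q v - 1) = circNorm m (excess s t p q v + 1) :=
      fun v => by rw [← circNorm_neg hm0]; congr 1; ring
    have e2 : ∀ v, circNorm m (-excess s t p q v + 1) = circNorm m (excess s t p q v - 1) :=
      fun v => by rw [← circNorm_neg hm0]; congr 1; ring
    refine Solvable.of_reverse ((h.reverse hm0).solvable_of_forall_lt hm hIH (hcut.reverse hm0) hW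
      (fun s' t' p' q' hlt => hsm s' t' p' q' (by omega)) hcount (fun v hv => ?_)
      (fun v hv => ?_) fun v hv => ?_)
    · rw [excess_reverse, e1, circNorm_neg hm0]; exact hng v hv
    · rw [excess_reverse, e2, circNorm_neg hm0]; exact hnp v hv
    · have := hp0 v
      by_contra hne
      exact (hpn v hv (by omega)).not_gt (hng v hv)

theorem CutRegular.solvable_of_solvableBelow (hm : 2 ≤ m) (hIH : SolvableBelow V m W.card)
    (h : CutRegular m W s t p q) : Solvable m W s t := by
  induction hn : (2 * (s.card : ℤ) + ∑ v ∈ W, p v + ∑ v ∈ W, q v).toNat using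
    Nat.strong_induction_on generalizing s t p q with
  | _ n ih =>
  subst hn
  refine h.solvable_of_smaller hm hIH fun s' t' p' q' hlt h' => ih _ ?_ h' rfl
  have h1 := Finset.sum_nonneg fun v (_ : v ∈ W) => h'.nonneg_left v
  have h2 := Finset.sum_nonneg fun v (_ : v ∈ W) => h'.nonneg_right v
  omega

theorem solvableBelow (hm : 2 ≤ m) (n : ℕ) : SolvableBelow V m n := by
  induction n with
  | zero => exact fun _ _ _ _ _ h => absurd h (by omega)
  | succ n ih =>
    intro W s t p q hlt
    have hIH : SolvableBelow V m W.card := fun W' s' t' p' q' h => ih W' s' t' p' q' (by omega)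
    exact ⟨fun h => h.solvable_of_solvableBelow hm hIH, fun e h => h.solvable hm hIH⟩

/-- The orientation theorem: a regular multigraph has an orientation with prescribed out-degrees
modulo `m`. -/
theorem CutRegular.solvable (hm : 2 ≤ m) (h : CutRegular m W s t p q) : Solvable m W s t :=
  h.solvable_of_solvableBelow hm (solvableBelow hm _)

end RegularInduction

section InitialInstance

variable {V : Type*}

/-- Every edge of `s` has exactly one end in `X`. -/
def IsCrossing (s : Multiset (Sym2 V)) (X : Finset V) : Prop :=
  ∀ x y, s(x, y) ∈ s → (x ∈ X ↔ y ∉ X)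

lemma IsCrossing.mono {s s' : Multiset (Sym2 V)} {X : Finset V} (h : IsCrossing s X)
    (hs : s' ≤ s) : IsCrossing s' X := fun x y hxy => h x y (Multiset.mem_of_le hs hxy)

variable [DecidableEq V] {m : ℕ}

/-- The edges of `s` with both ends in `A`. -/
def edgesIn (s : Multiset (Sym2 V)) (A : Finset V) : Multiset (Sym2 V) := s.filter (· ∈ A.sym2)

lemma edgesIn_le (s : Multiset (Sym2 V)) (A : Finset V) : edgesIn s A ≤ s :=
  Multiset.filter_le _ _

lemma edgesIn_cons (x y : V) (s : Multiset (Sym2 V)) (A : Finset V) :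
    edgesIn (s(x, y) ::ₘ s) A =
      if x ∈ A ∧ y ∈ A then s(x, y) ::ₘ edgesIn s A else edgesIn s A := by
  simp only [edgesIn, Multiset.filter_cons, Finset.mk_mem_sym2_iff]
  split_ifs <;> simp

lemma endsIn_edgesIn (s : Multiset (Sym2 V)) (A : Finset V) : EndsIn (edgesIn s A) A :=
  fun _ _ h => Finset.mk_mem_sym2_iff.1 (Multiset.mem_filter.1 h).2

lemma mdeg_nonneg (s : Multiset (Sym2 V)) (v : V) : 0 ≤ mdeg s v := by
  have := mdeg_eq_count_add_mcut s v
  have := mcut_nonneg s {v}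
  omega

lemma mdeg_edgesIn_le (s : Multiset (Sym2 V)) (A : Finset V) (v : V) :
    mdeg (edgesIn s A) v ≤ mdeg s v := by
  obtain ⟨r, hr⟩ := Multiset.le_iff_exists_add.1 (edgesIn_le s A)
  have := mdeg_nonneg r v
  rw [hr, mdeg_add, ← hr]
  omega

lemma mcut_eq_mcut_edgesIn_add (s : Multiset (Sym2 V)) {A B : Finset V} (hB : B ⊆ A) :
    mcut s B = mcut (edgesIn s A) B + ∑ v ∈ B, (mdeg s v - mdeg (edgesIn s A) v) := by
  induction s using Multiset.induction_on with
  | empty => simp [edgesIn]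
  | cons e s ih =>
    induction e using Sym2.ind with
    | _ x y =>
      rw [edgesIn_cons, mcut_cons, ih]
      split_ifs with hxy
      · simp only [mcut_cons, mdeg_cons, add_sub_add_left_eq_sub]
        ring
      · simp only [mdeg_cons, add_sub_assoc, Finset.sum_add_distrib, sum_incid, crossing_mk]
        have hx := @hB x
        have hy := @hB y
        split_ifs <;> first | omega | (exfalso; tauto)

lemma IsCrossing.mdeg_eq_mcut {s : Multiset (Sym2 V)} {X : Finset V} (h : IsCrossing s X) (v : V) :
    mdeg s v = mcut s {v} := by
  rw [mdeg_eq_count_add_mcut, Multiset.count_eq_zero_of_notMem fun hv => iff_not_self (h v v hv)]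
  simp

lemma IsCrossing.sum_mdeg_eq_card {s : Multiset (Sym2 V)} {X W : Finset V} (h : IsCrossing s X)
    (hW : EndsIn s W) : ∑ v ∈ W, (if v ∈ X then 0 else mdeg s v) = s.card := by
  induction s using Multiset.induction_on with
  | empty => simp
  | cons e s ih =>
    induction e using Sym2.ind with
    | _ x y =>
      have h1 := ih (h.mono (Multiset.le_cons_self _ _)) hW.of_cons
      have h2 := h x y (Multiset.mem_cons_self _ _)
      have h3 := hW x y (Multiset.mem_cons_self _ _)
      have h4 : ∀ v, (if v ∈ X then 0 else mdeg (s(x, y) ::ₘ s) v) =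
          (if x = v then if x ∈ X then 0 else 1 else 0) +
          (if y = v then if y ∈ X then 0 else 1 else 0) + if v ∈ X then 0 else mdeg s v := by
        intro v
        rw [mdeg_cons, incid_mk]
        grind
      simp only [h4, Finset.sum_add_distrib, h1, Multiset.card_cons, Finset.sum_ite_eq, h3, if_true]
      by_cases hx : x ∈ X <;> by_cases hy : y ∈ X <;> simp_all [add_comm]

lemma mdeg_unoriented_filter {O : Multiset (V × V)} {X : Finset V}
    (h : IsCrossing (unoriented O) X) (v : V) :
    mdeg (unoriented (O.filter (·.1 ∈ X))) v = if v ∈ X then tails O v else heads O v := by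
  induction O using Multiset.induction_on with
  | empty => simp
  | cons a O ih =>
    have h1 := ih (h.mono (by rw [unoriented_cons]; exact Multiset.le_cons_self _ _))
    have h2 := h a.1 a.2 (by rw [unoriented_cons]; exact Multiset.mem_cons_self _ _)
    by_cases ha : a.1 ∈ X
    · rw [Multiset.filter_cons_of_pos (a := a) O ha, unoriented_cons, mdeg_cons, h1, incid_mk,
        tails_cons, heads_cons]
      by_cases hx : a.1 = v <;> by_cases hy : a.2 = v <;> by_cases hv : v ∈ X <;> simp_all
    · rw [Multiset.filter_cons_of_neg (a := a) O ha, h1, tails_cons, heads_cons]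
      by_cases hx : a.1 = v <;> by_cases hy : a.2 = v <;> by_cases hv : v ∈ X <;> simp_all

lemma mdeg_eq_zero {s : Multiset (Sym2 V)} {W : Finset V} (h : EndsIn s W) {v : V} (hv : v ∉ W) :
    mdeg s v = 0 := by
  induction s using Multiset.induction_on with
  | empty => simp
  | cons e s ih =>
    induction e using Sym2.ind with
    | _ x y =>
      have h1 := h x y (Multiset.mem_cons_self _ _)
      rw [mdeg_cons, ih h.of_cons, incid_mk, if_neg (by rintro rfl; exact hv h1.1),
        if_neg (by rintro rfl; exact hv h1.2)]
      rfl


/-- A crossing multigraph whose cuts are large has a nonempty submultigraph with all degrees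
divisible by `m`. -/
theorem exists_le_dvd_mdeg_of_le_mcut (hm : 2 ≤ m) {s : Multiset (Sym2 V)} {X A : Finset V}
    (hX : IsCrossing s X) (hdeg : ∀ v, 6 * (m : ℤ) - 3 ≤ mdeg s v) (hcard : 2 ≤ A.card)
    (hA : mcut s A ≤ 7 * m - 6)
    (hmin : ∀ B ⊆ A, 2 ≤ B.card → B ≠ A → 7 * (m : ℤ) - 6 < mcut s B) :
    ∃ r ≤ s, r ≠ 0 ∧ ∀ v, (m : ℤ) ∣ mdeg r v := by
  have hm0 : 0 < m := by omega
  have hcA := mcut_eq_mcut_edgesIn_add s (Finset.Subset.refl A)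
  rw [mcut_eq_zero (endsIn_edgesIn s A), zero_add] at hcA
  obtain ⟨a, b, ha, hab⟩ : ∃ a b, a ∈ X ∧ s(a, b) ∈ edgesIn s A := by
    have hne : edgesIn s A ≠ 0 := by
      intro h0
      simp only [h0, mdeg_zero, sub_zero] at hcA
      have h1 := Finset.card_nsmul_le_sum A (fun v => mdeg s v) _ fun v _ => hdeg v
      rw [nsmul_eq_mul] at h1
      have h2 : (2 : ℤ) ≤ A.card := by exact_mod_cast hcard
      nlinarith
    obtain ⟨e, he⟩ := Multiset.exists_mem_of_ne_zero hne
    induction e using Sym2.ind with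
    | _ x y =>
      by_cases hx : x ∈ X
      · exact ⟨x, y, hx, he⟩
      · have := hX x y (Multiset.mem_of_le (edgesIn_le s A) he)
        exact ⟨y, x, by tauto, by rwa [Sym2.eq_swap]⟩
  obtain ⟨r, hr⟩ := Multiset.exists_cons_of_mem hab
  have hin := endsIn_edgesIn s A
  have hXin := hX.mono (edgesIn_le s A)
  have hle := mdeg_edgesIn_le s A
  have hcut := fun B (hB : B ⊆ A) => mcut_eq_mcut_edgesIn_add s hB
  have hsub := edgesIn_le s A
  generalize edgesIn s A = s' at *
  subst hr
  have habA := hin a b hab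
  have hb : b ∉ X := (hXin a b hab).1 ha
  have hne : a ≠ b := fun h => hb (h ▸ ha)
  have hrX := hXin.mono (Multiset.le_cons_self _ _)
  set t : V → ℤ := bump (bump (fun v => if v ∈ X then 0 else mdeg r v) a (-1)) b 1 with ht
  set d : V → ℤ := fun v => mdeg s v - mdeg (s(a, b) ::ₘ r) v with hd
  have hd0 : ∀ v, 0 ≤ d v := fun v => sub_nonneg.2 (hle v)
  set p : V → ℤ := fun v => if v ∈ X then d v else 0 with hp
  set q : V → ℤ := fun v => if v ∈ X then 0 else d v with hq
  have hpq : ∀ B : Finset V, ∑ v ∈ B, p v + ∑ v ∈ B, q v = ∑ v ∈ B, d v := fun B => by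
    rw [← Finset.sum_add_distrib]
    refine Finset.sum_congr rfl fun v _ => ?_
    simp only [hp, hq]
    split_ifs <;> ring
  have hbd : ∀ B ⊆ A, boundary r p q B = mcut s B - crossing B s(a, b) := by
    intro B hB
    rw [boundary, add_assoc, hpq, hcut B hB, mcut_cons]; ring
  have hreg : CutRegular m A r t p q := by
    refine ⟨⟨hin.of_cons, fun v => ?_, fun v => ?_, ?_, ?_⟩, fun B hB hBne hBA => ?_⟩
    · have := hd0 v
      simp only [hp]; split_ifs <;> omega
    · have := hd0 v
      simp only [hq]; split_ifs <;> omega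
    · rw [ht, sum_bump, sum_bump, if_pos habA.1, if_pos habA.2, hrX.sum_mdeg_eq_card hin.of_cons]
      simp
    · have h1 := (hpq A).trans hcA.symm
      have h2 := circNorm_nonneg m (∑ v ∈ A, p v - ∑ v ∈ A, q v)
      refine admissibleBoundary_of_le hm (Finset.sum_nonneg fun v _ => ?_)
        (Finset.sum_nonneg fun v _ => ?_) (by omega)
      · have := hd0 v
        simp only [hp]; split_ifs <;> omega
      · have := hd0 v
        simp only [hq]; split_ifs <;> omega
    · unfold CutCond
      rw [hbd B hB]
      by_cases hcB : 2 ≤ B.card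
      · have h1 := hmin B hB hcB hBA
        have h2 := circNorm_le_half hm0 (∑ v ∈ B, excess r t p q v)
        rw [crossing_mk]
        split_ifs <;> omega
      · obtain ⟨v, rfl⟩ := Finset.card_eq_one.1
          (by have := Finset.card_pos.2 hBne; omega : B.card = 1)
        rw [← hX.mdeg_eq_mcut, Finset.sum_singleton]
        obtain ⟨ε, hε, hε0, hε1⟩ : ∃ ε, ε = crossing {v} s(a, b) ∧ 0 ≤ ε ∧ ε ≤ 1 :=
          ⟨_, rfl, crossing_nonneg _ _, by rw [crossing_mk]; split_ifs <;> norm_num⟩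
        have hex : circNorm m (excess r t p q v) = circNorm m (mdeg s v + ε) := by
          have key : excess r t p q v =
              if v ∈ X then -(mdeg s v + ε) else mdeg s v + ε := by
            rw [hε]
            simp only [excess, ht, hp, hq, hd, bump, crossing_mk, mdeg_cons, incid_mk,
              Finset.mem_singleton]
            by_cases hav : a = v
            · subst hav
              simp only [ha, hne.symm, if_true, if_false, iff_false, not_true]
              ring
            · by_cases hbv : b = v
              · subst hbv
                simp only [hb, hav, if_true, if_false, iff_true]
                ring
              · simp only [hav, hbv, if_false, iff_self, if_true]
                split_ifs <;> ring
          rw [key]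
          split_ifs
          · exact circNorm_neg hm0 _
          · rfl
        have h1 := circNorm_le hm0 (mdeg s v + ε) 3
        have h2 := hdeg v
        rw [hex, ← hε]
        rcases abs_cases (mdeg s v + ε - 2 * m * 3) with ⟨h3, _⟩ | ⟨h3, _⟩ <;> omega
  obtain ⟨O, rfl, hO⟩ := hreg.solvable hm
  have hle' : s(a, b) ::ₘ unoriented (O.filter (·.1 ∈ X)) ≤ s(a, b) ::ₘ unoriented O :=
    Multiset.cons_le_cons _ (Multiset.map_le_map (Multiset.filter_le _ _))
  refine ⟨_, hle'.trans hsub, Multiset.cons_ne_zero, fun v => ?_⟩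
  by_cases hv : v ∈ A
  · have h1 := hO v hv
    rw [mdeg_cons, mdeg_unoriented_filter hrX, incid_mk]
    simp only [ht, bump, mdeg_unoriented] at h1
    by_cases hvX : v ∈ X
    · have hbv : b ≠ v := fun h => hb (h ▸ hvX)
      rw [if_pos hvX, if_neg hbv, ← Int.dvd_neg]
      rw [if_pos hvX, if_neg hbv] at h1
      convert h1 using 1
      split_ifs <;> ring
    · have hav : a ≠ v := fun h => hvX (h ▸ ha)
      rw [if_neg hvX, if_neg hav]
      rw [if_neg hvX, if_neg hav] at h1
      convert h1 using 1
      ring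
  · rw [mdeg_eq_zero (hin.mono hle') hv]
    exact dvd_zero _

lemma mdeg_edgeFinset (G : SimpleGraph V) [Fintype G.edgeSet] (v : V)
    [Fintype (G.neighborSet v)] :
    mdeg G.edgeFinset.val v = G.degree v := by
  rw [← G.card_incidenceFinset_eq_degree, G.incidenceFinset_eq_filter, Finset.natCast_card_filter]
  refine Finset.sum_congr rfl fun e he => ?_
  induction e using Sym2.ind with
  | _ x y =>
    have := (SimpleGraph.mem_edgeFinset.1 he : G.Adj x y).ne
    rw [incid_mk]
    grind

variable [Fintype V]

/-- Every graph has a spanning bipartite subgraph in which all degrees are at least half as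
large. -/
lemma exists_isCrossing (G : SimpleGraph V) [DecidableRel G.Adj] :
    ∃ X, ∃ s ≤ G.edgeFinset.val, IsCrossing s X ∧ ∀ v, (G.degree v : ℤ) ≤ 2 * mdeg s v := by
  obtain ⟨X, -, hX⟩ := Finset.exists_max_image Finset.univ (fun X => mcut G.edgeFinset.val X)
    Finset.univ_nonempty
  refine ⟨X, (G.edgeFinset.filter (crossing X · = 1)).val, ?_, fun x y hxy => ?_, fun v => ?_⟩
  · exact Finset.val_le_iff.2 (Finset.filter_subset _ _)
  · have h := (Finset.mem_filter.1 hxy).2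
    rw [crossing_mk] at h
    grind
  · have h1 := hX (symmDiff X {v}) (Finset.mem_univ _)
    have h2 : mcut G.edgeFinset.val (symmDiff X {v}) = mcut G.edgeFinset.val X +
        (mdeg G.edgeFinset.val v -
          2 * mdeg (G.edgeFinset.filter (crossing X · = 1)).val v) := by
      change ∑ e ∈ _, _ = ∑ e ∈ _, _ + (∑ e ∈ _, _ - 2 * ∑ e ∈ _, _)
      rw [Finset.sum_filter, Finset.mul_sum, ← Finset.sum_sub_distrib, ← Finset.sum_add_distrib]
      refine Finset.sum_congr rfl fun e he => ?_
      induction e using Sym2.ind with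
      | _ x y =>
        have := (SimpleGraph.mem_edgeFinset.1 he : G.Adj x y).ne
        simp only [crossing_mk, incid_mk, Finset.mem_symmDiff, Finset.mem_singleton]
        grind
    rw [mdeg_edgeFinset] at h2
    omega

/-- A graph of minimum degree at least `12 * m - 6` has a nonempty subgraph in which all degrees
are divisible by `m`. -/
theorem exists_subgraph_dvd_degree (hm : 2 ≤ m) [Nontrivial V] (G : SimpleGraph V)
    [DecidableRel G.Adj] (hG : ∀ v, 12 * m - 6 ≤ G.degree v) :
    ∃ H ≤ G, H.edgeSet.Nonempty ∧ ∀ v, m ∣ Nat.card (H.neighborSet v) := by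
  classical
  obtain ⟨X, s, hs, hX, hdeg⟩ := exists_isCrossing G
  obtain ⟨A, hA, hmin⟩ := Finset.exists_min_image
    (Finset.univ.filter fun A : Finset V => 2 ≤ A.card ∧ mcut s A ≤ 7 * m - 6) Finset.card
    ⟨Finset.univ, Finset.mem_filter.2 ⟨Finset.mem_univ _, Fintype.one_lt_card, by
      rw [mcut_eq_zero fun x y _ => ⟨Finset.mem_univ x, Finset.mem_univ y⟩]; omega⟩⟩
  simp only [Finset.mem_filter, Finset.mem_univ, true_and] at hA hmin
  obtain ⟨r, hr, hr0, hdvd⟩ := exists_le_dvd_mdeg_of_le_mcut hm hX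
    (fun v => by have := hdeg v; have := hG v; omega) hA.1 hA.2 fun B hB hcard hne => by
      by_contra hle
      have h1 := hmin B ⟨hcard, not_lt.1 hle⟩
      exact (Finset.card_lt_card (hB.ssubset_of_ne hne)).not_ge h1
  have hrG := hr.trans hs
  have hmem : ∀ e ∈ r, e ∈ G.edgeSet := fun e he =>
    SimpleGraph.mem_edgeFinset.1 (Multiset.mem_of_le hrG he)
  have hE : (SimpleGraph.fromEdgeSet {e | e ∈ r}).edgeSet = {e | e ∈ r} := by
    rw [SimpleGraph.edgeSet_fromEdgeSet, sdiff_eq_left, Set.disjoint_left]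
    exact fun e he => G.not_isDiag_of_mem_edgeSet (hmem e he)
  refine ⟨SimpleGraph.fromEdgeSet {e | e ∈ r}, ?_, ?_, fun v => ?_⟩
  · rw [← SimpleGraph.edgeSet_subset_edgeSet, hE]
    exact hmem
  · rw [hE]
    exact Multiset.exists_mem_of_ne_zero hr0
  · have hval : (SimpleGraph.fromEdgeSet {e | e ∈ r}).edgeFinset.val = r := by
      refine (Multiset.Nodup.ext (Finset.nodup _) (Multiset.nodup_of_le hrG (Finset.nodup _))).2
        fun e => ?_
      rw [Finset.mem_val, SimpleGraph.mem_edgeFinset, hE]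
      rfl
    have h1 := hdvd v
    rw [← hval, mdeg_edgeFinset, Int.natCast_dvd_natCast] at h1
    rwa [Nat.card_eq_fintype_card, SimpleGraph.card_neighborSet_eq_degree]

end InitialInstance

/-- Every degree of an `m`-connected graph is at least `m`. -/
lemma IsMConnected.le_degree {V : Type*} [Fintype V] {G : SimpleGraph V}
    [DecidableRel G.Adj] {m : ℕ} (h : IsMConnected G m) (v : V) : m ≤ G.degree v := by
  classical
  by_contra! hlt
  have hdeg : (G.neighborFinset v).card = G.degree v := G.card_neighborFinset_eq_degree v
  obtain ⟨w, hw, hwv⟩ : ∃ w, w ∉ G.neighborFinset v ∧ w ≠ v := by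
    by_contra! hall
    have h1 : Finset.univ ⊆ insert v (G.neighborFinset v) := fun w _ => by
      rw [Finset.mem_insert]
      exact or_iff_not_imp_right.2 (hall w)
    have h2 := (Finset.card_le_card h1).trans (Finset.card_insert_le _ _)
    have h3 := h.1
    rw [Finset.card_univ] at h2
    omega
  have hconn := h.2 (G.neighborFinset v) (by omega)
  have hv : v ∉ G.neighborFinset v := by simp
  have : Nontrivial {u : V | u ∉ G.neighborFinset v} :=
    ⟨⟨w, hw⟩, ⟨v, hv⟩, fun h' => hwv (congrArg Subtype.val h')⟩
  obtain ⟨u, hu⟩ := hconn.preconnected.exists_adj_of_nontrivial ⟨v, hv⟩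
  exact u.2 ((G.mem_neighborFinset v u).2 hu)

theorem k_divisible_subgraph_of_connected (k : ℕ) (hk : 2 ≤ k)
    {V : Type*} [Fintype V] [DecidableEq V] (H : SimpleGraph V)
    (hconn : IsMConnected H (12 * k - 6)) :
    ∃ H' : SimpleGraph V, H' ≤ H ∧ H'.edgeSet.Nonempty ∧
      ∀ v : V, k ∣ Nat.card (H'.neighborSet v) := by
  classical
  have : Nontrivial V := Fintype.one_lt_card_iff_nontrivial.1 (by have := hconn.1; omega)
  exact exists_subgraph_dvd_degree hk H hconn.le_degree
end
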